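/- arXiv:math/0502269 — 4 statements merged into one kernel-verified Lean document; each statement's English description precedes it below -/
import Mathlib

section
/- Let (W,S) be a Coxeter system satisfying conditions (1), (2), (3) below, let (W',S') be a Coxeter system, and let φ: W → W' be a group isomorphism such that φ maps every reflection of (W,S) to a reflection of (W',S'). Then there does not exist a three-element subset {s',t',u'} ⊆ S' such that m'(s',t') and m'(t',u') are both odd. Conditions: (1) for each s,t ∈ S with m(s,t) odd, {s,t} is a maximal spherical subset of S; (2) there is no three-element subset {s,t,u} ⊆ S with m(s,t) and m(t,u) both odd; (3) for each s,t ∈ S with m(s,t) odd, at most two maximal spherical subsets of S intersect {s,t}. -/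
/-!
In Mathlib's `CoxeterMatrix`, the entry `M i j : ℕ` is the order of `s i * s j`,
with `0` encoding the order `∞`.
-/

/-- The parabolic subgroup `W_T` of `W` generated by the simple reflections indexed by `T ⊆ S`. -/
def CoxeterSystem.parabolic {B W : Type*} [Group W] {M : CoxeterMatrix B}
    (cs : CoxeterSystem M W) (T : Set B) : Subgroup W :=
  Subgroup.closure (cs.simple '' T)

/-- `T` is a spherical subset of `S`: the parabolic subgroup `W_T` is finite. -/
def CoxeterSystem.IsSpherical {B W : Type*} [Group W] {M : CoxeterMatrix B}
    (cs : CoxeterSystem M W) (T : Set B) : Prop :=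
  ((cs.parabolic T : Subgroup W) : Set W).Finite

/-- `T` is a maximal spherical subset of `S`. -/
def CoxeterSystem.IsMaxSpherical {B W : Type*} [Group W] {M : CoxeterMatrix B}
    (cs : CoxeterSystem M W) (T : Set B) : Prop :=
  cs.IsSpherical T ∧ ∀ U : Set B, cs.IsSpherical U → T ⊆ U → U = T

set_option linter.unusedSectionVars false

namespace OddChain

open Real CoxeterSystem

section geom

variable {B W : Type*} [Group W] [Fintype B] [DecidableEq B] (M : CoxeterMatrix B)

/-- cosine matrix entry -/
noncomputable def cosE (i j : B) : ℝ := -Real.cos (Real.pi / (M i j : ℝ))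

noncomputable def bil : LinearMap.BilinForm ℝ (B → ℝ) :=
  Matrix.toBilin' (Matrix.of (cosE M))

/-- simple root -/
def al (i : B) : B → ℝ := Pi.single i 1

lemma al_self (i : B) : al i i = 1 := by simp [al]

lemma al_ne {i j : B} (h : j ≠ i) : al i j = 0 := by simp [al, h]

lemma bil_al (i j : B) : bil M (al i) (al j) = cosE M i j := by
  simp [bil, al, Matrix.toBilin'_single]

lemma cosE_symm (i j : B) : cosE M i j = cosE M j i := by
  simp [cosE, M.symmetric i j]

lemma cosE_self (i : B) : cosE M i i = 1 := by
  simp [cosE]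

lemma bil_symm (v w : B → ℝ) : bil M v w = bil M w v := by
  simp only [bil, Matrix.toBilin'_apply]
  rw [Finset.sum_comm]
  refine Finset.sum_congr rfl fun i _ => Finset.sum_congr rfl fun j _ => ?_
  simp only [Matrix.of_apply]
  rw [cosE_symm M j i]; ring

/-- simple reflection -/
noncomputable def sig (i : B) : Module.End ℝ (B → ℝ) :=
  LinearMap.id - (2 : ℝ) • (bil M (al i)).smulRight (al i)

lemma sig_apply (i : B) (v : B → ℝ) : sig M i v = v - (2 * bil M (al i) v) • al i := by
  simp [sig, smul_smul]

lemma sig_sig (i : B) : sig M i * sig M i = 1 := by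
  ext1 v
  ext x
  simp [sig_apply, bil_al, cosE_self]
  ring

lemma sig_al (i j : B) : sig M i (al j) = al j - (2 * cosE M i j) • al i := by
  rw [sig_apply, bil_al]

/-- the Chebyshev-like sequence -/
noncomputable def chS (θ : ℝ) : ℕ → ℝ
  | 0 => 0
  | 1 => 1
  | (n+2) => 2 * Real.cos θ * chS θ (n+1) - chS θ n

lemma chS_sin (θ : ℝ) : ∀ n : ℕ, chS θ n * Real.sin θ = Real.sin (n * θ)
  | 0 => by simp [chS]
  | 1 => by simp [chS]
  | (n+2) => by
    have h1 := chS_sin θ (n+1)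
    have h2 := chS_sin θ n
    rw [chS, sub_mul, mul_assoc, h1, h2]
    push_cast
    have e1 : ((n:ℝ) + 2) * θ = (n + 1) * θ + θ := by ring
    have e2 : (n:ℝ) * θ = (n + 1) * θ - θ := by ring
    rw [e1, e2, Real.sin_add, Real.sin_sub]
    ring

lemma chS_zero : ∀ n : ℕ, chS 0 n = n
  | 0 => by simp [chS]
  | 1 => by simp [chS]
  | (n+2) => by
    rw [chS, chS_zero (n+1), chS_zero n]; push_cast; simp; ring

lemma sin_pos_of {i j : B} (hij : i ≠ j) (h0 : M i j ≠ 0) : 0 < Real.sin (Real.pi / (M i j : ℝ)) := by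
  have h1 : M i j ≠ 1 := M.off_diagonal i j hij
  have h2 : (2:ℝ) ≤ M i j := by exact_mod_cast (by omega : 2 ≤ M i j)
  apply Real.sin_pos_of_pos_of_lt_pi
  · positivity
  · rw [div_lt_iff₀ (by linarith)]
    nlinarith [Real.pi_pos]

lemma chS_nonneg {i j : B} (hij : i ≠ j) (k : ℕ) (hk : M i j ≠ 0 → k ≤ M i j) :
    0 ≤ chS (Real.pi / (M i j : ℝ)) k := by
  by_cases h0 : M i j = 0
  · rw [h0]; simp [chS_zero]
  · have hs := sin_pos_of M hij h0
    have h := chS_sin (Real.pi / (M i j : ℝ)) k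
    have hM : (0:ℝ) < M i j := by exact_mod_cast Nat.pos_of_ne_zero h0
    have : 0 ≤ Real.sin (k * (Real.pi / (M i j : ℝ))) := by
      apply Real.sin_nonneg_of_nonneg_of_le_pi
      · positivity
      · have hk' : (k:ℝ) ≤ M i j := by exact_mod_cast hk h0
        rw [← mul_div_assoc, div_le_iff₀ hM]
        nlinarith [Real.pi_pos]
    rw [← h] at this
    exact nonneg_of_mul_nonneg_left this hs

lemma sig_comb (i j : B) (x y : ℝ) :
    sig M i (x • al i + y • al j) = (-x + 2 * Real.cos (Real.pi / (M i j : ℝ)) * y) • al i + y • al j := by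
  rw [map_add, map_smul, map_smul, sig_al, sig_al, cosE_self]
  simp only [cosE]
  module

lemma rot_pow (i j : B) (k : ℕ) :
    ((sig M i * sig M j) ^ k) (al i) = chS (Real.pi / (M i j : ℝ)) (2*k+1) • al i +
      chS (Real.pi / (M i j : ℝ)) (2*k) • al j := by
  induction k with
  | zero => simp [chS]
  | succ k ih =>
    rw [pow_succ', Module.End.mul_apply, ih, Module.End.mul_apply, add_comm, sig_comb, add_comm,
      sig_comb, M.symmetric j i]
    have e1 : 2 * (k+1) + 1 = (2*k+1) + 2 := by ring
    have e2 : 2 * (k+1) = 2*k + 2 := by ring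
    rw [e1, e2, chS, chS]
    congr 2 <;> ring

lemma rot_full (i j : B) (hij : i ≠ j) (h0 : M i j ≠ 0) :
    ((sig M i * sig M j) ^ (M i j)) (al i) = al i := by
  rw [rot_pow]
  have hs := sin_pos_of M hij h0
  set θ := Real.pi / (M i j : ℝ) with hθ
  have hM : (M i j : ℝ) ≠ 0 := by exact_mod_cast h0
  have e : (M i j : ℝ) * θ = Real.pi := by rw [hθ]; field_simp
  have h1 := chS_sin θ (2 * M i j)
  have h2 := chS_sin θ (2 * M i j + 1)
  have e1 : ((2 * M i j : ℕ) : ℝ) * θ = 2 * Real.pi := by push_cast; rw [mul_assoc, e]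
  have e2 : ((2 * M i j + 1 : ℕ) : ℝ) * θ = θ + 2 * Real.pi := by
    push_cast; rw [add_mul, mul_assoc, e]; ring
  rw [e1, Real.sin_two_pi] at h1
  rw [e2, Real.sin_add_two_pi] at h2
  have z1 : chS θ (2 * M i j) = 0 := by
    rcases mul_eq_zero.1 h1 with h | h
    · exact h
    · exact absurd h hs.ne'
  have z2 : chS θ (2 * M i j + 1) = 1 := mul_right_cancel₀ hs.ne' (by rw [h2, one_mul])
  rw [z1, z2]; simp

lemma liftable : M.IsLiftable (sig M) := by
  intro i j
  by_cases hij : i = j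
  · subst hij; simp [sig_sig]
  by_cases h0 : M i j = 0
  · simp [h0]
  have hs := sin_pos_of M hij h0
  have hi := rot_full M i j hij h0
  have hj : ((sig M i * sig M j) ^ (M i j)) (al j) = al j := by
    have h := rot_full M j i (Ne.symm hij) (by rwa [M.symmetric])
    rw [M.symmetric j i] at h
    have hinv : (sig M i * sig M j) ^ (M i j) * (sig M j * sig M i) ^ (M i j) = 1 := by
      rw [← Commute.mul_pow]
      · rw [mul_assoc, ← mul_assoc (sig M j), sig_sig, one_mul, sig_sig, one_pow]
      · show _ * _ = _ * _
        rw [mul_assoc, ← mul_assoc (sig M j), sig_sig, one_mul, sig_sig,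
          mul_assoc, ← mul_assoc (sig M i), sig_sig, one_mul, sig_sig]
    have := congrArg (fun f => f (al j)) hinv
    simp only [Module.End.mul_apply, h, Module.End.one_apply] at this
    exact this
  -- decomposition
  refine LinearMap.ext fun v => ?_
  set c := Real.cos (Real.pi / (M i j : ℝ)) with hc
  set s := Real.sin (Real.pi / (M i j : ℝ)) with hsd
  have hcs : s^2 = 1 - c^2 := by rw [hsd, hc]; exact Real.sin_sq _
  have cij : cosE M i j = -c := rfl
  have cji : cosE M j i = -c := by rw [cosE_symm]; rfl
  set p := bil M (al i) v
  set q := bil M (al j) v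
  have hs2 : s^2 ≠ 0 := by positivity
  obtain ⟨x, hx⟩ : ∃ x, x = (p + c * q) / s^2 := ⟨_, rfl⟩
  obtain ⟨y, hy⟩ : ∃ y, y = (q + c * p) / s^2 := ⟨_, rfl⟩
  have hx' : x * s^2 = p + c*q := by rw [hx]; field_simp
  have hy' : y * s^2 = q + c*p := by rw [hy]; field_simp
  obtain ⟨z, hz⟩ : ∃ z, z = v - x • al i - y • al j := ⟨_, rfl⟩
  have zi : bil M (al i) z = 0 := by
    rw [hz]
    simp only [map_sub, map_smul, bil_al, cosE_self, cij, smul_eq_mul]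
    apply mul_right_cancel₀ hs2
    have : (p - x * 1 - y * -c) * s^2 = p * s^2 - x*s^2 + (y * s^2) * c := by ring
    rw [this, hx', hy', hcs]; ring
  have zj : bil M (al j) z = 0 := by
    rw [hz]
    simp only [map_sub, map_smul, bil_al, cosE_self, cji, smul_eq_mul]
    apply mul_right_cancel₀ hs2
    have : (q - x * -c - y * 1) * s^2 = q * s^2 - y*s^2 + (x * s^2) * c := by ring
    rw [this, hx', hy', hcs]; ring
  have hzf : ∀ k : ℕ, ((sig M i * sig M j) ^ k) z = z := by
    intro k
    induction k with
    | zero => simp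
    | succ k ih =>
      rw [pow_succ', Module.End.mul_apply, ih, Module.End.mul_apply, sig_apply M j, zj]
      simp [sig_apply, zi]
  have hv : v = x • al i + y • al j + z := by rw [hz]; abel
  rw [hv]
  simp only [map_add, map_smul, hi, hj, hzf, Module.End.one_apply]

end geom

section pos

variable {B W : Type*} [Group W] [Fintype B] [DecidableEq B] {M : CoxeterMatrix B}
  (cs : CoxeterSystem M W)

/-- geometric representation -/
noncomputable def rep : W →* Module.End ℝ (B → ℝ) := cs.lift ⟨sig M, liftable M⟩

lemma rep_simple (i : B) : rep cs (cs.simple i) = sig M i := by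
  simp [rep]

lemma rep_mul (x y : W) (v : B → ℝ) : rep cs (x * y) v = rep cs x (rep cs y v) := by
  rw [map_mul, Module.End.mul_apply]

lemma rep_one (v : B → ℝ) : rep cs 1 v = v := by
  rw [map_one, Module.End.one_apply]

lemma rep_inv_cancel (x : W) (v : B → ℝ) : rep cs x⁻¹ (rep cs x v) = v := by
  rw [← rep_mul, inv_mul_cancel, rep_one]

lemma rep_cancel_inv (x : W) (v : B → ℝ) : rep cs x (rep cs x⁻¹ v) = v := by
  rw [← rep_mul, mul_inv_cancel, rep_one]

lemma bil_sig (i : B) (v w : B → ℝ) : bil M (sig M i v) (sig M i w) = bil M v w := by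
  simp only [sig_apply, map_sub, map_smul, LinearMap.sub_apply, LinearMap.smul_apply, smul_eq_mul,
    bil_al, cosE_self, bil_symm M v (al i)]
  ring

lemma bil_rep (x : W) (v w : B → ℝ) : bil M (rep cs x v) (rep cs x w) = bil M v w := by
  induction x using cs.simple_induction_left generalizing v w with
  | one => simp
  | mul_simple_left w' i ih => rw [rep_mul, rep_mul, rep_simple, bil_sig, ih]

lemma rep_refl (x : W) (i : B) (v : B → ℝ) :
    rep cs (x * cs.simple i * x⁻¹) v =
      v - (2 * bil M (rep cs x (al i)) v) • rep cs x (al i) := by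
  rw [rep_mul, rep_mul, rep_simple, sig_apply, map_sub, map_smul, rep_cancel_inv,
    ← bil_rep cs x (al i), rep_cancel_inv]

lemma rep_al_ne (x : W) (i : B) : rep cs x (al i) ≠ 0 := by
  intro h
  have := bil_rep cs x (al i) (al i)
  rw [h, bil_al, cosE_self] at this
  simp at this

lemma rep_alt (s t : B) (k : ℕ) :
    rep cs (cs.wordProd (alternatingWord s t k)) (al s) =
      if Even k then
        chS (Real.pi / (M s t : ℝ)) (k+1) • al s + chS (Real.pi / (M s t : ℝ)) k • al t
      else chS (Real.pi / (M s t : ℝ)) k • al s + chS (Real.pi / (M s t : ℝ)) (k+1) • al t := by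
  induction k with
  | zero => simp [alternatingWord, chS]
  | succ k ih =>
    rw [alternatingWord_succ', wordProd_cons, rep_mul, ih, rep_simple]
    by_cases hk : Even k
    · have hk' : ¬ Even (k+1) := by simp [hk, parity_simps]
      rw [if_pos hk, if_pos hk, if_neg hk', add_comm, sig_comb, M.symmetric t s, chS, add_comm]
      congr 2; ring
    · have hk' : Even (k+1) := by simp [hk, parity_simps]
      rw [if_neg hk, if_neg hk, if_pos hk', sig_comb, chS]
      congr 2; ring

lemma al_nonneg (i : B) : (0 : B → ℝ) ≤ al i := by
  intro j
  by_cases h : j = i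
  · subst h; simp [al_self]
  · simp [al_ne h]

lemma rep_pos : ∀ (n : ℕ) (w : W) (s : B), cs.length w = n →
    cs.length w < cs.length (w * cs.simple s) → 0 ≤ rep cs w (al s) := by
  intro n
  induction n using Nat.strong_induction_on with
  | _ n IH =>
  intro w s hn hws
  by_cases hw1 : w = 1
  · subst hw1; rw [rep_one]; exact al_nonneg s
  obtain ⟨t, ht⟩ := cs.exists_rightDescent_of_ne_one hw1
  have hst : s ≠ t := by
    rintro rfl
    exact absurd ht (by unfold IsRightDescent; omega)
  let P : ℕ → Prop := fun k => ∃ v : W, w = v * cs.wordProd (alternatingWord s t k) ∧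
    cs.length v + k = cs.length w
  have hP1 : P 1 := by
    refine ⟨w * cs.simple t, ?_, ?_⟩
    · simp [alternatingWord]
    · exact (cs.isRightDescent_iff.1 ht)
  have hbd : ∀ k, P k → k ≤ n := by
    rintro k ⟨v, _, h⟩; omega
  classical
  obtain ⟨k, hk1, ⟨v, hv, hlen⟩, hmax⟩ : ∃ k, 1 ≤ k ∧ P k ∧ ¬ P (k+1) := by
    by_contra hcon
    push Not at hcon
    have : ∀ k, 1 ≤ k → P k := by
      intro k hk
      induction k, hk using Nat.le_induction with
      | base => exact hP1
      | succ k hk ih => exact hcon k hk ih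
    have := hbd (n+1) (this _ (by omega))
    omega
  set x := if Even k then t else s with hx
  have lvx : cs.length v < cs.length (v * cs.simple x) := by
    by_contra hcon
    have h1 := cs.length_mul_simple v x
    apply hmax
    refine ⟨v * cs.simple x, ?_, by omega⟩
    rw [alternatingWord_succ', wordProd_cons, ← hx, ← mul_assoc, simple_mul_simple_cancel_right]
    exact hv
  obtain ⟨k', rfl⟩ : ∃ k', k = k' + 1 := ⟨k-1, by omega⟩
  set y := if Even k' then t else s with hy
  have lvy : cs.length v < cs.length (v * cs.simple y) := by
    by_contra hcon
    have h1 := cs.length_mul_simple v y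
    rw [alternatingWord_succ', wordProd_cons, ← hy, ← mul_assoc] at hv
    have h2 := cs.length_mul_le (v * cs.simple y) (cs.wordProd (alternatingWord s t k'))
    have h3 := cs.length_wordProd_le (alternatingWord s t k')
    rw [length_alternatingWord] at h3
    rw [← hv] at h2
    omega
  have hboth : cs.length v < cs.length (v * cs.simple s) ∧
      cs.length v < cs.length (v * cs.simple t) := by
    by_cases hk : Even k'
    · have hk2 : ¬ Even (k'+1) := by simp [hk, parity_simps]
      rw [if_pos hk] at hy
      rw [if_neg hk2] at hx
      rw [hx] at lvx; rw [hy] at lvy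
      exact ⟨lvx, lvy⟩
    · have hk2 : Even (k'+1) := by simp [hk, parity_simps]
      rw [if_neg hk] at hy
      rw [if_pos hk2] at hx
      rw [hx] at lvx; rw [hy] at lvy
      exact ⟨lvy, lvx⟩
  have ps := IH (cs.length v) (by omega) v s rfl hboth.1
  have pt := IH (cs.length v) (by omega) v t rfl hboth.2
  have hkM : M s t ≠ 0 → k' + 1 < M s t := by
    intro h0
    by_contra hcon
    push Not at hcon
    have hred : cs.IsReduced (alternatingWord s t (k'+1)) := by
      have h1 := cs.length_mul_le v (cs.wordProd (alternatingWord s t (k'+1)))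
      have h3 := cs.length_wordProd_le (alternatingWord s t (k'+1))
      rw [← hv] at h1
      unfold CoxeterSystem.IsReduced
      rw [length_alternatingWord] at h3 ⊢
      omega
    have hle : k'+1 ≤ M s t := by
      by_contra hc2
      exact cs.not_isReduced_alternatingWord s t h0 (by omega) hred
    have heq : k' + 1 = M s t := le_antisymm hle hcon
    have h4 := cs.prod_alternatingWord_eq_prod_alternatingWord_sub s t (k'+1) (by omega)
    have h5 : M s t * 2 - (k'+1) = k' + 1 := by omega
    rw [h5, alternatingWord_succ t s, List.concat_eq_append, wordProd_append, wordProd_singleton] at h4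
    rw [hv, h4, mul_assoc, mul_assoc, simple_mul_simple_self, mul_one] at hws
    have h6 := cs.length_mul_le v (cs.wordProd (alternatingWord s t k'))
    have h3 := cs.length_wordProd_le (alternatingWord s t k')
    rw [length_alternatingWord] at h3
    rw [← h4, ← hv] at hws
    omega
  have c1 := chS_nonneg M hst (k'+1) (fun h => (hkM h).le)
  have c2 := chS_nonneg M hst (k'+1+1) (fun h => (hkM h))
  rw [hv, rep_mul, rep_alt]
  split_ifs <;> rw [map_add, map_smul, map_smul] <;>
    exact add_nonneg (smul_nonneg ‹_› ps) (smul_nonneg ‹_› pt)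

lemma rep_neg (w : W) (s : B) (h : cs.length (w * cs.simple s) < cs.length w) :
    rep cs w (al s) ≤ 0 := by
  have := rep_pos cs _ (w * cs.simple s) s rfl (by rwa [simple_mul_simple_cancel_right])
  rw [rep_mul, rep_simple, sig_al, cosE_self] at this
  have e : al s - (2 * (1:ℝ)) • al s = -al s := by module
  rw [e, map_neg] at this
  exact neg_nonneg.1 this

lemma rep_pos_or (w : W) (s : B) : 0 ≤ rep cs w (al s) ∨ rep cs w (al s) ≤ 0 := by
  rcases lt_or_gt_of_ne (cs.length_mul_simple_ne w s) with h | h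
  · exact Or.inr (rep_neg cs w s h)
  · exact Or.inl (rep_pos cs _ w s rfl h)

/-- roots -/
def Rt : Set (B → ℝ) := {b | ∃ w i, b = rep cs w (al i)}

/-- positive roots -/
def PR : Set (B → ℝ) := {b | b ∈ Rt cs ∧ 0 ≤ b}

lemma Rt_rep {b : B → ℝ} (hb : b ∈ Rt cs) (x : W) : rep cs x b ∈ Rt cs := by
  obtain ⟨w, i, rfl⟩ := hb
  exact ⟨x * w, i, (rep_mul cs x w _).symm⟩

lemma Rt_neg {b : B → ℝ} (hb : b ∈ Rt cs) : -b ∈ Rt cs := by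
  obtain ⟨w, i, rfl⟩ := hb
  refine ⟨w * cs.simple i, i, ?_⟩
  rw [rep_mul, rep_simple, sig_al, cosE_self, ← map_neg]
  congr 1; module

lemma Rt_or {b : B → ℝ} (hb : b ∈ Rt cs) : 0 ≤ b ∨ b ≤ 0 := by
  obtain ⟨w, i, rfl⟩ := hb
  exact rep_pos_or cs w i

lemma Rt_ne {b : B → ℝ} (hb : b ∈ Rt cs) : b ≠ 0 := by
  obtain ⟨w, i, rfl⟩ := hb
  exact rep_al_ne cs w i

lemma Rt_unit {b : B → ℝ} (hb : b ∈ Rt cs) : bil M b b = 1 := by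
  obtain ⟨w, i, rfl⟩ := hb
  rw [bil_rep, bil_al, cosE_self]

lemma al_PR (i : B) : al i ∈ PR cs := ⟨⟨1, i, (rep_one cs _).symm⟩, al_nonneg i⟩

/-- parallel positive roots agree -/
lemma PR_par {b c : B → ℝ} (hb : b ∈ PR cs) (hc : c ∈ PR cs) (r : ℝ) (h : b = r • c) : b = c := by
  have h1 := Rt_unit cs hb.1
  have h2 := Rt_unit cs hc.1
  rw [h] at h1
  simp only [map_smul, LinearMap.smul_apply, h2, smul_eq_mul, mul_one] at h1
  rcases mul_self_eq_one_iff.1 h1 with h3 | h3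
  · rw [h, h3, one_smul]
  · exfalso
    rw [h3, neg_smul, one_smul] at h
    have h4 := hb.2
    rw [h] at h4
    exact Rt_ne cs hc.1 (le_antisymm (neg_nonneg.1 h4) hc.2)

/-- simple reflections permute the other positive roots -/
lemma PR_sig {b : B → ℝ} (hb : b ∈ PR cs) (i : B) (hne : b ≠ al i) : sig M i b ∈ PR cs := by
  have hR : sig M i b ∈ Rt cs := by
    rw [← rep_simple cs]; exact Rt_rep cs hb.1 _
  refine ⟨hR, ?_⟩
  rcases Rt_or cs hR with h | h
  · exact h
  exfalso
  have hz : ∀ j, j ≠ i → b j = 0 := by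
    intro j hj
    have h1 := h j
    rw [sig_apply] at h1
    simp only [Pi.sub_apply, Pi.smul_apply, al_ne hj, Pi.zero_apply, smul_zero, sub_zero] at h1
    exact le_antisymm h1 (hb.2 j)
  apply hne
  apply PR_par cs hb (al_PR cs i) (b i)
  ext j
  by_cases hj : j = i
  · subst hj; simp [al_self]
  · simp [al_ne hj, hz j hj]

/-- inversion set -/
def Inv (w : W) : Set (B → ℝ) := {b | b ∈ PR cs ∧ rep cs w b ≤ 0}

lemma Inv_finite (w : W) : (Inv cs w).Finite := by
  induction w using cs.simple_induction_left with
  | one =>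
    convert Set.finite_empty
    ext b
    simp only [Inv, rep_one, Set.mem_ofPred_eq, Set.mem_empty_iff_false, iff_false]
    rintro ⟨h1, h2⟩
    exact Rt_ne cs h1.1 (le_antisymm h2 h1.2)
  | mul_simple_left w i ih =>
    refine (ih.union (Set.finite_singleton (rep cs w⁻¹ (al i)))).subset ?_
    rintro b ⟨h1, h2⟩
    rcases Rt_or cs (Rt_rep cs h1.1 w) with h | h
    · right
      rw [rep_mul, rep_simple] at h2
      by_contra hcon
      have : rep cs w b ≠ al i := by
        intro h3
        apply hcon
        rw [Set.mem_singleton_iff, ← h3, rep_inv_cancel]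
      have h4 := PR_sig cs ⟨Rt_rep cs h1.1 w, h⟩ i this
      exact Rt_ne cs h4.1 (le_antisymm h2 h4.2)
    · left; exact ⟨h1, h⟩

lemma eq_one_of_Inv (w : W) (h : Inv cs w = ∅) : w = 1 := by
  by_contra hw
  obtain ⟨t, ht⟩ := cs.exists_rightDescent_of_ne_one hw
  have : al t ∈ Inv cs w := ⟨al_PR cs t, rep_neg cs w t ht⟩
  rw [h] at this
  exact this

lemma Inv_inj {v w : W} (h : Inv cs v = Inv cs w) : v = w := by
  have : w * v⁻¹ = 1 := by
    apply eq_one_of_Inv cs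
    ext b
    simp only [Set.mem_empty_iff_false, iff_false]
    rintro ⟨h1, h2⟩
    rw [rep_mul] at h2
    have hR := Rt_rep cs h1.1 v⁻¹
    rcases Rt_or cs hR with h3 | h3
    · have : rep cs v⁻¹ b ∈ Inv cs w := ⟨⟨hR, h3⟩, h2⟩
      rw [← h] at this
      have h4 := this.2
      rw [rep_cancel_inv] at h4
      exact Rt_ne cs h1.1 (le_antisymm h4 h1.2)
    · have : -rep cs v⁻¹ b ∈ Inv cs v := by
        refine ⟨⟨Rt_neg cs hR, neg_nonneg.2 h3⟩, ?_⟩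
        rw [map_neg, rep_cancel_inv]
        exact neg_nonpos.2 h1.2
      rw [h] at this
      have h4 := this.2
      rw [map_neg, neg_nonpos] at h4
      exact Rt_ne cs (Rt_rep cs hR w) (le_antisymm h2 h4)
  exact (mul_inv_eq_one.1 this).symm

end pos

section fun3

variable {B W : Type*} [Group W] [Fintype B] [DecidableEq B] {M : CoxeterMatrix B}
  (cs : CoxeterSystem M W)

/-- contragredient action -/
noncomputable def act (x : W) (f : Module.Dual ℝ (B → ℝ)) : Module.Dual ℝ (B → ℝ) :=
  f.comp (rep cs x⁻¹)

lemma act_apply (x : W) (f : Module.Dual ℝ (B → ℝ)) (v : B → ℝ) :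
    act cs x f v = f (rep cs x⁻¹ v) := rfl

lemma act_mul (x y : W) (f : Module.Dual ℝ (B → ℝ)) :
    act cs (x * y) f = act cs x (act cs y f) := by
  refine LinearMap.ext fun v => ?_
  simp only [act_apply, mul_inv_rev, rep_mul]

lemma act_one (f : Module.Dual ℝ (B → ℝ)) : act cs 1 f = f := by
  refine LinearMap.ext fun v => ?_
  simp only [act_apply, inv_one, rep_one]

/-- chamber -/
def Cham (f : Module.Dual ℝ (B → ℝ)) : Prop := ∀ i, 0 ≤ f (al i)

def Zr (f : Module.Dual ℝ (B → ℝ)) : Set B := {i | f (al i) = 0}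

/-- positive on almost all positive roots -/
def APos (f : Module.Dual ℝ (B → ℝ)) : Prop := {b | b ∈ PR cs ∧ f b ≤ 0}.Finite

lemma dual_sum (f : Module.Dual ℝ (B → ℝ)) (v : B → ℝ) : f v = ∑ i, v i * f (al i) := by
  rw [LinearMap.pi_apply_eq_sum_univ f v]
  refine Finset.sum_congr rfl fun i _ => ?_
  rw [smul_eq_mul]
  congr 2
  ext j
  simp [al, Pi.single_apply, eq_comm]

lemma cham_nonneg {f : Module.Dual ℝ (B → ℝ)} (hf : Cham f) {v : B → ℝ} (hv : 0 ≤ v) : 0 ≤ f v := by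
  rw [dual_sum]
  exact Finset.sum_nonneg fun i _ => mul_nonneg (hv i) (hf i)

lemma act_simple {f : Module.Dual ℝ (B → ℝ)} {i : B} (h : f (al i) = 0) :
    act cs (cs.simple i) f = f := by
  refine LinearMap.ext fun v => ?_
  rw [act_apply, inv_simple, rep_simple, sig_apply, map_sub, map_smul, h]
  simp

lemma act_parabolic {f : Module.Dual ℝ (B → ℝ)} {T : Set B} (hT : ∀ i ∈ T, f (al i) = 0) {g : W}
    (hg : g ∈ cs.parabolic T) : act cs g f = f := by
  unfold CoxeterSystem.parabolic at hg
  induction hg using Subgroup.closure_induction with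
  | mem x hx =>
    obtain ⟨i, hi, rfl⟩ := hx
    exact act_simple cs (hT i hi)
  | one => exact act_one cs f
  | mul x y _ _ hx hy => rw [act_mul, hy, hx]
  | inv x _ hx => 
    conv_lhs => rw [← hx]
    rw [← act_mul, inv_mul_cancel, act_one]

lemma zero_of_fix {f : Module.Dual ℝ (B → ℝ)} {i : B} (h : act cs (cs.simple i) f = f) :
    f (al i) = 0 := by
  have := congrArg (fun g => g (al i)) h
  simp only [act_apply, inv_simple, rep_simple, sig_al, cosE_self, map_sub, map_smul] at this
  simp only [smul_eq_mul] at this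
  linarith

lemma mem_parabolic : ∀ (n : ℕ) (g : W) (f : Module.Dual ℝ (B → ℝ)), cs.length g = n → Cham f →
    Cham (act cs g f) → g ∈ cs.parabolic (Zr f) := by
  intro n
  induction n with
  | zero =>
    intro g f hn _ _
    rw [cs.length_eq_zero_iff.1 hn]
    exact one_mem _
  | succ n ih =>
    intro g f hn h1 h2
    have hg : g ≠ 1 := by
      rintro rfl
      simp at hn
    obtain ⟨i, hi⟩ := cs.exists_rightDescent_of_ne_one hg
    have hneg := rep_neg cs g i hi
    have h3 := cham_nonneg h2 (neg_nonneg.2 hneg)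
    rw [act_apply, map_neg, rep_inv_cancel, map_neg] at h3
    have h0 : f (al i) = 0 := le_antisymm (by linarith) (h1 i)
    have hd := cs.isRightDescent_iff.1 hi
    have h4 := ih (g * cs.simple i) f (by omega) h1 (by rwa [act_mul, act_simple cs h0])
    have h5 : cs.simple i ∈ cs.parabolic (Zr f) := Subgroup.subset_closure ⟨i, h0, rfl⟩
    have := mul_mem h4 h5
    rwa [simple_mul_simple_cancel_right] at this

lemma mem_parabolic_of_fix {f : Module.Dual ℝ (B → ℝ)} (hf : Cham f) {g : W} (hg : act cs g f = f) :
    g ∈ cs.parabolic (Zr f) :=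
  mem_parabolic cs _ g f rfl hf (by rwa [hg])

lemma to_cham : ∀ (n : ℕ) (f : Module.Dual ℝ (B → ℝ)), APos cs f →
    {b | b ∈ PR cs ∧ f b < 0}.ncard = n → ∃ g, Cham (act cs g f) := by
  intro n
  induction n using Nat.strong_induction_on with
  | _ n ih =>
  intro f hf hn
  by_cases hc : Cham f
  · exact ⟨1, by rwa [act_one]⟩
  unfold Cham at hc
  push Not at hc
  obtain ⟨i, hi⟩ := hc
  have hfin : {b | b ∈ PR cs ∧ f b < 0}.Finite := hf.subset (fun b hb => ⟨hb.1, hb.2.le⟩)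
  have key : ∀ b, b ∈ PR cs → act cs (cs.simple i) f b ≤ 0 → b ≠ al i := by
    rintro b hb h rfl
    rw [act_apply, inv_simple, rep_simple, sig_al, cosE_self] at h
    simp only [map_sub, map_smul, smul_eq_mul] at h
    linarith
  have hval : ∀ b, act cs (cs.simple i) f b = f (sig M i b) := by
    intro b
    rw [act_apply, inv_simple, rep_simple]
  have hss : ∀ b, sig M i (sig M i b) = b := fun b => by
    rw [← Module.End.mul_apply, sig_sig, Module.End.one_apply]
  have hap : APos cs (act cs (cs.simple i) f) := by
    refine (hf.image (sig M i)).subset ?_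
    rintro b ⟨hb, h⟩
    exact ⟨sig M i b, ⟨PR_sig cs hb i (key b hb h), by rwa [← hval]⟩, hss b⟩
  have hlt : {b | b ∈ PR cs ∧ act cs (cs.simple i) f b < 0}.ncard < n := by
    have hsub : {b | b ∈ PR cs ∧ act cs (cs.simple i) f b < 0} ⊆
        (sig M i) '' ({b | b ∈ PR cs ∧ f b < 0} \ {al i}) := by
      rintro b ⟨hb, h⟩
      have hne := key b hb h.le
      refine ⟨sig M i b, ⟨⟨PR_sig cs hb i hne, by rwa [← hval]⟩, ?_⟩, hss b⟩
      intro hmem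
      rw [Set.mem_singleton_iff] at hmem
      have := hss b
      rw [hmem, sig_al, cosE_self] at this
      have h2 := hb.2 i
      rw [← this] at h2
      simp [al_self] at h2
    have h1 := Set.ncard_le_ncard hsub ((hfin.sdiff).image _)
    have h2 := Set.ncard_image_le (f := sig M i) (hfin.sdiff (t := {al i}))
    have h3 := Set.ncard_sdiff_singleton_lt_of_mem (a := al i) (⟨al_PR cs i, hi⟩ : al i ∈ {b | b ∈ PR cs ∧ f b < 0}) hfin
    omega
  obtain ⟨g, hg⟩ := ih _ hlt _ hap rfl
  exact ⟨g * cs.simple i, by rwa [act_mul]⟩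

lemma spherical_of_APos {f : Module.Dual ℝ (B → ℝ)} (hf : Cham f) (hap : APos cs f) :
    cs.IsSpherical (Zr f) := by
  unfold CoxeterSystem.IsSpherical
  have : Set.Finite (Inv cs '' (cs.parabolic (Zr f) : Set W)) := by
    refine (Set.Finite.finite_subsets hap).subset ?_
    rintro _ ⟨w, hw, rfl⟩ b ⟨hb, hneg⟩
    refine ⟨hb, ?_⟩
    have h1 : act cs w⁻¹ f = f := act_parabolic cs (fun i hi => hi) (inv_mem hw)
    have h2 := congrArg (fun g => g b) h1
    simp only [act_apply, inv_inv] at h2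
    rw [← h2]
    have := cham_nonneg hf (neg_nonneg.2 hneg)
    rw [map_neg] at this
    linarith
  exact Set.Finite.of_finite_image this (fun v _ w _ h => Inv_inj cs h)

open Classical in
/-- functional of the face of type T -/
noncomputable def pT (T : Set B) : Module.Dual ℝ (B → ℝ) :=
  ∑ i, if i ∈ T then 0 else LinearMap.proj i

open Classical in
lemma pT_al (T : Set B) (i : B) : pT T (al i) = if i ∈ T then 0 else 1 := by
  unfold pT
  rw [LinearMap.sum_apply, Finset.sum_eq_single i]
  · split_ifs <;> simp [al_self]
  · intro j _ hj
    split_ifs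
    · simp
    · simp [al_ne hj]
  · simp

lemma pT_cham (T : Set B) : Cham (pT T) := by
  intro i
  rw [pT_al]; split_ifs <;> norm_num

lemma pT_zr (T : Set B) : Zr (pT T) = T := by
  ext i
  show pT T (al i) = 0 ↔ _
  rw [pT_al]; split_ifs <;> simp [*]

lemma simple_mem_parabolic {T : Set B} {i : B} (h : cs.simple i ∈ cs.parabolic T) : i ∈ T := by
  have h1 := act_parabolic cs (f := pT T) (T := T) (fun i hi => by rw [pT_al, if_pos hi]) h
  have h2 := zero_of_fix cs h1
  rw [← pT_zr T]
  exact h2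

lemma act_refl_fix {f : Module.Dual ℝ (B → ℝ)} {x : W} {i : B} (h : f (rep cs x (al i)) = 0) :
    act cs (x * cs.simple i * x⁻¹) f = f := by
  refine LinearMap.ext fun v => ?_
  have : (x * cs.simple i * x⁻¹)⁻¹ = x * cs.simple i * x⁻¹ := by
    simp [mul_assoc]
  rw [act_apply, this, rep_refl, map_sub, map_smul, h]
  simp

lemma pT_APos {T : Set B} (hT : cs.IsSpherical T) : APos cs (pT T) := by
  unfold APos
  have hz : ∀ b, b ∈ PR cs → pT T b ≤ 0 → pT T b = 0 := fun b hb h =>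
    le_antisymm h (cham_nonneg (pT_cham T) hb.2)
  have hex : ∀ b : B → ℝ, ∃ t : W, (b ∈ PR cs ∧ pT T b ≤ 0) →
      (t ∈ cs.parabolic T ∧ ∀ v, rep cs t v = v - (2 * bil M b v) • b) := by
    intro b
    by_cases hb : b ∈ PR cs ∧ pT T b ≤ 0
    · obtain ⟨w, i, h⟩ := hb.1.1
      refine ⟨w * cs.simple i * w⁻¹, fun _ => ⟨?_, ?_⟩⟩
      · have := act_refl_fix cs (f := pT T) (x := w) (i := i) (by rw [← h]; exact hz b hb.1 hb.2)
        have h2 := mem_parabolic_of_fix cs (pT_cham T) this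
        rwa [pT_zr] at h2
      · intro v; rw [rep_refl, ← h]
    · exact ⟨1, fun h => absurd h hb⟩
  choose t ht using hex
  refine Set.Finite.of_finite_image (f := t) (hT.subset ?_) ?_
  · rintro _ ⟨b, hb, rfl⟩
    exact (ht b hb).1
  · intro b hb c hc hbc
    have h1 := (ht b hb).2 b
    rw [hbc, (ht c hc).2 b, Rt_unit cs hb.1.1] at h1
    refine PR_par cs hb.1 hc.1 (bil M c b) ?_
    have h2 : (2:ℝ) • b = (2:ℝ) • (bil M c b • c) := by
      rw [smul_smul]
      have : (2 * bil M c b) • c = b - (b - (2 * (1:ℝ)) • b) := by rw [← h1]; abel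
      rw [this]; module
    exact smul_right_injective _ (two_ne_zero) h2

/-- key lemma for maximal spherical subsets -/
lemma max_face {T : Set B} (hT : cs.IsMaxSpherical T) {q : Module.Dual ℝ (B → ℝ)}
    (hq : ∀ i ∈ T, q (al i) = 0) (hap : APos cs q) (c : B) (hc : c ∉ T) : 0 < q (al c) := by
  classical
  by_contra hcon
  push Not at hcon
  have hne : (Finset.univ.filter (fun i => i ∉ T)).Nonempty := ⟨c, by simp [hc]⟩
  obtain ⟨d, hd, hmin⟩ := Finset.exists_min_image _ (fun i => q (al i)) hne
  simp only [Finset.mem_filter, Finset.mem_univ, true_and] at hd hmin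
  obtain ⟨μ, hμ⟩ : ∃ μ, μ = - q (al d) := ⟨_, rfl⟩
  have hμ0 : 0 ≤ μ := by have := hmin c hc; linarith
  set q' := q + μ • pT T with hq'
  have v1 : ∀ i ∈ T, q' (al i) = 0 := by
    intro i hi
    simp [hq', hq i hi, pT_al, hi]
  have v2 : ∀ i, i ∉ T → q' (al i) = q (al i) + μ := by
    intro i hi
    simp [hq', pT_al, hi]
  have hch : Cham q' := by
    intro i
    by_cases hi : i ∈ T
    · rw [v1 i hi]
    · rw [v2 i hi]; have := hmin i hi; linarith
  have hap' : APos cs q' := by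
    refine hap.subset ?_
    rintro b ⟨hb, h⟩
    refine ⟨hb, ?_⟩
    have h3 := cham_nonneg (pT_cham T) hb.2
    have h4 : q' b = q b + μ * pT T b := by simp [hq']
    nlinarith [mul_nonneg hμ0 h3]
  have hsub : T ⊆ Zr q' := fun i hi => v1 i hi
  have h5 := hT.2 _ (spherical_of_APos cs hch hap') hsub
  have h6 : d ∈ Zr q' := by
    show q' (al d) = 0
    rw [v2 d hd, hμ]; ring
  rw [h5] at h6
  exact hd h6

lemma act_APos {f : Module.Dual ℝ (B → ℝ)} (hf : APos cs f) (g : W) : APos cs (act cs g f) := by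
  refine ((Inv_finite cs g⁻¹).union (hf.image (rep cs g))).subset ?_
  rintro b ⟨hb, h⟩
  have hR := Rt_rep cs hb.1 g⁻¹
  rcases Rt_or cs hR with h1 | h1
  · right
    exact ⟨rep cs g⁻¹ b, ⟨⟨hR, h1⟩, h⟩, rep_cancel_inv cs g b⟩
  · left
    exact ⟨hb, h1⟩

/-- averaging a chamber functional over a finite subgroup -/
noncomputable def avg (F : Subgroup W) [Fintype F] (f : Module.Dual ℝ (B → ℝ)) :
    Module.Dual ℝ (B → ℝ) := ∑ x : F, act cs (x : W) f

lemma avg_apply (F : Subgroup W) [Fintype F] (f : Module.Dual ℝ (B → ℝ)) (v : B → ℝ) :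
    avg cs F f v = ∑ x : F, f (rep cs (x : W)⁻¹ v) := by
  simp [avg, LinearMap.sum_apply, act_apply]

lemma avg_fix (F : Subgroup W) [Fintype F] (f : Module.Dual ℝ (B → ℝ)) {g : W} (hg : g ∈ F) :
    act cs g (avg cs F f) = avg cs F f := by
  refine LinearMap.ext fun v => ?_
  rw [act_apply, avg_apply, avg_apply]
  refine Fintype.sum_equiv (Equiv.mulLeft (⟨g, hg⟩ : F)) _ _ fun x => ?_
  simp [rep_mul]

lemma avg_ge (F : Subgroup W) [Fintype F] {f : Module.Dual ℝ (B → ℝ)} (hf : Cham f) :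
    {b | b ∈ PR cs ∧ avg cs F f b < f b}.Finite := by
  have : Set.Finite (⋃ x : F, Inv cs (x : W)⁻¹) := Set.finite_iUnion fun x => Inv_finite cs _
  refine this.subset ?_
  rintro b ⟨hb, h⟩
  by_contra hcon
  simp only [Set.mem_iUnion, not_exists] at hcon
  have h1 : ∀ x : F, 0 ≤ f (rep cs (x : W)⁻¹ b) := by
    intro x
    apply cham_nonneg hf
    rcases Rt_or cs (Rt_rep cs hb.1 (x : W)⁻¹) with h2 | h2
    · exact h2
    · exact absurd ⟨hb, h2⟩ (hcon x)
  have h2 := Finset.single_le_sum (f := fun x : F => f (rep cs (x : W)⁻¹ b)) (fun x _ => h1 x)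
    (Finset.mem_univ (1 : F))
  simp only [OneMemClass.coe_one, inv_one, rep_one] at h2
  rw [avg_apply] at h
  linarith

lemma max_finite {T : Set B} (hT : cs.IsMaxSpherical T) (F : Subgroup W) (hF : (F : Set W).Finite)
    (hTF : cs.parabolic T ≤ F) : F ≤ cs.parabolic T := by
  have : Fintype F := hF.fintype
  set q := avg cs F (pT T) with hq
  have hz : ∀ i ∈ T, q (al i) = 0 := fun i hi =>
    zero_of_fix cs (avg_fix cs F _ (hTF (Subgroup.subset_closure ⟨i, hi, rfl⟩)))
  have hap : APos cs q := by
    refine ((avg_ge cs F (pT_cham T)).union (pT_APos cs hT.1)).subset ?_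
    rintro b ⟨hb, h⟩
    rcases le_or_gt (pT T b) 0 with h1 | h1
    · right; exact ⟨hb, h1⟩
    · left; exact ⟨hb, lt_of_le_of_lt h h1⟩
  have hpos := max_face cs hT hz hap
  have hch : Cham q := by
    intro i
    by_cases hi : i ∈ T
    · rw [hz i hi]
    · exact (hpos i hi).le
  have hzr : Zr q = T := by
    ext i
    constructor
    · intro h
      by_contra hi
      exact (hpos i hi).ne' h
    · exact fun hi => hz i hi
  intro g hg
  have := mem_parabolic_of_fix cs hch (avg_fix cs F _ hg)
  rwa [hzr] at this

end fun3

section ranktwo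

variable {B W : Type*} [Group W] [Fintype B] [DecidableEq B] {M : CoxeterMatrix B}
  (cs : CoxeterSystem M W)

/-- stabiliser of a functional -/
def stab (f : Module.Dual ℝ (B → ℝ)) : Subgroup W where
  carrier := {g | act cs g f = f}
  one_mem' := act_one cs f
  mul_mem' := by
    intro x y hx hy
    show act cs (x * y) f = f
    rw [act_mul, show act cs y f = f from hy, show act cs x f = f from hx]
  inv_mem' := by
    intro x hx
    show act cs x⁻¹ f = f
    conv_lhs => rw [← show act cs x f = f from hx]
    rw [← act_mul, inv_mul_cancel, act_one]

lemma finrank_pair_le (u v : B → ℝ) : Module.finrank ℝ (Submodule.span ℝ {u, v}) ≤ 2 := by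
  classical
  have h := finrank_span_finset_le_card (R := ℝ) ({u, v} : Finset (B → ℝ))
  have h2 : ({u, v} : Finset (B → ℝ)).card ≤ 2 := Finset.card_le_two
  have h3 : ((({u, v} : Finset (B → ℝ)) : Finset (B → ℝ)) : Set (B → ℝ)) = {u, v} := by
    ext x; simp
  rw [h3] at h
  exact h.trans h2

lemma al_indep (T : Set B) (g : W) :
    LinearIndependent ℝ (fun i : T => rep cs g (al (i : B))) := by
  have h1 : LinearIndependent ℝ (fun i : B => al i) := Pi.linearIndependent_single_one B ℝ
  have h2 := h1.comp (fun i : T => (i : B)) Subtype.val_injective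
  have hinj : Function.Injective (rep cs g) :=
    Function.LeftInverse.injective (g := rep cs g⁻¹) (rep_inv_cancel cs g)
  exact h2.map' (rep cs g) (LinearMap.ker_eq_bot.2 hinj)

lemma card_le_of_span (T : Set B) (g : W) (p : Submodule ℝ (B → ℝ))
    (hp : ∀ i ∈ T, rep cs g (al i) ∈ p) : T.ncard ≤ Module.finrank ℝ p := by
  have : Fintype T := Fintype.ofFinite T
  have h1 := finrank_span_eq_card (al_indep cs T g)
  have h2 : Submodule.span ℝ (Set.range (fun i : T => rep cs g (al (i : B)))) ≤ p := by
    rw [Submodule.span_le]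
    rintro _ ⟨i, rfl⟩
    exact hp i i.2
  have h3 := Submodule.finrank_mono h2
  rw [h1] at h3
  rwa [Set.ncard_eq_toFinset_card', Set.toFinset_card]

lemma generic_fun (F : Subgroup W) (hF : (F : Set W).Finite) (x₁ x₂ : W) (i₁ i₂ : B)
    (hgen : F ≤ Subgroup.closure {x₁ * cs.simple i₁ * x₁⁻¹, x₂ * cs.simple i₂ * x₂⁻¹}) :
    ∃ f : Module.Dual ℝ (B → ℝ), APos cs f ∧ F ≤ stab cs f ∧
      ∀ b ∈ PR cs, f b = 0 → b ∈ Submodule.span ℝ {rep cs x₁ (al i₁), rep cs x₂ (al i₂)} := by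
  have : Fintype F := hF.fintype
  set p := Submodule.span ℝ {rep cs x₁ (al i₁), rep cs x₂ (al i₂)} with hp
  set ρ : Module.Dual ℝ (B → ℝ) := pT ∅ with hρ
  have ρal : ∀ i, ρ (al i) = 1 := fun i => by simp [hρ, pT_al]
  have ρpos : ∀ b ∈ PR cs, 0 < ρ b := by
    intro b hb
    have h1 : ρ b = ∑ i, b i := by rw [dual_sum]; simp [ρal]
    have h2 : 0 ≤ ρ b := cham_nonneg (pT_cham _) hb.2
    refine lt_of_le_of_ne h2 fun h0 => Rt_ne cs hb.1 ?_
    rw [h1] at h0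
    have := (Finset.sum_eq_zero_iff_of_nonneg (fun i _ => hb.2 i)).1 h0.symm
    ext i; exact this i (Finset.mem_univ i)
  set f := avg cs F ρ with hf
  set Z := {b | b ∈ PR cs ∧ f b < ρ b} with hZ
  have hZf : Z.Finite := avg_ge cs F (pT_cham _)
  have : Finite {b // b ∈ Z ∧ b ∉ p} := (hZf.subset (fun b hb => hb.1) : {b | b ∈ Z ∧ b ∉ p}.Finite)
  obtain ⟨h, hh, hne⟩ := Module.Dual.exists_forall_mem_ne_zero_of_forall_exists (K := ℝ)
    (M := Module.Dual ℝ (B → ℝ)) p.dualAnnihilator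
    (fun b : {b // b ∈ Z ∧ b ∉ p} => Module.Dual.eval ℝ (B → ℝ) b.1) (by
      rintro ⟨b, hb, hbp⟩
      obtain ⟨u, hu1, hu2⟩ := Submodule.exists_le_ker_of_notMem hbp
      refine ⟨u, ?_, hu1⟩
      rw [Submodule.mem_dualAnnihilator]
      exact fun w hw => hu2 hw)
  rw [Submodule.mem_dualAnnihilator] at hh
  have hne' : ∀ b ∈ Z, b ∉ p → h b ≠ 0 := fun b hb hbp => hne ⟨b, hb, hbp⟩
  obtain ⟨C, hC⟩ : ∃ C : ℝ, C = 1 + ∑ i, |h (al i)| := ⟨_, rfl⟩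
  have hC1 : 1 ≤ C := by
    rw [hC]; have : 0 ≤ ∑ i, |h (al i)| := Finset.sum_nonneg fun i _ => abs_nonneg _
    linarith
  have hbound : ∀ b ∈ PR cs, -(C * ρ b) ≤ h b := by
    intro b hb
    rw [dual_sum h b, dual_sum ρ b, Finset.mul_sum, ← Finset.sum_neg_distrib]
    refine Finset.sum_le_sum fun i _ => ?_
    rw [ρal]
    have h1 : |h (al i)| ≤ C := by
      have := Finset.single_le_sum (f := fun i => |h (al i)|) (fun i _ => abs_nonneg _)
        (Finset.mem_univ i)
      linarith
    have h2 := hb.2 i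
    have h3 := neg_abs_le (h (al i))
    simp only [Pi.zero_apply] at h2
    nlinarith
  have hinf : (Set.Ioo (0:ℝ) (1/C)).Infinite := Set.Ioo_infinite (by positivity)
  obtain ⟨ε, ⟨he0, he1⟩, hebad⟩ := (hinf.sdiff (hZf.image (fun b => - f b / h b))).nonempty
  have heC : ε * C < 1 := by rwa [lt_div_iff₀ (by linarith)] at he1
  have happ : ∀ b, (f + ε • h) b = f b + ε * h b := fun b => by simp
  have hoff : ∀ b ∈ PR cs, b ∉ Z → 0 < (f + ε • h) b := by
    intro b hb hbZ
    have h1 : ρ b ≤ f b := by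
      by_contra hc
      exact hbZ ⟨hb, not_le.1 hc⟩
    have h2 := hbound b hb
    have h3 := ρpos b hb
    rw [happ]
    nlinarith
  refine ⟨f + ε • h, ?_, ?_, ?_⟩
  · refine hZf.subset ?_
    rintro b ⟨hb, h1⟩
    by_contra hc
    exact absurd (hoff b hb hc) (not_lt.2 h1)
  · intro y hy
    have h1 : act cs y f = f := avg_fix cs F ρ hy
    have h2 : y ∈ stab cs h := by
      refine (Subgroup.closure_le _).2 ?_ (hgen hy)
      rintro _ (rfl | rfl)
      · exact act_refl_fix cs (hh _ (Submodule.subset_span (by simp)))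
      · exact act_refl_fix cs (hh _ (Submodule.subset_span (by simp)))
    have h2' : act cs y h = h := h2
    show act cs y (f + ε • h) = f + ε • h
    refine LinearMap.ext fun v => ?_
    have e1 := congrArg (fun u => u v) h1
    have e2 := congrArg (fun u => u v) h2'
    simp only [act_apply] at e1 e2 ⊢
    rw [happ, happ, e1, e2]
  · intro b hb h0
    by_contra hbp
    have hbZ : b ∈ Z := by
      by_contra hc
      exact (hoff b hb hc).ne' h0
    have hn := hne' b hbZ hbp
    apply hebad
    refine ⟨b, hbZ, ?_⟩
    rw [happ] at h0
    show - f b / h b = ε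
    rw [div_eq_iff hn]; linarith

lemma mem_closure_singleton_invol {G : Type*} [Group G] {s x : G} (hs : s * s = 1)
    (hx : x ∈ Subgroup.closure {s}) : x = 1 ∨ x = s := by
  have hsi : s⁻¹ = s := inv_eq_of_mul_eq_one_left hs
  induction hx using Subgroup.closure_induction with
  | mem x hx => exact Or.inr hx
  | one => exact Or.inl rfl
  | mul x y _ _ hx hy =>
    rcases hx with rfl | rfl <;> rcases hy with rfl | rfl <;> simp [hs]
  | inv x _ hx => rcases hx with rfl | rfl <;> simp [hsi]

lemma rank_two (F : Subgroup W) (hF : (F : Set W).Finite) (r₁ r₂ : W)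
    (h₁ : cs.IsReflection r₁) (h₂ : cs.IsReflection r₂) (hne : r₁ ≠ r₂)
    (hr1 : r₁ ∈ F) (hr2 : r₂ ∈ F)
    (hgen : F ≤ Subgroup.closure {r₁, r₂}) :
    ∃ g a b, a ≠ b ∧ ∀ y ∈ F, g * y * g⁻¹ ∈ cs.parabolic {a, b} := by
  obtain ⟨x₁, i₁, e₁⟩ := h₁
  obtain ⟨x₂, i₂, e₂⟩ := h₂
  obtain ⟨f, hap, hst, hsp⟩ := generic_fun cs F hF x₁ x₂ i₁ i₂ (by rwa [← e₁, ← e₂])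
  obtain ⟨g, hg⟩ := to_cham cs _ f hap rfl
  set T := Zr (act cs g f) with hT
  have hpar : ∀ y ∈ F, g * y * g⁻¹ ∈ cs.parabolic T := by
    intro y hy
    apply mem_parabolic_of_fix cs hg
    have : act cs y f = f := hst hy
    rw [← act_mul, inv_mul_cancel_right, act_mul, this]
  have hcard : T.ncard ≤ 2 := by
    refine (card_le_of_span cs T g⁻¹ _ ?_).trans (finrank_pair_le (rep cs x₁ (al i₁)) (rep cs x₂ (al i₂)))
    intro i hi
    have h0 : f (rep cs g⁻¹ (al i)) = 0 := hi
    have hR : rep cs g⁻¹ (al i) ∈ Rt cs := ⟨_, _, rfl⟩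
    rcases Rt_or cs hR with h | h
    · exact hsp _ ⟨hR, h⟩ h0
    · rw [← Submodule.neg_mem_iff]
      exact hsp _ ⟨Rt_neg cs hR, neg_nonneg.2 h⟩ (by rw [map_neg, h0, neg_zero])
  have hn1 : ∀ (x : W) i, x * cs.simple i * x⁻¹ ≠ 1 := by
    intro x i h
    have h1 := cs.length_simple i
    have : cs.simple i = 1 := by
      have := congrArg (fun z => x⁻¹ * z * x) h
      simpa [mul_assoc] using this
    rw [this, cs.length_one] at h1
    omega
  by_cases h2 : T.ncard = 2
  · obtain ⟨a, b, hab, hTe⟩ := Set.ncard_eq_two.1 h2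
    exact ⟨g, a, b, hab, fun y hy => by rw [← hTe]; exact hpar y hy⟩
  · exfalso
    have h3 : T.ncard ≤ 1 := by omega
    have hne1 : ∀ r, (∃ x i, r = x * cs.simple i * x⁻¹) → g * r * g⁻¹ ≠ 1 := by
      rintro r ⟨x, i, rfl⟩ h
      apply hn1 (g * x) i
      rw [← h]; group
    have k1 := hpar _ hr1
    have k2 := hpar _ hr2
    have n1 := hne1 r₁ ⟨_, _, e₁⟩
    have n2 := hne1 r₂ ⟨_, _, e₂⟩
    rcases Nat.le_one_iff_eq_zero_or_eq_one.1 h3 with h4 | h4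
    · rw [Set.ncard_eq_zero] at h4
      rw [h4, CoxeterSystem.parabolic, Set.image_empty, Subgroup.closure_empty,
        Subgroup.mem_bot] at k1
      exact n1 k1
    · obtain ⟨a, ha⟩ := Set.ncard_eq_one.1 h4
      rw [ha, CoxeterSystem.parabolic, Set.image_singleton] at k1 k2
      have q1 := (mem_closure_singleton_invol (cs.simple_mul_simple_self a) k1).resolve_left n1
      have q2 := (mem_closure_singleton_invol (cs.simple_mul_simple_self a) k2).resolve_left n2
      rw [← q2] at q1
      exact hne (mul_left_cancel (mul_right_cancel q1))

/-- dihedral normal form -/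
lemma dihedral_form {G : Type*} [Group G] {s t x : G} (hs : s * s = 1) (ht : t * t = 1)
    (hx : x ∈ Subgroup.closure {s, t}) : ∃ k : ℤ, x = (s * t) ^ k ∨ x = (s * t) ^ k * s := by
  have hsi : s⁻¹ = s := inv_eq_of_mul_eq_one_left hs
  have hti : t⁻¹ = t := inv_eq_of_mul_eq_one_left ht
  have hc : ∀ l : ℤ, s * (s * t) ^ l = (s * t) ^ (-l) * s := by
    intro l
    have h1 : s * (s * t) * s⁻¹ = (s * t)⁻¹ := by
      rw [mul_inv_rev, hsi, hti, ← mul_assoc, hs, one_mul]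
    have h2 := conj_zpow (a := s) (b := s * t) (i := l)
    rw [h1, inv_zpow'] at h2
    rw [h2, inv_mul_cancel_right]
  induction hx using Subgroup.closure_induction with
  | mem x hx =>
    rcases hx with rfl | rfl
    · exact ⟨0, Or.inr (by simp)⟩
    · refine ⟨-1, Or.inr ?_⟩
      rw [zpow_neg_one, mul_inv_rev, inv_mul_cancel_right, hti]
  | one => exact ⟨0, Or.inl (by simp)⟩
  | mul x y _ _ hx hy =>
    obtain ⟨k, rfl | rfl⟩ := hx <;> obtain ⟨l, rfl | rfl⟩ := hy
    · exact ⟨k + l, Or.inl (zpow_add _ _ _).symm⟩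
    · exact ⟨k + l, Or.inr (by rw [zpow_add, mul_assoc])⟩
    · exact ⟨k + -l, Or.inr (by rw [zpow_add, mul_assoc, hc, mul_assoc])⟩
    · refine ⟨k + -l, Or.inl ?_⟩
      rw [zpow_add, mul_assoc, ← mul_assoc s, hc, mul_assoc _ s s, hs, mul_one]
  | inv x _ hx =>
    obtain ⟨k, rfl | rfl⟩ := hx
    · exact ⟨-k, Or.inl (zpow_neg _ _).symm⟩
    · refine ⟨k, Or.inr ?_⟩
      rw [mul_inv_rev, hsi, ← zpow_neg, hc, neg_neg]

lemma parabolic_pair (a b : B) :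
    cs.parabolic {a, b} = Subgroup.closure {cs.simple a, cs.simple b} := by
  rw [CoxeterSystem.parabolic, Set.image_pair]

lemma parabolic_form {a b : B} {x : W} (hx : x ∈ cs.parabolic {a, b}) :
    ∃ k : ℤ, x = (cs.simple a * cs.simple b) ^ k ∨
      x = (cs.simple a * cs.simple b) ^ k * cs.simple a := by
  rw [parabolic_pair] at hx
  exact dihedral_form (cs.simple_mul_simple_self a) (cs.simple_mul_simple_self b) hx

lemma parabolic_refl_form {a b : B} {x : W} (hx : x ∈ cs.parabolic {a, b})
    (hr : cs.IsReflection x) : ∃ k : ℤ, x = (cs.simple a * cs.simple b) ^ k * cs.simple a := by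
  obtain ⟨k, h | h⟩ := parabolic_form cs hx
  · exfalso
    have h1 : cs.lengthParity x = 1 := by
      rw [h, map_zpow, map_mul, lengthParity_simple, lengthParity_simple]
      have : (Multiplicative.ofAdd (1 : ZMod 2) * Multiplicative.ofAdd 1) = 1 := by decide
      rw [this, one_zpow]
    have h2 := hr.odd_length
    rw [lengthParity_eq_ofAdd_length] at h1
    have h3 : ((cs.length x : ℕ) : ZMod 2) = 0 := h1
    rw [ZMod.natCast_eq_zero_iff_even] at h3
    exact (Nat.not_even_iff_odd.2 h2) h3
  · exact ⟨k, h⟩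

lemma parabolic_pair_finite (a b : B) (h : M a b ≠ 0) : cs.IsSpherical {a, b} := by
  have h1 : IsOfFinOrder (cs.simple a * cs.simple b) :=
    isOfFinOrder_iff_pow_eq_one.2 ⟨M a b, Nat.pos_of_ne_zero h, cs.simple_mul_simple_pow a b⟩
  have h2 := finite_zpowers.2 h1
  refine (h2.union (h2.image (· * cs.simple a))).subset ?_
  intro x hx
  obtain ⟨k, rfl | rfl⟩ := parabolic_form cs hx
  · left; exact ⟨k, rfl⟩
  · right; exact ⟨_, ⟨k, rfl⟩, rfl⟩

lemma odd_of_pow {a b : B} (hab : a ≠ b) {n : ℕ} (hn : Odd n)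
    (h : (cs.simple a * cs.simple b) ^ n = 1) : Odd (M a b) := by
  have h1 := congrArg (fun g => rep cs g (al a)) h
  simp only [map_pow, map_mul, rep_simple, rot_pow, rep_one] at h1
  have ha := congrFun h1 a
  have hb := congrFun h1 b
  simp only [Pi.add_apply, Pi.smul_apply, al_self, al_ne hab, al_ne hab.symm, smul_eq_mul, mul_one,
    mul_zero, add_zero, zero_add] at ha hb
  by_cases h0 : M a b = 0
  · rw [h0] at hb
    simp [chS_zero] at hb
    subst hb
    exact absurd hn (by decide)
  have hs := sin_pos_of M hab h0
  have e1 := chS_sin (Real.pi / (M a b : ℝ)) (2*n+1)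
  have e2 := chS_sin (Real.pi / (M a b : ℝ)) (2*n)
  have hM : (M a b : ℝ) ≠ 0 := by exact_mod_cast h0
  set θ := Real.pi / (M a b : ℝ) with hθ
  rw [ha, one_mul] at e1
  rw [hb, zero_mul] at e2
  push_cast at e1 e2
  rw [add_mul, one_mul, Real.sin_add, ← e2, zero_mul, zero_add] at e1
  have hc : Real.cos (2 * n * θ) = 1 := mul_right_cancel₀ hs.ne' (by rw [← e1, one_mul])
  obtain ⟨k, hk⟩ := (Real.cos_eq_one_iff _).1 hc
  have h3 : (n : ℝ) = k * M a b := by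
    have hpi := Real.pi_pos.ne'
    rw [hθ] at hk
    field_simp at hk
    linarith
  have h4 : (n : ℤ) = k * (M a b : ℤ) := by exact_mod_cast h3
  have h5 : (M a b) ∣ n := by
    rw [← Int.natCast_dvd_natCast]; exact ⟨k, by rw [h4]; ring⟩
  exact Odd.of_dvd_nat hn h5

end ranktwo

section final

lemma odd_conj {B W : Type*} [Group W] {M : CoxeterMatrix B} (cs : CoxeterSystem M W) (i j : B)
    (h : Odd (M i j)) : IsConj (cs.simple i) (cs.simple j) := by
  obtain ⟨k, hk⟩ := h
  have hs := cs.simple_mul_simple_self i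
  have hp := cs.simple_mul_simple_pow i j
  have hsi : (cs.simple i)⁻¹ = cs.simple i := cs.inv_simple i
  have hsj : (cs.simple j)⁻¹ = cs.simple j := cs.inv_simple j
  rw [hk] at hp
  have h1 : cs.simple i * (cs.simple i * cs.simple j) * (cs.simple i)⁻¹ =
      (cs.simple i * cs.simple j)⁻¹ := by
    rw [mul_inv_rev, hsi, hsj, ← mul_assoc, hs, one_mul]
  have h2 := conj_pow (a := cs.simple i) (b := cs.simple i * cs.simple j) (i := k)
  rw [h1] at h2
  rw [isConj_iff]
  have hj : cs.simple j = (cs.simple i * cs.simple j)⁻¹ * cs.simple i := by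
    rw [mul_inv_rev, hsi, hsj, mul_assoc, hs, mul_one]
  refine ⟨(cs.simple i * cs.simple j) ^ k, ?_⟩
  set c := cs.simple i * cs.simple j with hc
  have h3 : c ^ k * c ^ k = c⁻¹ := by
    rw [eq_inv_iff_mul_eq_one, ← pow_add, ← pow_succ, ← two_mul]; exact hp
  have h4 : cs.simple i * (c ^ k)⁻¹ = c ^ k * cs.simple i := by
    have h5 := congrArg (fun z => z⁻¹ * cs.simple i) h2
    simp only [inv_pow, inv_inv, mul_inv_rev] at h5
    rw [h5, hsi]
    simp only [mul_assoc, hs, mul_one]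
  rw [mul_assoc, h4, ← mul_assoc, h3]
  exact hj.symm

open Classical in
lemma parity {B W : Type*} [Group W] {M : CoxeterMatrix B} (cs : CoxeterSystem M W) (P : B → Prop)
    (hP : ∀ i j, Odd (M i j) → (P i ↔ P j)) :
    ∃ χ : W →* Multiplicative (ZMod 2), ∀ i, χ (cs.simple i) ≠ 1 ↔ P i := by
  have key : M.IsLiftable (fun i => if P i then (Multiplicative.ofAdd (1 : ZMod 2)) else 1) := by
    intro i j
    have sq : ∀ x : Multiplicative (ZMod 2), x * x = 1 := by decide
    rcases Nat.even_or_odd (M i j) with ⟨k, hk⟩ | ho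
    · rw [hk, pow_add, sq]
    · have := hP i j ho
      by_cases hi : P i
      · simp only [if_pos hi, if_pos (this.1 hi), sq, one_pow]
      · simp only [if_neg hi, if_neg (fun h => hi (this.2 h)), sq, one_pow]
  refine ⟨cs.lift ⟨_, key⟩, fun i => ?_⟩
  rw [cs.lift_apply_simple key]
  by_cases hi : P i
  · simp only [if_pos hi, hi, iff_true]; decide
  · simp [hi]

lemma map_conj_comm {G A : Type*} [Group G] [CommGroup A] (χ : G →* A) (x y : G) :
    χ (x * y * x⁻¹) = χ y := by
  rw [map_mul, map_mul, map_inv, mul_comm, inv_mul_cancel_left]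

variable {B W B' W' : Type*} [Group W] [Group W'] 
    {M : CoxeterMatrix B} {M' : CoxeterMatrix B'}
    (cs : CoxeterSystem M W) (cs' : CoxeterSystem M' W') (φ : W ≃* W')

lemma symm_refl (hφ : ∀ w : W, cs.IsReflection w → cs'.IsReflection (φ w)) (t : B') :
    cs.IsReflection (φ.symm (cs'.simple t)) := by
  obtain ⟨χ, hχ⟩ := parity cs' (fun i => IsConj (cs'.simple i) (cs'.simple t)) (by
    intro i j ho
    exact ⟨fun h => (odd_conj cs' i j ho).symm.trans h, fun h => (odd_conj cs' i j ho).trans h⟩)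
  have h1 : χ (cs'.simple t) ≠ 1 := (hχ t).2 (IsConj.refl _)
  have h2 : ∃ i, χ (φ (cs.simple i)) ≠ 1 := by
    by_contra hc
    push Not at hc
    apply h1
    have h3 : Subgroup.closure (Set.range cs.simple) ≤ (χ.comp φ.toMonoidHom).ker := by
      rw [Subgroup.closure_le]
      rintro _ ⟨i, rfl⟩
      exact hc i
    rw [cs.subgroup_closure_range_simple] at h3
    have h4 := h3 (Subgroup.mem_top (φ.symm (cs'.simple t)))
    rw [MonoidHom.mem_ker] at h4
    simpa using h4
  obtain ⟨i, hi⟩ := h2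
  obtain ⟨w, j, hw⟩ := hφ _ (cs.isReflection_simple i)
  rw [hw, map_conj_comm] at hi
  obtain ⟨c, hc⟩ := isConj_iff.1 ((hχ j).1 hi)
  refine ⟨φ.symm (c * w⁻¹), i, ?_⟩
  apply φ.injective
  rw [map_mul, map_mul, map_inv, φ.apply_symm_apply, φ.apply_symm_apply, hw, ← hc]
  group

variable [Fintype B] [DecidableEq B] [Fintype B'] [DecidableEq B']

lemma pT_vanish (T : Set B) {v : B → ℝ} (hv : v ∈ Submodule.span ℝ (al '' T)) : pT T v = 0 := by
  have : Submodule.span ℝ (al '' T) ≤ LinearMap.ker (pT T) := by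
    rw [Submodule.span_le]
    rintro _ ⟨i, hi, rfl⟩
    show pT T (al i) = 0
    rw [pT_al, if_pos hi]
  exact this hv

/-- if two simple reflections lie in the group generated by two reflections, the latter lie in
the parabolic subgroup -/
lemma refl_pair {i j : B} (hij : i ≠ j) {ρ₁ ρ₂ : W} (h₁ : cs.IsReflection ρ₁)
    (h₂ : cs.IsReflection ρ₂) (hi : cs.simple i ∈ Subgroup.closure {ρ₁, ρ₂})
    (hj : cs.simple j ∈ Subgroup.closure {ρ₁, ρ₂}) :
    ρ₁ ∈ cs.parabolic {i, j} ∧ ρ₂ ∈ cs.parabolic {i, j} := by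
  obtain ⟨x₁, i₁, rfl⟩ := h₁
  obtain ⟨x₂, i₂, rfl⟩ := h₂
  set p := Submodule.span ℝ {rep cs x₁ (al i₁), rep cs x₂ (al i₂)} with hp
  have hmem : ∀ c, cs.simple c ∈ Subgroup.closure {x₁ * cs.simple i₁ * x₁⁻¹, x₂ * cs.simple i₂ * x₂⁻¹} →
      al c ∈ p := by
    intro c hc
    by_contra hn
    obtain ⟨u, hu1, hu2⟩ := Submodule.exists_le_ker_of_notMem hn
    apply hu1
    apply zero_of_fix cs
    have : cs.simple c ∈ stab cs u := by
      refine (Subgroup.closure_le _).2 ?_ hc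
      rintro _ (rfl | rfl)
      · exact act_refl_fix cs (hu2 (Submodule.subset_span (by simp)))
      · exact act_refl_fix cs (hu2 (Submodule.subset_span (by simp)))
    exact this
  have hle : Submodule.span ℝ (al '' ({i, j} : Set B)) ≤ p := by
    rw [Submodule.span_le]
    rintro _ ⟨c, rfl | rfl, rfl⟩
    · exact hmem _ hi
    · exact hmem _ hj
  have hcard : 2 ≤ Module.finrank ℝ (Submodule.span ℝ (al '' ({i, j} : Set B))) := by
    have h := card_le_of_span cs {i, j} 1 (Submodule.span ℝ (al '' ({i, j} : Set B))) (by
      intro c hc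
      rw [rep_one]
      exact Submodule.subset_span ⟨c, hc, rfl⟩)
    rwa [Set.ncard_pair hij] at h
  have heq := Submodule.eq_of_le_of_finrank_le hle ((finrank_pair_le _ _).trans hcard)
  have hfin : ∀ x c, rep cs x (al c) ∈ p → x * cs.simple c * x⁻¹ ∈ cs.parabolic {i, j} := by
    intro x c hx
    rw [← heq] at hx
    have := mem_parabolic_of_fix cs (pT_cham {i, j}) (act_refl_fix cs (pT_vanish _ hx))
    rwa [pT_zr] at this
  exact ⟨hfin _ _ (Submodule.subset_span (by simp)), hfin _ _ (Submodule.subset_span (by simp))⟩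

lemma simple_ne {i j : B} (hij : i ≠ j) : cs.simple i ≠ cs.simple j := by
  intro h
  have : cs.simple i ∈ cs.parabolic {j} := by
    rw [h]; exact Subgroup.subset_closure ⟨j, rfl, rfl⟩
  have h2 : i ∈ ({j} : Set B) := simple_mem_parabolic cs this
  exact hij h2

lemma left_mem (i j : B) : cs.simple i ∈ cs.parabolic {i, j} :=
  Subgroup.subset_closure ⟨i, by simp, rfl⟩

lemma right_mem (i j : B) : cs.simple j ∈ cs.parabolic {i, j} :=
  Subgroup.subset_closure ⟨j, by simp, rfl⟩

lemma pow_pair {i j : B} {ρ₁ ρ₂ : W} (h₁ : cs.IsReflection ρ₁)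
    (h₂ : cs.IsReflection ρ₂) (m₁ : ρ₁ ∈ cs.parabolic {i, j}) (m₂ : ρ₂ ∈ cs.parabolic {i, j}) :
    (ρ₁ * ρ₂) ^ (M i j) = 1 := by
  obtain ⟨k, hk⟩ := parabolic_refl_form cs m₁ h₁
  obtain ⟨l, hl⟩ := parabolic_refl_form cs m₂ h₂
  have h3 : ρ₂ = ρ₂⁻¹ := (inv_eq_of_mul_eq_one_left h₂.mul_self).symm
  have : ρ₁ * ρ₂ = (cs.simple i * cs.simple j) ^ (k - l) := by
    rw [h3, hk, hl, zpow_sub]; group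
  rw [this, ← zpow_natCast, ← zpow_mul, mul_comm, zpow_mul, zpow_natCast, cs.simple_mul_simple_pow,
    one_zpow]

lemma lemA (hφ : ∀ w : W, cs.IsReflection w → cs'.IsReflection (φ w)) {i j : B'} (hij : i ≠ j)
    (ho : Odd (M' i j)) : ∃ (a b : B) (g : W), a ≠ b ∧ Odd (M a b) ∧
      ∀ y, y ∈ cs.parabolic {a, b} ↔ φ (g⁻¹ * y * g) ∈ cs'.parabolic {i, j} := by
  set F := (cs'.parabolic {i, j}).comap φ.toMonoidHom with hF
  have hFm : ∀ y, y ∈ F ↔ φ y ∈ cs'.parabolic {i, j} := fun y => Iff.rfl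
  have hM : M' i j ≠ 0 := fun h => by rw [h] at ho; exact absurd ho (by decide)
  have hFf : (F : Set W).Finite := by
    have h := Set.Finite.preimage (f := φ) φ.injective.injOn (parabolic_pair_finite cs' i j hM)
    exact h
  obtain ⟨g, a, b, hab, hg⟩ := rank_two cs F hFf _ _ (symm_refl cs cs' φ hφ i)
    (symm_refl cs cs' φ hφ j) (fun h => simple_ne cs' hij (φ.symm.injective h))
    (by rw [hFm, φ.apply_symm_apply]; exact left_mem cs' i j)
    (by rw [hFm, φ.apply_symm_apply]; exact right_mem cs' i j)
    (by
      intro y hy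
      rw [hFm, parabolic_pair] at hy
      have : Subgroup.closure {cs'.simple i, cs'.simple j} ≤
        (Subgroup.closure {φ.symm (cs'.simple i), φ.symm (cs'.simple j)}).comap
          φ.symm.toMonoidHom := by
        rw [Subgroup.closure_le]
        rintro _ (rfl | rfl)
        · exact Subgroup.subset_closure (by simp)
        · exact Subgroup.subset_closure (by simp)
      have h := this hy
      rw [Subgroup.mem_comap] at h
      simpa using h)
  -- the pulled back generators
  have r₁ : cs'.IsReflection (φ (g⁻¹ * cs.simple a * g)) := hφ _ ⟨g⁻¹, a, by simp⟩
  have r₂ : cs'.IsReflection (φ (g⁻¹ * cs.simple b * g)) := hφ _ ⟨g⁻¹, b, by simp⟩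
  set c : W →* W' := φ.toMonoidHom.comp (MulAut.conj g⁻¹).toMonoidHom with hc
  have hcy : ∀ y, c y = φ (g⁻¹ * y * g) := fun y => by simp [hc]
  have himg : ∀ y ∈ cs.parabolic {a, b}, φ (g⁻¹ * y * g) ∈
      Subgroup.closure {φ (g⁻¹ * cs.simple a * g), φ (g⁻¹ * cs.simple b * g)} := by
    intro y hy
    rw [parabolic_pair] at hy
    have : Subgroup.closure {cs.simple a, cs.simple b} ≤
        (Subgroup.closure {φ (g⁻¹ * cs.simple a * g), φ (g⁻¹ * cs.simple b * g)}).comap c := by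
      rw [Subgroup.closure_le]
      rintro _ (rfl | rfl)
      · rw [SetLike.mem_coe, Subgroup.mem_comap, hcy]
        exact Subgroup.subset_closure (by simp)
      · rw [SetLike.mem_coe, Subgroup.mem_comap, hcy]
        exact Subgroup.subset_closure (by simp)
    have h := this hy
    rwa [Subgroup.mem_comap, hcy] at h
  have hin : ∀ z ∈ cs'.parabolic {i, j}, z ∈
      Subgroup.closure {φ (g⁻¹ * cs.simple a * g), φ (g⁻¹ * cs.simple b * g)} := by
    intro z hz
    have h1 := himg _ (hg (φ.symm z) (by rw [hFm, φ.apply_symm_apply]; exact hz))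
    have h2 : g⁻¹ * (g * φ.symm z * g⁻¹) * g = φ.symm z := by group
    rwa [h2, φ.apply_symm_apply] at h1
  obtain ⟨m₁, m₂⟩ := refl_pair cs' hij r₁ r₂ (hin _ (left_mem cs' i j)) (hin _ (right_mem cs' i j))
  refine ⟨a, b, g, hab, ?_, fun y => ⟨fun hy => ?_, fun hy => ?_⟩⟩
  · have hp := pow_pair cs' r₁ r₂ m₁ m₂
    refine odd_of_pow cs hab ho ?_
    rw [← hcy, ← hcy, ← map_mul, ← map_pow, hcy] at hp
    rw [EmbeddingLike.map_eq_one_iff] at hp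
    have := congrArg (fun z => g * z * g⁻¹) hp
    simpa [mul_assoc] using this
  · refine (Subgroup.closure_le _).2 ?_ (himg y hy)
    rintro _ (rfl | rfl)
    · exact m₁
    · exact m₂
  · have h1 := hg _ ((hFm _).2 hy)
    have h2 : g * (g⁻¹ * y * g) * g⁻¹ = y := by group
    rwa [h2] at h1

theorem main (hφ : ∀ w : W, cs.IsReflection w → cs'.IsReflection (φ w))
    (h1 : ∀ i j : B, i ≠ j → Odd (M i j) → cs.IsMaxSpherical {i, j})
    (h2 : ¬ ∃ i j k : B, i ≠ j ∧ j ≠ k ∧ i ≠ k ∧ Odd (M i j) ∧ Odd (M j k))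
    (i j k : B') (hij : i ≠ j) (hjk : j ≠ k) (hik : i ≠ k) (o1 : Odd (M' i j))
    (o2 : Odd (M' j k)) : False := by
  obtain ⟨a, b, g₁, hab, oab, H₁⟩ := lemA cs cs' φ hφ hij o1
  obtain ⟨a₂, b₂, g₂, hab₂, oab₂, H₂⟩ := lemA cs cs' φ hφ hjk o2
  -- same pair
  have hset : ({a₂, b₂} : Set B) = {a, b} := by
    obtain ⟨χ, hχ⟩ := parity cs (fun c => c = a ∨ c = b) (by
      have key : ∀ x y, Odd (M x y) → (x = a ∨ x = b) → (y = a ∨ y = b) := by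
        intro x y hxy hx
        by_contra hy
        push Not at hy
        have oba : Odd (M b a) := by rwa [M.symmetric]
        rcases hx with rfl | rfl
        · exact h2 ⟨b, x, y, hab.symm, hy.1.symm, hy.2.symm, oba, hxy⟩
        · exact h2 ⟨a, x, y, hab, hy.2.symm, hy.1.symm, oab, hxy⟩
      intro x y hxy
      exact ⟨key x y hxy, key y x (by rwa [M.symmetric])⟩)
    have hr := symm_refl cs cs' φ hφ j
    have form : ∀ (g : W) (a b : B) (i k : B'), cs'.simple j ∈ cs'.parabolic {i, k} → Odd (M a b) →
        (∀ y, y ∈ cs.parabolic {a, b} ↔ φ (g⁻¹ * y * g) ∈ cs'.parabolic {i, k}) →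
        χ (φ.symm (cs'.simple j)) = χ (cs.simple a) := by
      intro g a b i k hj ho H
      have hm : g * φ.symm (cs'.simple j) * g⁻¹ ∈ cs.parabolic {a, b} := by
        rw [H]
        have h2 : g⁻¹ * (g * φ.symm (cs'.simple j) * g⁻¹) * g = φ.symm (cs'.simple j) := by group
        rwa [h2, φ.apply_symm_apply]
      obtain ⟨n, hn⟩ := parabolic_refl_form cs hm (hr.conj g)
      have e1 := congrArg χ hn
      obtain ⟨w, hw⟩ := isConj_iff.1 (odd_conj cs a b ho)
      have sq : ∀ x : Multiplicative (ZMod 2), x * x = 1 := by decide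
      rw [map_conj_comm, map_mul, map_zpow, map_mul, ← hw, map_conj_comm, sq, one_zpow, one_mul] at e1
      exact e1
    have f1 := form g₁ a b i j (right_mem cs' i j) oab H₁
    have f2 := form g₂ a₂ b₂ j k (left_mem cs' j k) oab₂ H₂
    have ha2 : a₂ = a ∨ a₂ = b := by
      rw [← hχ, ← f2, f1, hχ]; exact Or.inl rfl
    have hb2 : b₂ = a ∨ b₂ = b := by
      obtain ⟨w, hw⟩ := isConj_iff.1 (odd_conj cs a₂ b₂ oab₂)
      rw [← hχ, ← hw, map_conj_comm, hχ]; exact ha2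
    rcases ha2 with rfl | rfl <;> rcases hb2 with rfl | rfl
    · exact absurd rfl hab₂
    · rfl
    · exact Set.pair_comm _ _
    · exact absurd rfl hab₂
  rw [hset] at H₂
  have hmax := h1 a b hab oab
  have ne0 : ∀ {n : ℕ}, Odd n → n ≠ 0 := fun {n} h hn => by rw [hn] at h; exact absurd h (by decide)
  have hmax' : cs'.IsMaxSpherical {j, k} := by
    refine ⟨parabolic_pair_finite cs' j k (ne0 o2), fun U hU hs => ?_⟩
    set c : W →* W' := φ.toMonoidHom.comp (MulAut.conj g₂⁻¹).toMonoidHom with hc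
    have hcy : ∀ y, c y = φ (g₂⁻¹ * y * g₂) := fun y => by simp [hc]
    have hcinj : Function.Injective c := φ.injective.comp (MulAut.conj g₂⁻¹).injective
    have hfin : (((cs'.parabolic U).comap c : Subgroup W) : Set W).Finite := by
      have h := Set.Finite.preimage (f := c) hcinj.injOn hU
      exact h
    have hle := max_finite cs hmax ((cs'.parabolic U).comap c) hfin (by
      intro y hy
      rw [Subgroup.mem_comap, hcy]
      exact Subgroup.closure_mono (Set.image_mono hs) ((H₂ y).1 hy))
    refine Set.Subset.antisymm (fun u hu => ?_) hs
    apply simple_mem_parabolic cs'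
    have hz : g₂⁻¹ * (g₂ * φ.symm (cs'.simple u) * g₂⁻¹) * g₂ = φ.symm (cs'.simple u) := by group
    have h3 : g₂ * φ.symm (cs'.simple u) * g₂⁻¹ ∈ (cs'.parabolic U).comap c := by
      rw [Subgroup.mem_comap, hcy, hz, φ.apply_symm_apply]
      exact Subgroup.subset_closure ⟨u, hu, rfl⟩
    have h4 := (H₂ _).1 (hle h3)
    rwa [hz, φ.apply_symm_apply] at h4
  set g := φ (g₂⁻¹ * g₁) with hgdef
  -- conjugation
  have hconj : ∀ z ∈ cs'.parabolic {j, k}, g⁻¹ * z * g ∈ cs'.parabolic {i, j} := by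
    intro z hz
    have e : g₂⁻¹ * (g₂ * φ.symm z * g₂⁻¹) * g₂ = φ.symm z := by group
    have h3 := (H₂ (g₂ * φ.symm z * g₂⁻¹)).2 (by rw [e, φ.apply_symm_apply]; exact hz)
    have h4 := (H₁ _).1 h3
    have e2 : φ (g₁⁻¹ * (g₂ * φ.symm z * g₂⁻¹) * g₁) = g⁻¹ * z * g := by
      rw [hgdef]; simp [mul_assoc]
    rwa [e2] at h4
  set p₁ : Module.Dual ℝ (B' → ℝ) := pT {i, j} with hp
  have hp0 : ∀ c ∈ ({i, j} : Set B'), p₁ (al c) = 0 := fun c hc => by rw [hp, pT_al, if_pos hc]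
  have hq0 : ∀ c ∈ ({j, k} : Set B'), act cs' g p₁ (al c) = 0 := by
    intro c hc
    apply zero_of_fix cs'
    have h3 := act_parabolic cs' hp0 (hconj (cs'.simple c) (Subgroup.subset_closure ⟨c, hc, rfl⟩))
    rw [← act_mul]
    conv_rhs => rw [← h3, ← act_mul]
    congr 1
    group
  have hap : APos cs' (act cs' g p₁) :=
    act_APos cs' (pT_APos cs' (parabolic_pair_finite cs' i j (ne0 o1))) g
  have hcham : Cham (act cs' g p₁) := by
    intro c
    by_cases hc : c ∈ ({j, k} : Set B')
    · exact (hq0 c hc).ge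
    · exact (max_face cs' hmax' hq0 hap c hc).le
  have hgm := mem_parabolic cs' _ g p₁ rfl (pT_cham _) hcham
  have hfix : act cs' g p₁ = p₁ := act_parabolic cs' (fun c hc => hc) hgm
  have h5 := hq0 k (by simp)
  rw [hfix, hp, pT_al, if_neg (by simp [hik.symm, hjk.symm])] at h5
  exact one_ne_zero h5

end final
end OddChain

theorem no_odd_chain_image {B W B' W' : Type*} [Group W] [Group W'] [Finite B] [Finite B']
    {M : CoxeterMatrix B} {M' : CoxeterMatrix B'}
    (cs : CoxeterSystem M W) (cs' : CoxeterSystem M' W')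
    (φ : W ≃* W')
    (hφ : ∀ w : W, cs.IsReflection w → cs'.IsReflection (φ w))
    (h1 : ∀ i j : B, i ≠ j → Odd (M i j) → cs.IsMaxSpherical {i, j})
    (h2 : ¬ ∃ i j k : B, i ≠ j ∧ j ≠ k ∧ i ≠ k ∧ Odd (M i j) ∧ Odd (M j k))
    (h3 : ∀ i j : B, i ≠ j → Odd (M i j) →
      {T : Set B | cs.IsMaxSpherical T ∧ (T ∩ {i, j}).Nonempty}.ncard ≤ 2) :
    ¬ ∃ i' j' k' : B', i' ≠ j' ∧ j' ≠ k' ∧ i' ≠ k' ∧ Odd (M' i' j') ∧ Odd (M' j' k') := by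
  classical
  letI := Fintype.ofFinite B
  letI := Fintype.ofFinite B'
  rintro ⟨i, j, k, hij, hjk, hik, o1, o2⟩
  exact OddChain.main cs cs' φ hφ h1 h2 i j k hij hjk hik o1 o2
end

section
/- Let (W,S) be a Coxeter system satisfying conditions (1), (2), (3) below, let (W',S') be a Coxeter system, and let φ: W → W' be a group isomorphism such that φ maps every reflection of (W,S) to a reflection of (W',S'). Then for each s',t' ∈ S' such that m'(s',t') is odd, the number of maximal spherical subsets of S' intersecting {s',t'} is at most two. Conditions: (1) for each s,t ∈ S with m(s,t) odd, {s,t} is a maximal spherical subset of S; (2) there is no three-element subset {s,t,u} ⊆ S with m(s,t) and m(t,u) both odd; (3) for each s,t ∈ S with m(s,t) odd, at most two maximal spherical subsets of S intersect {s,t}. -/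
open CoxeterSystem

namespace CoxGeo

/-- Sine quotient sequence. -/
def useq (c : ℝ) : ℕ → ℝ
  | 0 => 0
  | 1 => 1
  | (n + 2) => 2 * c * useq c (n + 1) - useq c n

lemma useq_sin (θ : ℝ) (n : ℕ) : Real.sin θ * useq (Real.cos θ) n = Real.sin (n * θ) ∧
    Real.sin θ * useq (Real.cos θ) (n + 1) = Real.sin ((n + 1 : ℕ) * θ) := by
  induction n with
  | zero => simp [useq]
  | succ n ih =>
    refine ⟨ih.2, ?_⟩
    obtain ⟨h1, h2⟩ := ih
    have : Real.sin θ * useq (Real.cos θ) (n + 1 + 1) =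
      2 * Real.cos θ * (Real.sin θ * useq (Real.cos θ) (n + 1))
        - Real.sin θ * useq (Real.cos θ) n := by
      rw [useq]; ring
    rw [this, h1, h2]
    have e1 : ((n + 1 + 1 : ℕ) : ℝ) * θ = (n + 1 : ℕ) * θ + θ := by push_cast; ring
    have e2 : (n : ℝ) * θ = (n + 1 : ℕ) * θ - θ := by push_cast; ring
    rw [e1, e2, Real.sin_add, Real.sin_sub]
    ring

lemma useq_one (n : ℕ) : useq 1 n = n ∧ useq 1 (n + 1) = n + 1 := by
  induction n with
  | zero => simp [useq]
  | succ n ih =>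
    refine ⟨by simpa using ih.2, ?_⟩
    rw [useq, ih.1, ih.2]; push_cast; ring

lemma sin_pi_div_pos (m : ℕ) (hm : 2 ≤ m) : 0 < Real.sin (Real.pi / m) := by
  have h2 : (2 : ℝ) ≤ m := by exact_mod_cast hm
  apply Real.sin_pos_of_pos_of_lt_pi
  · positivity
  · rw [div_lt_iff₀ (by positivity)]
    nlinarith [Real.pi_pos]

lemma useq_nonneg (m k : ℕ) (hm : m ≠ 1) (hk : m ≠ 0 → k ≤ m) :
    0 ≤ useq (Real.cos (Real.pi / m)) k := by
  rcases Nat.eq_zero_or_pos m with rfl | hpos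
  · simp [(useq_one k).1]
  · have h2 : 2 ≤ m := by omega
    have hs := sin_pi_div_pos m h2
    have hkm : (k : ℝ) ≤ m := by exact_mod_cast hk (by omega)
    have hmp : (0 : ℝ) < m := by exact_mod_cast hpos
    have h := (useq_sin (Real.pi / m) k).1
    have h3 : 0 ≤ Real.sin (k * (Real.pi / m)) := by
      apply Real.sin_nonneg_of_nonneg_of_le_pi
      · positivity
      · rw [← mul_div_assoc, div_le_iff₀ hmp]
        nlinarith [Real.pi_pos]
    rw [← h] at h3
    exact nonneg_of_mul_nonneg_right h3 hs

section
variable {B W : Type*} [Group W] [Fintype B] [DecidableEq B] {M : CoxeterMatrix B}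
  (cs : CoxeterSystem M W)

/-- Gram matrix. -/
noncomputable def K (M : CoxeterMatrix B) : Matrix B B ℝ :=
  Matrix.of fun a b => -2 * Real.cos (Real.pi / M a b)

/-- The form. -/
noncomputable def form (M : CoxeterMatrix B) : LinearMap.BilinForm ℝ (B → ℝ) :=
  Matrix.toBilin' (K M)

/-- Simple root. -/
def al (a : B) : B → ℝ := Pi.single a 1

lemma form_al (a b : B) : form M (al a) (al b) = -2 * Real.cos (Real.pi / M a b) := by
  simp [form, al, K, Matrix.toBilin'_single]

lemma form_self (a : B) : form M (al a) (al a) = 2 := by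
  rw [form_al]; simp

lemma form_symm (u v : B → ℝ) : form M u v = form M v u := by
  simp only [form, Matrix.toBilin'_apply]
  rw [Finset.sum_comm]
  refine Finset.sum_congr rfl fun i _ => Finset.sum_congr rfl fun j _ => ?_
  simp only [K, Matrix.of_apply, M.symmetric j i]
  ring

/-- Simple reflection on V. -/
noncomputable def sg (M : CoxeterMatrix B) (a : B) : Module.End ℝ (B → ℝ) :=
  LinearMap.id - (form M (al a)).smulRight (al a)

lemma sg_apply (a : B) (v : B → ℝ) : sg M a v = v - form M (al a) v • al a := rfl

lemma sg_form (a : B) (u v : B → ℝ) : form M (sg M a u) (sg M a v) = form M u v := by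
  simp only [sg_apply, map_sub, map_smul, LinearMap.sub_apply, LinearMap.smul_apply, smul_eq_mul,
    form_self, form_symm u (al a)]
  ring

lemma sg_sq (a : B) (v : B → ℝ) : sg M a (sg M a v) = v := by
  simp only [sg_apply, map_sub, map_smul, smul_eq_mul, form_self]
  module

lemma rot_form (a b : B) (n : ℕ) (u v : B → ℝ) :
    form M (((sg M a * sg M b) ^ n) u) (((sg M a * sg M b) ^ n) v) = form M u v := by
  induction n with
  | zero => simp
  | succ n ih =>
    simp only [pow_succ', Module.End.mul_apply, sg_form] at ih ⊢
    exact ih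

lemma rot_al (a b : B) (θ : ℝ) (hθ : θ = Real.pi / M a b) (n : ℕ) :
    Real.sin θ • (((sg M a * sg M b) ^ n) (al a)) =
      Real.sin ((2 * n + 1) * θ) • al a + Real.sin (2 * n * θ) • al b ∧
    Real.sin θ • (((sg M a * sg M b) ^ n) (al b)) =
      - Real.sin (2 * n * θ) • al a - Real.sin ((2 * n - 1) * θ) • al b := by
  have hab : form M (al a) (al b) = -2 * Real.cos θ := by rw [form_al, hθ]
  have hba : form M (al b) (al a) = -2 * Real.cos θ := by rw [form_symm, hab]
  have key : ∀ p q : ℝ, (sg M a * sg M b) (p • al a + q • al b) =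
     ((4 * Real.cos θ ^ 2 - 1) * p - 2 * Real.cos θ * q) • al a + (2 * Real.cos θ * p - q) • al b := by
    intro p q
    simp only [Module.End.mul_apply, sg_apply, map_add, map_sub, map_smul, smul_eq_mul, form_self, hab, hba]
    module
  induction n with
  | zero => simp
  | succ n ih =>
    obtain ⟨h1, h2⟩ := ih
    have hs2 : Real.sin θ ^ 2 = 1 - Real.cos θ ^ 2 := by
      rw [← Real.sin_sq_add_cos_sq θ]; ring
    have e1 : (2 * ((n + 1 : ℕ) : ℝ) + 1) * θ = 2 * n * θ + θ + θ + θ := by push_cast; ring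
    have e2 : 2 * ((n + 1 : ℕ) : ℝ) * θ = 2 * n * θ + θ + θ := by push_cast; ring
    have e3 : (2 * ((n + 1 : ℕ) : ℝ) - 1) * θ = 2 * n * θ + θ := by push_cast; ring
    have e4 : (2 * (n : ℝ) + 1) * θ = 2 * n * θ + θ := by ring
    have e5 : (2 * (n : ℝ) - 1) * θ = 2 * n * θ - θ := by ring
    rw [e4] at h1
    rw [e5] at h2
    rw [e1, e2, e3]
    simp only [pow_succ', Module.End.mul_apply (_ * _) (_ ^ _)]
    constructor
    · rw [← map_smul, h1, key]
      congr 2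
      · simp only [Real.sin_add, Real.cos_add]
        linear_combination (3 * Real.sin (2 * n * θ) * Real.cos θ + Real.cos (2 * n * θ) * Real.sin θ) * hs2
      · simp only [Real.sin_add, Real.cos_add]
        linear_combination Real.sin (2 * n * θ) * hs2
    · rw [← map_smul, h2, sub_eq_add_neg, ← neg_smul, key, sub_eq_add_neg (-Real.sin _ • al a), ← neg_smul]
      congr 2
      · simp only [Real.sin_add, Real.cos_add, Real.sin_sub]
        linear_combination -Real.sin (2 * n * θ) * hs2
      · simp only [Real.sin_add, Real.cos_add, Real.sin_sub]
        ring

lemma rot_shift (a b : B) (n : ℕ) (z : B → ℝ) :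
    ∃ p q : ℝ, ((sg M a * sg M b) ^ n) z = z + p • al a + q • al b := by
  induction n with
  | zero => exact ⟨0, 0, by simp⟩
  | succ n ih =>
    obtain ⟨p, q, h⟩ := ih
    rw [pow_succ', Module.End.mul_apply, h, Module.End.mul_apply]
    refine ⟨p - form M (al a) (sg M b (z + p • al a + q • al b)),
      q - form M (al b) (z + p • al a + q • al b), ?_⟩
    rw [sg_apply a, sg_apply b]
    generalize form M (al a) _ = x1
    generalize form M (al b) _ = x2
    module

lemma liftable (M : CoxeterMatrix B) : M.IsLiftable (sg M) := by
  intro a b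
  rcases eq_or_ne a b with rfl | hab
  · simp only [M.diagonal, pow_one]
    ext1 v
    ext1
    simp [sg_sq]
  rcases Nat.eq_zero_or_pos (M a b) with h0 | hpos
  · simp [h0]
  have h2 : 2 ≤ M a b := by
    have := M.off_diagonal a b hab
    omega
  have hs := sin_pi_div_pos _ h2
  set θ := Real.pi / M a b with hθ
  have hm0 : ((M a b : ℕ) : ℝ) ≠ 0 := by positivity
  have hmθ : (M a b : ℝ) * θ = Real.pi := by rw [hθ]; field_simp
  obtain ⟨h1, h3⟩ := rot_al (M := M) a b θ hθ (M a b)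
  have e1 : (2 * (M a b : ℝ) + 1) * θ = θ + 2 * Real.pi := by rw [← hmθ]; ring
  have e2 : 2 * (M a b : ℝ) * θ = 2 * Real.pi := by rw [← hmθ]; ring
  have e3 : (2 * (M a b : ℝ) - 1) * θ = -θ + 2 * Real.pi := by rw [← hmθ]; ring
  rw [e1, e2, Real.sin_add_two_pi, Real.sin_two_pi] at h1
  rw [e2, e3, Real.sin_add_two_pi, Real.sin_two_pi] at h3
  have ha : ((sg M a * sg M b) ^ (M a b)) (al a) = al a := by
    apply smul_right_injective _ hs.ne'
    simpa using h1
  have hb : ((sg M a * sg M b) ^ (M a b)) (al b) = al b := by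
    apply smul_right_injective _ hs.ne'
    simpa using h3
  refine LinearMap.ext fun z => ?_
  obtain ⟨p, q, h⟩ := rot_shift (M := M) a b (M a b) z
  have fa := rot_form (M := M) a b (M a b) (al a) z
  have fb := rot_form (M := M) a b (M a b) (al b) z
  rw [ha, h] at fa
  rw [hb, h] at fb
  simp only [map_add, map_smul, smul_eq_mul, form_self, form_al, M.symmetric b a, ← hθ] at fa fb
  have hs2 := Real.sin_sq_add_cos_sq θ
  have hq : Real.sin θ ^ 2 * q = 0 := by
    linear_combination (Real.cos θ / 2) * fa + (1/2) * fb + q * hs2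
  have hp : Real.sin θ ^ 2 * p = 0 := by
    linear_combination (1 / 2) * fa + (Real.cos θ/2) * fb + p * hs2
  have hq0 : q = 0 := by
    rcases mul_eq_zero.1 hq with h | h
    · exact absurd h (by positivity)
    · exact h
  have hp0 : p = 0 := by
    rcases mul_eq_zero.1 hp with h | h
    · exact absurd h (by positivity)
    · exact h
  rw [h, hp0, hq0]; simp

/-- Geometric representation. -/
noncomputable def rho : W →* Module.End ℝ (B → ℝ) := cs.lift ⟨sg M, liftable M⟩

lemma rho_simple (a : B) : rho cs (cs.simple a) = sg M a := cs.lift_apply_simple _ _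

lemma rho_form (w : W) (u v : B → ℝ) : form M (rho cs w u) (rho cs w v) = form M u v := by
  induction w using cs.simple_induction_left with
  | one => simp
  | mul_simple_left w i ih => simp only [map_mul, Module.End.mul_apply, rho_simple, sg_form, ih]

lemma rho_inv_apply (w : W) (v : B → ℝ) : rho cs w⁻¹ (rho cs w v) = v := by
  rw [← Module.End.mul_apply, ← map_mul]; simp

lemma rho_apply_inv (w : W) (v : B → ℝ) : rho cs w (rho cs w⁻¹ v) = v := by
  rw [← Module.End.mul_apply, ← map_mul]; simp

lemma sg_al (a : B) : sg M a (al a) = - al a := by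
  rw [sg_apply, form_self]; module

lemma alt_al (s t : B) (k : ℕ) :
    rho cs (cs.wordProd (alternatingWord s t k)) (al s) =
      useq (Real.cos (Real.pi / M s t)) (k + 1) • al (if Even k then s else t) +
      useq (Real.cos (Real.pi / M s t)) k • al (if Even k then t else s) := by
  induction k with
  | zero => simp [useq, alternatingWord]
  | succ k ih =>
    rw [alternatingWord_succ', wordProd_cons, map_mul, Module.End.mul_apply, ih, rho_simple]
    rcases Nat.even_or_odd k with hk | hk
    · have : ¬ Even (k + 1) := by simpa [Nat.even_add_one] using hk
      simp only [hk, this, if_true, if_false, map_add, map_smul, sg_al]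
      rw [sg_apply, form_al, M.symmetric t s, useq]
      module
    · have h0 : ¬ Even k := by simpa using hk
      have : Even (k + 1) := by simpa [Nat.even_add_one] using hk
      simp only [h0, this, if_true, if_false, map_add, map_smul, sg_al]
      rw [sg_apply, form_al, useq]
      module

lemma al_nonneg (a : B) : 0 ≤ (al a : B → ℝ) := by
  intro b
  by_cases h : b = a
  · subst h; simp [al]
  · simp [al, h]

lemma alt_pos (s t : B) (hst : s ≠ t) (k : ℕ) (hk : M s t ≠ 0 → k < M s t) :
    ∃ c d : ℝ, 0 ≤ c ∧ 0 ≤ d ∧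
    rho cs (cs.wordProd (alternatingWord s t k)) (al s) = c • al s + d • al t := by
  have h1 := useq_nonneg (M s t) (k + 1) (M.off_diagonal s t hst) (fun h => hk h)
  have h2 := useq_nonneg (M s t) k (M.off_diagonal s t hst) (fun h => (hk h).le)
  rw [alt_al]
  split_ifs
  · exact ⟨_, _, h1, h2, rfl⟩
  · exact ⟨_, _, h2, h1, add_comm _ _⟩

theorem root_pos : ∀ (n : ℕ) (w : W) (s : B), cs.length w = n →
    ¬ cs.IsRightDescent w s → 0 ≤ rho cs w (al s) := by
  intro n
  induction n using Nat.strong_induction_on with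
  | _ n IH =>
  intro w s hn hs
  by_cases hw : w = 1
  · subst hw; simpa using al_nonneg s
  obtain ⟨t, ht⟩ := cs.exists_rightDescent_of_ne_one hw
  have hst : s ≠ t := by rintro rfl; exact hs ht
  have hs' := cs.not_isRightDescent_iff.1 hs
  have ht' := cs.isRightDescent_iff.1 ht
  let P : ℕ → Prop := fun k => ∃ v, w = v * cs.wordProd (alternatingWord s t k) ∧
    cs.length v + k = cs.length w
  have hP1 : P 1 := ⟨w * cs.simple t, by simp [alternatingWord], ht'⟩
  have hPdown : ∀ k, P (k + 1) → P k := by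
    rintro k ⟨v, hv, hl⟩
    rw [alternatingWord_succ', wordProd_cons, ← mul_assoc] at hv
    refine ⟨_, hv, ?_⟩
    have l1 := cs.length_mul_le (v * cs.simple (if Even k then t else s))
      (cs.wordProd (alternatingWord s t k))
    rw [← hv] at l1
    have l2 := cs.length_wordProd_le (alternatingWord s t k)
    rw [length_alternatingWord] at l2
    have l3 := cs.length_mul_le v (cs.simple (if Even k then t else s))
    rw [cs.length_simple] at l3
    omega
  have hPle : ∀ k j, P (k + j) → P k := by
    intro k j
    induction j with
    | zero => exact id
    | succ j ih => exact fun h => ih (hPdown _ h)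
  have hPm : M s t ≠ 0 → ¬ P (M s t) := by
    rintro h0 ⟨v, hv, hl⟩
    obtain ⟨m, hm⟩ := Nat.exists_eq_succ_of_ne_zero h0
    have e := cs.wordProd_braidWord_eq s t
    rw [braidWord, braidWord] at e
    rw [e, M.symmetric t s, hm, alternatingWord_succ, wordProd_concat, ← mul_assoc] at hv
    have : w * cs.simple s = v * cs.wordProd (alternatingWord s t m) := by
      rw [hv]; simp
    have l1 := cs.length_mul_le v (cs.wordProd (alternatingWord s t m))
    have l2 := cs.length_wordProd_le (alternatingWord s t m)
    rw [length_alternatingWord] at l2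
    rw [← this] at l1
    omega
  have hex : ∃ k, ¬ P (k + 2) := by
    refine ⟨cs.length w, ?_⟩
    rintro ⟨v, -, hl⟩
    omega
  obtain ⟨k, hk, hk'⟩ : ∃ k, P (k + 1) ∧ ¬ P (k + 2) := by
    classical
    refine ⟨Nat.find hex, ?_, Nat.find_spec hex⟩
    rcases Nat.eq_zero_or_pos (Nat.find hex) with h | h
    · rw [h]; exact hP1
    · have := Nat.find_min hex (m := Nat.find hex - 1) (by omega)
      rw [not_not] at this
      convert this using 1
      omega
  have hkm : M s t ≠ 0 → k + 1 < M s t := by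
    intro h0
    by_contra hlt
    refine hPm h0 (hPle (M s t) (k + 1 - M s t) ?_)
    convert hk using 1
    omega
  obtain ⟨v, hv, hl⟩ := hk
  have hp : ¬ cs.IsRightDescent v (if Even (k + 1) then t else s) := by
    intro hd
    apply hk'
    refine ⟨v * cs.simple (if Even (k + 1) then t else s), ?_, ?_⟩
    · rw [alternatingWord_succ', wordProd_cons]
      simp [← mul_assoc, hv]
    · have := cs.isRightDescent_iff.1 hd
      omega
  have hq : ¬ cs.IsRightDescent v (if Even k then t else s) := by
    intro hd
    rw [alternatingWord_succ', wordProd_cons, ← mul_assoc] at hv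
    have l1 := cs.length_mul_le (v * cs.simple (if Even k then t else s))
      (cs.wordProd (alternatingWord s t k))
    rw [← hv] at l1
    have l2 := cs.length_wordProd_le (alternatingWord s t k)
    rw [length_alternatingWord] at l2
    have := cs.isRightDescent_iff.1 hd
    omega
  have hboth : ¬ cs.IsRightDescent v s ∧ ¬ cs.IsRightDescent v t := by
    rcases Nat.even_or_odd k with h | h
    · have h' : ¬ Even (k + 1) := by simpa [Nat.even_add_one] using h
      rw [if_neg h'] at hp
      rw [if_pos h] at hq
      exact ⟨hp, hq⟩
    · have h0 : ¬ Even k := by simpa using h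
      have h' : Even (k + 1) := by simpa [Nat.even_add_one] using h
      rw [if_pos h'] at hp
      rw [if_neg h0] at hq
      exact ⟨hq, hp⟩
  have pa := IH (cs.length v) (by omega) v s rfl hboth.1
  have pb := IH (cs.length v) (by omega) v t rfl hboth.2
  obtain ⟨c, d, hc, hd, e⟩ := alt_pos cs s t hst (k + 1) hkm
  rw [hv, map_mul, Module.End.mul_apply, e, map_add, map_smul, map_smul]
  exact add_nonneg (smul_nonneg hc pa) (smul_nonneg hd pb)

lemma root_neg (w : W) (s : B) (h : cs.IsRightDescent w s) : rho cs w (al s) ≤ 0 := by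
  have h' := cs.isRightDescent_iff_not_isRightDescent_mul.1 h
  have := root_pos cs _ _ s rfl h'
  rw [map_mul, Module.End.mul_apply, rho_simple, sg_al, map_neg] at this
  exact neg_nonneg.1 this

end

section
variable {B W : Type*} [Group W] [Fintype B] [DecidableEq B] {M : CoxeterMatrix B}
  (cs : CoxeterSystem M W)

lemma al_ne_zero (a : B) : (al a : B → ℝ) ≠ 0 := by
  intro h
  have := congrFun h a
  simp [al] at this

lemma simple_inj {a b : B} (h : cs.simple a = cs.simple b) : a = b := by
  by_contra hab
  have h1 : rho cs (cs.simple a) (al a) = rho cs (cs.simple b) (al a) := by rw [h]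
  rw [rho_simple, rho_simple, sg_al, sg_apply] at h1
  have := congrFun h1 a
  simp [al, hab] at this
  norm_num at this

/-- roots -/
def Rt : Set (B → ℝ) := {β | ∃ (w : W) (a : B), β = rho cs w (al a)}

lemma al_mem (a : B) : al a ∈ Rt cs := ⟨1, a, by simp⟩

lemma Rt_smul (w : W) {β : B → ℝ} (h : β ∈ Rt cs) : rho cs w β ∈ Rt cs := by
  obtain ⟨u, a, rfl⟩ := h
  exact ⟨w * u, a, by simp⟩

lemma Rt_neg {β : B → ℝ} (h : β ∈ Rt cs) : -β ∈ Rt cs := by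
  obtain ⟨u, a, rfl⟩ := h
  exact ⟨u * cs.simple a, a, by simp [rho_simple, sg_al]⟩

lemma Rt_or {β : B → ℝ} (h : β ∈ Rt cs) : 0 ≤ β ∨ β ≤ 0 := by
  obtain ⟨u, a, rfl⟩ := h
  by_cases hd : cs.IsRightDescent u a
  · exact Or.inr (root_neg cs u a hd)
  · exact Or.inl (root_pos cs _ u a rfl hd)

lemma Rt_form {β : B → ℝ} (h : β ∈ Rt cs) : form M β β = 2 := by
  obtain ⟨u, a, rfl⟩ := h
  rw [rho_form, form_self]

lemma Rt_ne {β : B → ℝ} (h : β ∈ Rt cs) : β ≠ 0 := by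
  rintro rfl
  have := Rt_form cs h
  simp at this

lemma sg_coord (a b : B) (hab : b ≠ a) (v : B → ℝ) : sg M a v b = v b := by
  simp [sg_apply, al, hab]

lemma Rt_simple {β : B → ℝ} (h : β ∈ Rt cs) (hpos : 0 ≤ β) (a : B) (hneg : sg M a β ≤ 0) :
    β = al a := by
  have h0 : ∀ b, b ≠ a → β b = 0 := by
    intro b hb
    have := hneg b
    rw [sg_coord a b hb] at this
    exact le_antisymm this (hpos b)
  have h1 : β = β a • al a := by
    ext b
    by_cases hb : b = a
    · subst hb; simp [al]
    · simp [al, hb, h0 b hb]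
  have h2 := Rt_form cs h
  rw [h1] at h2
  simp only [map_smul, LinearMap.smul_apply, form_self, smul_eq_mul] at h2
  have h3 := hpos a
  simp only [Pi.zero_apply] at h3
  have h4 : β a = 1 := by nlinarith
  rw [h1, h4, one_smul]

/-- inversions -/
def Nv (w : W) : Set (B → ℝ) := {β | β ∈ Rt cs ∧ 0 ≤ β ∧ rho cs w β ≤ 0}

lemma Nv_finite (w : W) : (Nv cs w).Finite := by
  induction w using cs.simple_induction_left with
  | one =>
    convert Set.finite_empty
    ext β
    simp only [Nv, map_one, Module.End.one_apply, Set.mem_setOf_eq, Set.mem_empty_iff_false,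
      iff_false]
    rintro ⟨h1, h2, h3⟩
    exact Rt_ne cs h1 (le_antisymm h3 h2)
  | mul_simple_left w i ih =>
    refine (ih.insert (rho cs w⁻¹ (al i))).subset ?_
    rintro β ⟨h1, h2, h3⟩
    rw [map_mul, Module.End.mul_apply, rho_simple] at h3
    rcases Rt_or cs (Rt_smul cs w h1) with h | h
    · left
      rw [← Rt_simple cs (Rt_smul cs w h1) h i h3, rho_inv_apply]
    · right
      exact ⟨h1, h2, h⟩

/-- bad roots for a functional -/
def Bad (x : (B → ℝ) →ₗ[ℝ] ℝ) : Set (B → ℝ) := {β | β ∈ Rt cs ∧ 0 ≤ β ∧ x β ≤ 0}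

lemma Bad_comp (x : (B → ℝ) →ₗ[ℝ] ℝ) (hx : (Bad cs x).Finite) (g : W) :
    (Bad cs (x ∘ₗ rho cs g)).Finite := by
  refine ((Nv_finite cs g).union (hx.image (rho cs g⁻¹))).subset ?_
  rintro β ⟨h1, h2, h3⟩
  rcases Rt_or cs (Rt_smul cs g h1) with h | h
  · right
    exact ⟨rho cs g β, ⟨Rt_smul cs g h1, h, h3⟩, rho_inv_apply cs g β⟩
  · left
    exact ⟨h1, h2, h⟩

lemma func_nonneg (x : (B → ℝ) →ₗ[ℝ] ℝ) (hx : ∀ b, 0 ≤ x (al b)) {v : B → ℝ} (hv : 0 ≤ v) :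
    0 ≤ x v := by
  have : v = ∑ b, v b • al b := by
    ext c
    simp [al, Finset.sum_apply, Pi.single_apply]
  rw [this, map_sum]
  exact Finset.sum_nonneg fun b _ => by
    rw [map_smul]; exact mul_nonneg (hv b) (hx b)

lemma func_nonpos (x : (B → ℝ) →ₗ[ℝ] ℝ) (hx : ∀ b, 0 ≤ x (al b)) {v : B → ℝ} (hv : v ≤ 0) :
    x v ≤ 0 := by
  have := func_nonneg x hx (neg_nonneg.2 hv)
  rw [map_neg] at this
  linarith

/-- zero set -/
def Jz (x : (B → ℝ) →ₗ[ℝ] ℝ) : Set B := {b | x (al b) = 0}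

lemma comp_sg (x : (B → ℝ) →ₗ[ℝ] ℝ) (b : B) (hb : x (al b) = 0) : x ∘ₗ sg M b = x := by
  refine LinearMap.ext fun v => ?_
  simp [sg_apply, hb]

lemma of_comp_sg (x : (B → ℝ) →ₗ[ℝ] ℝ) (b : B) (h : x ∘ₗ sg M b = x) : x (al b) = 0 := by
  have := LinearMap.congr_fun h (al b)
  simp only [LinearMap.comp_apply, sg_al, map_neg] at this
  linarith

lemma rho_comp (x : (B → ℝ) →ₗ[ℝ] ℝ) (w u : W) :
    x ∘ₗ rho cs (w * u) = (x ∘ₗ rho cs w) ∘ₗ rho cs u := by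
  rw [map_mul]; rfl

lemma chamber (x : (B → ℝ) →ₗ[ℝ] ℝ) (hx : ∀ b, 0 ≤ x (al b)) :
    ∀ (n : ℕ) (w : W), cs.length w = n → (∀ b, 0 ≤ x (rho cs w (al b))) →
      x ∘ₗ rho cs w = x ∧ w ∈ cs.parabolic (Jz x) := by
  intro n
  induction n with
  | zero =>
    intro w hw _
    rw [cs.length_eq_zero_iff] at hw
    subst hw
    refine ⟨?_, one_mem _⟩
    rw [map_one]; rfl
  | succ n ih =>
    intro w hw h
    have hw1 : w ≠ 1 := by rintro rfl; simp at hw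
    obtain ⟨b, hb⟩ := cs.exists_rightDescent_of_ne_one hw1
    have hl := cs.isRightDescent_iff.1 hb
    have hz : x (rho cs w (al b)) = 0 :=
      le_antisymm (func_nonpos x hx (root_neg cs w b hb)) (h b)
    have e : x ∘ₗ rho cs (w * cs.simple b) = x ∘ₗ rho cs w := by
      rw [rho_comp, rho_simple]
      exact comp_sg _ b hz
    obtain ⟨h1, h2⟩ := ih (w * cs.simple b) (by omega) (fun c => by
      have := LinearMap.congr_fun e (al c)
      simp only [LinearMap.comp_apply] at this
      rw [this]; exact h c)
    rw [e] at h1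
    refine ⟨h1, ?_⟩
    have hbJ : b ∈ Jz x := by
      have := LinearMap.congr_fun h1 (al b)
      simp only [LinearMap.comp_apply] at this
      rw [Jz, Set.mem_setOf_eq, ← this, hz]
    have hbm : cs.simple b ∈ cs.parabolic (Jz x) :=
      Subgroup.subset_closure ⟨b, hbJ, rfl⟩
    have := mul_mem h2 hbm
    simpa using this

lemma par_fix (x : (B → ℝ) →ₗ[ℝ] ℝ) (T : Set B) (hT : ∀ t ∈ T, x (al t) = 0) (w : W)
    (hw : w ∈ cs.parabolic T) : x ∘ₗ rho cs w = x := by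
  induction hw using Subgroup.closure_induction with
  | mem w h =>
    obtain ⟨t, ht, rfl⟩ := h
    rw [rho_simple]; exact comp_sg x t (hT t ht)
  | one => rw [map_one]; rfl
  | mul w u _ _ h1 h2 => rw [rho_comp, h1, h2]
  | inv w _ h =>
    conv_lhs => rw [← h]
    rw [← rho_comp]
    simp only [mul_inv_cancel, map_one]
    rfl

lemma spherical_of_bad (x : (B → ℝ) →ₗ[ℝ] ℝ) (hx : ∀ b, 0 ≤ x (al b))
    (hfin : (Bad cs x).Finite) : cs.IsSpherical (Jz x) := by
  let Z : Set (B → ℝ) := {β | β ∈ Rt cs ∧ x β = 0}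
  have hZ : Z.Finite := by
    refine (hfin.union (hfin.image Neg.neg)).subset ?_
    rintro β ⟨h1, h2⟩
    rcases Rt_or cs h1 with h | h
    · left; exact ⟨h1, h, h2.le⟩
    · right; exact ⟨-β, ⟨Rt_neg cs h1, neg_nonneg.2 h, by rw [map_neg, h2, neg_zero]⟩, neg_neg β⟩
  have hfix : ∀ w ∈ cs.parabolic (Jz x), x ∘ₗ rho cs w = x :=
    fun w hw => par_fix cs x _ (fun _ h => h) w hw
  have : Finite Z := hZ
  let f : cs.parabolic (Jz x) → (Z → Z) := fun w β => ⟨rho cs w β, Rt_smul cs _ β.2.1, by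
    have := LinearMap.congr_fun (hfix w w.2) β
    simp only [LinearMap.comp_apply] at this
    rw [this, β.2.2]⟩
  have hf : Function.Injective f := by
    intro w w' h
    by_contra hne
    have hu1 : (w : W)⁻¹ * w' ≠ 1 := by
      intro h1
      apply hne
      exact Subtype.ext (inv_mul_eq_one.1 h1)
    have hum : (w : W)⁻¹ * w' ∈ cs.parabolic (Jz x) := mul_mem (inv_mem w.2) w'.2
    obtain ⟨b, hb⟩ := cs.exists_rightDescent_of_ne_one hu1
    have hneg := root_neg cs _ b hb
    have e := LinearMap.congr_fun (hfix _ hum) (al b)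
    simp only [LinearMap.comp_apply] at e
    have hb0 : x (al b) = 0 := by
      refine le_antisymm ?_ (hx b)
      rw [← e]
      exact func_nonpos x hx hneg
    have h2 := congrArg Subtype.val (congrFun h ⟨al b, al_mem cs b, hb0⟩)
    simp only [f] at h2
    rw [map_mul, Module.End.mul_apply, ← h2, rho_inv_apply] at hneg
    exact al_ne_zero b (le_antisymm hneg (al_nonneg b))
  exact Finite.of_injective f hf

lemma descend : ∀ (n : ℕ) (x : (B → ℝ) →ₗ[ℝ] ℝ), (Bad cs x).Finite →
    {β | β ∈ Rt cs ∧ 0 ≤ β ∧ x β < 0}.ncard = n →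
    ∃ g : W, ∀ b, 0 ≤ x (rho cs g (al b)) := by
  intro n
  induction n using Nat.strong_induction_on with
  | _ n IH =>
  intro x hfin hn
  by_cases h : ∀ b, 0 ≤ x (al b)
  · exact ⟨1, by simpa using h⟩
  push Not at h
  obtain ⟨b, hb⟩ := h
  have hfin' : {β | β ∈ Rt cs ∧ 0 ≤ β ∧ x β < 0}.Finite :=
    hfin.subset fun β h => ⟨h.1, h.2.1, h.2.2.le⟩
  have hlt : {β | β ∈ Rt cs ∧ 0 ≤ β ∧ (x ∘ₗ rho cs (cs.simple b)) β < 0}.ncard < n := by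
    rw [← hn]
    have hbm : al b ∈ {β | β ∈ Rt cs ∧ 0 ≤ β ∧ x β < 0} := ⟨al_mem cs b, al_nonneg b, hb⟩
    refine lt_of_le_of_lt ?_ (Set.ncard_diff_singleton_lt_of_mem hbm hfin')
    refine Set.ncard_le_ncard_of_injOn (fun β => sg M b β) ?_ ?_ (hfin'.subset Set.diff_subset)
    · rintro β ⟨h1, h2, h3⟩
      rw [rho_simple, LinearMap.comp_apply] at h3
      have hm : sg M b β ∈ Rt cs := by rw [← rho_simple cs]; exact Rt_smul cs _ h1
      refine ⟨⟨hm, ?_, h3⟩, ?_⟩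
      · rcases Rt_or cs hm with h | h
        · exact h
        · have := Rt_simple cs h1 h2 b h
          rw [this, sg_al, map_neg] at h3
          linarith
      · intro he
        have : sg M b β = al b := he
        have h4 := sg_sq (M := M) b β
        rw [this, sg_al] at h4
        rw [← h4] at h2
        exact al_ne_zero b (le_antisymm (neg_nonneg.1 h2) (al_nonneg b))
    · intro β _ β' _ he
      have := congrArg (sg M b) he
      simpa [sg_sq] using this
  obtain ⟨g, hg⟩ := IH _ hlt (x ∘ₗ rho cs (cs.simple b)) (Bad_comp cs x hfin _) rfl
  exact ⟨cs.simple b * g, fun c => by simpa using hg c⟩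

/-- sum of coordinates -/
noncomputable def x0 (B : Type*) [Fintype B] : (B → ℝ) →ₗ[ℝ] ℝ := ∑ b, LinearMap.proj b

lemma x0_apply (v : B → ℝ) : x0 B v = ∑ b, v b := by simp [x0]

lemma x0_nonneg {v : B → ℝ} (hv : 0 ≤ v) : 0 ≤ x0 B v := by
  rw [x0_apply]; exact Finset.sum_nonneg fun b _ => hv b

lemma x0_pos {v : B → ℝ} (hv : 0 ≤ v) (h : v ≠ 0) : 0 < x0 B v := by
  refine lt_of_le_of_ne (x0_nonneg hv) fun h0 => h ?_
  rw [x0_apply, eq_comm, Finset.sum_eq_zero_iff_of_nonneg (fun b _ => hv b)] at h0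
  ext b
  exact h0 b (Finset.mem_univ b)

/-- averaged functional -/
noncomputable def avg (F : Subgroup W) [Fintype F] : (B → ℝ) →ₗ[ℝ] ℝ :=
  ∑ f : F, x0 B ∘ₗ rho cs f

lemma avg_apply (F : Subgroup W) [Fintype F] (v : B → ℝ) :
    avg cs F v = ∑ f : F, x0 B (rho cs f v) := by simp [avg]

lemma avg_fix (F : Subgroup W) [Fintype F] (g : W) (hg : g ∈ F) :
    avg cs F ∘ₗ rho cs g = avg cs F := by
  refine LinearMap.ext fun v => ?_
  rw [LinearMap.comp_apply, avg_apply, avg_apply]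
  refine Fintype.sum_equiv (Equiv.mulRight (⟨g, hg⟩ : F)) _ _ fun f => ?_
  simp

lemma avg_bad (F : Subgroup W) [Fintype F] : (Bad cs (avg cs F)).Finite := by
  refine (Set.finite_iUnion fun f : F => Nv_finite cs (f : W)).subset ?_
  rintro β ⟨h1, h2, h3⟩
  by_contra hn
  simp only [Set.mem_iUnion, not_exists] at hn
  have hp : ∀ f : F, 0 < x0 B (rho cs f β) := by
    intro f
    rcases Rt_or cs (Rt_smul cs (f : W) h1) with h | h
    · exact x0_pos h (Rt_ne cs (Rt_smul cs _ h1))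
    · exact absurd ⟨h1, h2, h⟩ (hn f)
  rw [avg_apply] at h3
  have : 0 < ∑ f : F, x0 B (rho cs f β) := Finset.sum_pos (fun f _ => hp f) ⟨1, Finset.mem_univ _⟩
  linarith

theorem finite_in_parabolic (F : Subgroup W) [Finite F] :
    ∃ (g : W) (J : Set B), cs.IsSpherical J ∧ ∀ f ∈ F, g⁻¹ * f * g ∈ cs.parabolic J := by
  have := Fintype.ofFinite F
  obtain ⟨g, hg⟩ := descend cs _ (avg cs F) (avg_bad cs F) rfl
  refine ⟨g, Jz (avg cs F ∘ₗ rho cs g), ?_, ?_⟩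
  · exact spherical_of_bad cs _ hg (Bad_comp cs _ (avg_bad cs F) g)
  · intro f hf
    refine (chamber cs _ hg _ (g⁻¹ * f * g) rfl fun b => ?_).2
    have : (avg cs F ∘ₗ rho cs g) ∘ₗ rho cs (g⁻¹ * f * g) = avg cs F ∘ₗ rho cs g := by
      rw [← rho_comp, mul_assoc, mul_inv_cancel_left, rho_comp, avg_fix cs F f hf]
    have := LinearMap.congr_fun this (al b)
    rw [LinearMap.comp_apply] at this
    rw [this]
    exact hg b

lemma exists_max (J : Set B) (hJ : cs.IsSpherical J) : ∃ T, cs.IsMaxSpherical T ∧ J ⊆ T := by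
  obtain ⟨T, hJT, hT⟩ := (Set.toFinite {T : Set B | cs.IsSpherical T}).exists_le_maximal hJ
  exact ⟨T, ⟨hT.1, fun U hU h => (hT.2 hU h).antisymm h⟩, hJT⟩

theorem finite_in_max (F : Subgroup W) [Finite F] :
    ∃ (g : W) (T : Set B), cs.IsMaxSpherical T ∧ ∀ f ∈ F, g⁻¹ * f * g ∈ cs.parabolic T := by
  obtain ⟨g, J, hJ, h⟩ := finite_in_parabolic cs F
  obtain ⟨T, hT, hJT⟩ := exists_max cs J hJ
  exact ⟨g, T, hT, fun f hf => Subgroup.closure_mono (Set.image_mono hJT) (h f hf)⟩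

lemma par_coord (T : Set B) (w : W) (hw : w ∈ cs.parabolic T) (b : B) (hb : b ∉ T) (v : B → ℝ) :
    rho cs w v b = v b := by
  have := par_fix cs (LinearMap.proj b) T (fun t ht => by
    have : b ≠ t := by rintro rfl; exact hb ht
    simp [al, this]) w hw
  exact LinearMap.congr_fun this v

/-- A functional in the chamber with zero set exactly `T`. -/
lemma exists_point (T : Set B) (hT : cs.IsSpherical T) :
    ∃ x : (B → ℝ) →ₗ[ℝ] ℝ, (Bad cs x).Finite ∧ (∀ t ∈ T, x (al t) = 0) ∧
      ∀ b ∉ T, 0 < x (al b) := by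
  have : Finite (cs.parabolic T) := hT
  have := Fintype.ofFinite (cs.parabolic T)
  refine ⟨avg cs (cs.parabolic T), avg_bad cs _, ?_, ?_⟩
  · intro t ht
    refine of_comp_sg (M := M) _ t ?_
    rw [← rho_simple cs]
    exact avg_fix cs _ _ (Subgroup.subset_closure ⟨t, ht, rfl⟩)
  · intro b hb
    rw [avg_apply]
    refine Finset.sum_pos (fun f _ => ?_) ⟨1, Finset.mem_univ _⟩
    have hm := Rt_smul cs (f : W) (al_mem cs b)
    rcases Rt_or cs hm with h | h
    · exact x0_pos h (Rt_ne cs hm)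
    · have h1 := par_coord cs T f f.2 b hb (al b)
      have h2 := h b
      rw [h1] at h2
      simp [al] at h2
      norm_num at h2

theorem max_unique (T U : Set B) (hT : cs.IsMaxSpherical T) (hU : cs.IsSpherical U) (h : W)
    (hc : ∀ w ∈ cs.parabolic T, h⁻¹ * w * h ∈ cs.parabolic U) : T = U := by
  obtain ⟨x, hbad, hx0, hxp⟩ := exists_point cs U hU
  have hxn : ∀ b, 0 ≤ x (al b) := by
    intro b
    by_cases hb : b ∈ U
    · exact (hx0 b hb).ge
    · exact (hxp b hb).le
  set y := x ∘ₗ rho cs h⁻¹ with hy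
  have hybad : (Bad cs y).Finite := Bad_comp cs x hbad _
  have hyT : ∀ t ∈ T, y (al t) = 0 := by
    intro t ht
    refine of_comp_sg (M := M) _ t ?_
    rw [← rho_simple cs, hy, ← rho_comp]
    have h1 := hc _ (Subgroup.subset_closure ⟨t, ht, rfl⟩ : cs.simple t ∈ cs.parabolic T)
    have h2 := par_fix cs x U hx0 _ h1
    have : h⁻¹ * cs.simple t = (h⁻¹ * cs.simple t * h) * h⁻¹ := by group
    rw [this, rho_comp, h2]
  have hychamber : ∀ b, 0 ≤ y (al b) := by
    by_contra hcon
    push Not at hcon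
    obtain ⟨b0, hb0⟩ := hcon
    obtain ⟨b, -, hmin⟩ := Finset.exists_min_image Finset.univ (fun b => y (al b)) ⟨b0, Finset.mem_univ _⟩
    have hbneg : y (al b) < 0 := lt_of_le_of_lt (hmin b0 (Finset.mem_univ _)) hb0
    have hbT : b ∉ T := fun hb => by rw [hyT b hb] at hbneg; exact lt_irrefl _ hbneg
    classical
    let x1 : (B → ℝ) →ₗ[ℝ] ℝ := ∑ c, if c ∈ T then 0 else LinearMap.proj c
    have hx1 : ∀ c, x1 (al c) = if c ∈ T then 0 else 1 := by
      intro c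
      simp only [x1, LinearMap.sum_apply]
      rw [Finset.sum_eq_single c]
      · split_ifs <;> simp [al]
      · intro d _ hd
        split_ifs <;> simp [al, hd]
      · simp
    let z := y - (y (al b)) • x1
    have hz : ∀ c, z (al c) = y (al c) - y (al b) * (if c ∈ T then 0 else 1) := by
      intro c; simp [z, hx1]
    have hzn : ∀ c, 0 ≤ z (al c) := by
      intro c
      rw [hz]
      split_ifs with hcT
      · simp [hyT c hcT]
      · have := hmin c (Finset.mem_univ _)
        linarith
    have hzbad : (Bad cs z).Finite := by
      refine hybad.subset ?_
      rintro β ⟨h1, h2, h3⟩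
      refine ⟨h1, h2, ?_⟩
      have h4 : 0 ≤ x1 β := func_nonneg x1 (fun c => by rw [hx1]; split_ifs <;> norm_num) h2
      have h5 : z β = y β - y (al b) * x1 β := by simp [z]
      rw [h5] at h3
      nlinarith
    have hsph := spherical_of_bad cs z hzn hzbad
    have hsub : T ⊆ Jz z := by
      intro t ht
      rw [Jz, Set.mem_setOf_eq, hz, hyT t ht]; simp [ht]
    have heq := hT.2 _ hsph hsub
    apply hbT
    rw [← heq, Jz, Set.mem_setOf_eq, hz]
    simp [hbT]
  have hxy := (chamber cs x hxn _ h⁻¹ rfl hychamber).1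
  have hsub : T ⊆ U := by
    intro t ht
    by_contra hn
    have h1 := hyT t ht
    rw [hy, hxy] at h1
    exact (hxp t hn).ne' h1
  exact (hT.2 U hU hsub).symm

end

section
variable {B W : Type*} [Group W] {M : CoxeterMatrix B} (cs : CoxeterSystem M W)

lemma exists_ret (C : Set B) (hC : ∀ c ∈ C, ∀ d ∉ C, Even (M c d)) :
    ∃ ψ : W →* W, (∀ c ∈ C, ψ (cs.simple c) = cs.simple c) ∧ ∀ d ∉ C, ψ (cs.simple d) = 1 := by
  classical
  have hl : M.IsLiftable (fun c => if c ∈ C then cs.simple c else 1) := by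
    intro c d
    have hev : ∀ (e : B) (n : ℕ), Even n → cs.simple e ^ n = 1 := by
      rintro e n ⟨k, rfl⟩
      rw [← two_mul, pow_mul]; simp
    by_cases hc : c ∈ C <;> by_cases hd : d ∈ C
    · simp [hc, hd]
    · simp [hc, hd, hev c _ (hC c hc d hd)]
    · have := hC d hd c hc
      rw [M.symmetric d c] at this
      simp [hc, hd, hev d _ this]
    · simp [hc, hd]
  refine ⟨cs.lift ⟨_, hl⟩, ?_, ?_⟩
  · intro c hc
    rw [cs.lift_apply_simple hl]; simp [hc]
  · intro d hd
    rw [cs.lift_apply_simple hl]; simp [hd]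

lemma simple_ne_one (a : B) : cs.simple a ≠ 1 := by
  intro h
  have := cs.length_simple a
  rw [h] at this
  simp at this

lemma conj_of_odd (a b : B) (h : Odd (M a b)) : IsConj (cs.simple a) (cs.simple b) := by
  obtain ⟨k, hk⟩ := h
  have h1 := cs.simple_mul_simple_pow a b
  rw [hk] at h1
  rw [isConj_iff]
  refine ⟨(cs.simple a * cs.simple b) ^ k, ?_⟩
  have h2 : ∀ n : ℕ, cs.simple a * ((cs.simple a * cs.simple b) ^ n)⁻¹ =
      (cs.simple a * cs.simple b) ^ n * cs.simple a := by
    intro n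
    induction n with
    | zero => simp
    | succ n ih =>
      rw [pow_succ', mul_inv_rev, ← mul_assoc, ih]
      rw [← pow_succ', pow_succ]
      simp [mul_assoc]
  rw [mul_assoc, h2, ← mul_assoc, ← pow_add, ← two_mul]
  rw [pow_succ] at h1
  rw [eq_inv_of_mul_eq_one_left h1]
  simp

end
end CoxGeo

theorem maxSpherical_count_image {B W B' W' : Type*} [Group W] [Group W'] [Finite B] [Finite B']
    {M : CoxeterMatrix B} {M' : CoxeterMatrix B'}
    (cs : CoxeterSystem M W) (cs' : CoxeterSystem M' W')
    (φ : W ≃* W')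
    (hφ : ∀ w : W, cs.IsReflection w → cs'.IsReflection (φ w))
    (h1 : ∀ i j : B, i ≠ j → Odd (M i j) → cs.IsMaxSpherical {i, j})
    (h2 : ¬ ∃ i j k : B, i ≠ j ∧ j ≠ k ∧ i ≠ k ∧ Odd (M i j) ∧ Odd (M j k))
    (h3 : ∀ i j : B, i ≠ j → Odd (M i j) →
      {T : Set B | cs.IsMaxSpherical T ∧ (T ∩ {i, j}).Nonempty}.ncard ≤ 2) :
    ∀ i' j' : B', i' ≠ j' → Odd (M' i' j') →
      {T' : Set B' | cs'.IsMaxSpherical T' ∧ (T' ∩ {i', j'}).Nonempty}.ncard ≤ 2 := by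
  intro i' j' hij' hodd'
  classical
  have := Fintype.ofFinite B
  have := Fintype.ofFinite B'
  -- the retraction on the target side
  have hconj' := CoxGeo.conj_of_odd cs' i' j' hodd'
  let C' : Set B' := {c | IsConj (cs'.simple i') (cs'.simple c)}
  obtain ⟨ψ, hψ1, hψ2⟩ := CoxGeo.exists_ret cs' C' (by
    intro c hc d hd
    by_contra hcon
    rw [Nat.not_even_iff_odd] at hcon
    exact hd (IsConj.trans hc (CoxGeo.conj_of_odd cs' c d hcon)))
  have hψi : ψ (cs'.simple i') = cs'.simple i' := hψ1 i' (IsConj.refl _)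
  have hψj : ψ (cs'.simple j') = cs'.simple j' := hψ1 j' hconj'
  have hkill : ∀ b : B, ¬ IsConj (cs'.simple i') (φ (cs.simple b)) → ψ (φ (cs.simple b)) = 1 := by
    intro b hb
    obtain ⟨w, d, hd⟩ := hφ _ (cs.isReflection_simple b)
    have hdC : d ∉ C' := by
      intro hdC
      apply hb
      refine IsConj.trans hdC ?_
      rw [hd]
      exact isConj_iff.2 ⟨w, rfl⟩
    rw [hd]
    simp [hψ2 d hdC]
  let Ψ : W →* W' := ψ.comp φ.toMonoidHom
  have hΨ : ∀ w, Ψ w = ψ (φ w) := fun _ => rfl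
  obtain ⟨a, ha⟩ : ∃ a, IsConj (cs'.simple i') (φ (cs.simple a)) := by
    by_contra hcon
    push Not at hcon
    have h1 : Ψ = 1 := cs.ext_simple fun b => by
      rw [hΨ, hkill b (hcon b)]; rfl
    have h2 := DFunLike.congr_fun h1 (φ.symm (cs'.simple i'))
    rw [hΨ, MulEquiv.apply_symm_apply, hψi] at h2
    exact CoxGeo.simple_ne_one cs' i' h2
  -- some other generator is conjugate to `a`
  obtain ⟨b, hba, hb⟩ : ∃ b, b ≠ a ∧ IsConj (cs'.simple i') (φ (cs.simple b)) := by
    by_contra hcon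
    push Not at hcon
    have h1 : ∀ w, Ψ w = 1 ∨ Ψ w = Ψ (cs.simple a) := by
      intro w
      induction w using cs.simple_induction_left with
      | one => left; simp
      | mul_simple_left w c ih =>
        by_cases hc : c = a
        · subst hc
          rcases ih with h | h
          · right; rw [map_mul, h, mul_one]
          · left; rw [map_mul, h, ← map_mul]; simp
        · rw [map_mul, hΨ (cs.simple c), hkill c (hcon c hc), one_mul]
          exact ih
    have hi := h1 (φ.symm (cs'.simple i'))
    have hj := h1 (φ.symm (cs'.simple j'))
    rw [hΨ (φ.symm _), MulEquiv.apply_symm_apply, hψi] at hi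
    rw [hΨ (φ.symm _), MulEquiv.apply_symm_apply, hψj] at hj
    have hi' := hi.resolve_left (CoxGeo.simple_ne_one cs' i')
    have hj' := hj.resolve_left (CoxGeo.simple_ne_one cs' j')
    exact hij' (CoxGeo.simple_inj cs' (hi'.trans hj'.symm))
  have hpull : ∀ u v : W, IsConj (φ u) (φ v) → IsConj u v := by
    intro u v h
    obtain ⟨c, hc⟩ := isConj_iff.1 h
    refine isConj_iff.2 ⟨φ.symm c, φ.injective ?_⟩
    simpa using hc
  have hab : IsConj (cs.simple b) (cs.simple a) := hpull _ _ (hb.symm.trans ha)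
  -- odd edge at `a`
  obtain ⟨e, hae, hodd⟩ : ∃ e, a ≠ e ∧ Odd (M a e) := by
    by_contra hcon
    push Not at hcon
    obtain ⟨η, he1, he2⟩ := CoxGeo.exists_ret cs {a} (by
      rintro c rfl d hd
      have := hcon d (fun h => hd h.symm)
      rwa [Nat.not_odd_iff_even] at this)
    obtain ⟨w, hw⟩ := isConj_iff.1 hab
    have h1 := congrArg η hw
    rw [map_mul, map_mul, he2 b hba, he1 a rfl, map_inv, mul_one, mul_inv_cancel] at h1
    exact CoxGeo.simple_ne_one cs a h1.symm
  obtain ⟨η, he1, he2⟩ := CoxGeo.exists_ret cs {a, e} (by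
    intro c hc d hd
    by_contra hcon
    rw [Nat.not_even_iff_odd] at hcon
    simp only [Set.mem_insert_iff, Set.mem_singleton_iff, not_or] at hc hd
    rcases hc with rfl | rfl
    · exact h2 ⟨e, c, d, hae.symm, fun h => hd.1 h.symm, fun h => hd.2 h.symm,
        by rwa [M.symmetric e c], hcon⟩
    · exact h2 ⟨a, c, d, hae, fun h => hd.2 h.symm, fun h => hd.1 h.symm, hodd, hcon⟩)
  refine le_trans ?_ (h3 a e hae hodd)
  -- the map
  have hex : ∀ T' : Set B', cs'.IsMaxSpherical T' → ∃ (g : W) (T : Set B), cs.IsMaxSpherical T ∧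
      ∀ w ∈ cs'.parabolic T', g⁻¹ * φ.symm w * g ∈ cs.parabolic T := by
    intro T' hT'
    have : Finite (cs'.parabolic T') := hT'.1
    have : Finite ((cs'.parabolic T').map φ.symm.toMonoidHom) := by
      have h : ((cs'.parabolic T' : Set W').Finite) := hT'.1
      have := h.image φ.symm
      exact this
    obtain ⟨g, T, hT, h⟩ := CoxGeo.finite_in_max cs ((cs'.parabolic T').map φ.symm.toMonoidHom)
    exact ⟨g, T, hT, fun w hw => h _ ⟨w, hw, rfl⟩⟩
  choose! g τ hτ1 hτ2 using hex
  refine Set.ncard_le_ncard_of_injOn τ ?_ ?_ (Set.toFinite _)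
  · rintro T' ⟨hT', c, hcT, hc⟩
    refine ⟨hτ1 T' hT', ?_⟩
    have hcc : IsConj (cs'.simple i') (cs'.simple c) := by
      rcases hc with rfl | hc
      · exact IsConj.refl _
      · rw [Set.mem_singleton_iff] at hc
        rw [hc]; exact hconj'
    have hmem := hτ2 T' hT' (cs'.simple c) (Subgroup.subset_closure ⟨c, hcT, rfl⟩)
    by_contra hemp
    have hη : ∀ w ∈ cs.parabolic (τ T'), η w = 1 := by
      intro w hw
      induction hw using Subgroup.closure_induction with
      | mem w h =>
        obtain ⟨t, ht, rfl⟩ := h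
        exact he2 t (fun h => hemp ⟨t, ht, h⟩)
      | one => simp
      | mul w u _ _ h1 h2 => rw [map_mul, h1, h2, mul_one]
      | inv w _ h => rw [map_inv, h, inv_one]
    have h5 := hη _ hmem
    have h6 : IsConj (φ.symm (cs'.simple c)) (cs.simple a) := by
      apply hpull
      rw [MulEquiv.apply_symm_apply]
      exact hcc.symm.trans ha
    obtain ⟨w, hw⟩ := isConj_iff.1 h6
    have h7 : η (φ.symm (cs'.simple c)) = 1 := by
      have : φ.symm (cs'.simple c) =
        g T' * ((g T')⁻¹ * φ.symm (cs'.simple c) * g T') * (g T')⁻¹ := by group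
      rw [this, map_mul, map_mul, h5, mul_one, map_inv, mul_inv_cancel]
    have h8 := congrArg η hw
    rw [map_mul, map_mul, h7, map_inv, mul_one, mul_inv_cancel, he1 a (by simp)] at h8
    exact CoxGeo.simple_ne_one cs a h8.symm
  · rintro T₁ ⟨hT₁, -⟩ T₂ ⟨hT₂, -⟩ heq
    have hfin : Finite ((cs.parabolic (τ T₁)).map φ.toMonoidHom) := by
      have h : ((cs.parabolic (τ T₁) : Set W).Finite) := (hτ1 T₁ hT₁).1
      have := h.image φ
      exact this
    obtain ⟨k, U, hU, hk⟩ := CoxGeo.finite_in_max cs' ((cs.parabolic (τ T₁)).map φ.toMonoidHom)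
    have key : ∀ T, cs'.IsMaxSpherical T → τ T = τ T₁ → T = U := by
      intro T hT hTT
      refine CoxGeo.max_unique cs' T U hT hU.1 (φ (g T) * k) fun w hw => ?_
      have h1 := hτ2 T hT w hw
      rw [hTT] at h1
      have h2 := hk _ ⟨_, h1, rfl⟩
      convert h2 using 1
      simp [mul_assoc]
    rw [key T₁ hT₁ rfl, key T₂ hT₂ heq.symm]
end

section
/- Let (W,S) be a Coxeter system satisfying conditions (1), (2), (3) below, let (W',S') be a Coxeter system, and let φ: W → W' be a group isomorphism such that φ maps every reflection of (W,S) to a reflection of (W',S'). Then for each s ∈ S, the number of elements a' ∈ S' that are conjugate in W' to φ(s) is either 1 or 2. Conditions: (1) for each s,t ∈ S with m(s,t) odd, {s,t} is a maximal spherical subset of S; (2) there is no three-element subset {s,t,u} ⊆ S with m(s,t) and m(t,u) both odd; (3) for each s,t ∈ S with m(s,t) odd, at most two maximal spherical subsets of S intersect {s,t}. -/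
noncomputable section CoxAux

open Polynomial Polynomial.Chebyshev

variable {B W : Type*} [Group W] {M : CoxeterMatrix B}

/-- The coefficients of (twice) the standard bilinear form. -/
def coxCoef (M : CoxeterMatrix B) (a b : B) : ℝ := -2 * Real.cos (Real.pi / (M a b : ℕ))

theorem coxCoef_comm (a b : B) : coxCoef M a b = coxCoef M b a := by
  unfold coxCoef; rw [M.symmetric]

theorem coxCoef_self (a : B) : coxCoef M a a = 2 := by
  simp [coxCoef]

theorem coxCoef_nonpos {a b : B} (h : a ≠ b) : coxCoef M a b ≤ 0 := by
  have h1 : M a b ≠ 1 := M.off_diagonal a b h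
  have : 0 ≤ Real.cos (Real.pi / (M a b : ℕ)) := by
    rcases Nat.eq_zero_or_pos (M a b) with h0 | h0
    · simp [h0]
    · have h2 : (2 : ℝ) ≤ (M a b : ℕ) := by exact_mod_cast (by omega : 2 ≤ M a b)
      apply Real.cos_nonneg_of_neg_pi_div_two_le_of_le
      · have : 0 ≤ Real.pi / (M a b : ℕ) := by positivity
        linarith [Real.pi_pos]
      · gcongr
  unfold coxCoef; linarith

/-- The simple coroot. -/
def coxDual (M : CoxeterMatrix B) (a : B) : Module.Dual ℝ (B →₀ ℝ) :=
  Finsupp.linearCombination ℝ (coxCoef M a)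

/-- The simple root. -/
abbrev coxE (a : B) : B →₀ ℝ := Finsupp.single a 1

theorem coxDual_E (a b : B) : coxDual M a (coxE b) = coxCoef M a b := by
  simp [coxDual, coxE]

theorem coxDual_self (a : B) : coxDual M a (coxE a) = 2 := by
  rw [coxDual_E, coxCoef_self]

/-- The simple reflection in the geometric representation. -/
def coxRefl (M : CoxeterMatrix B) (a : B) : (B →₀ ℝ) ≃ₗ[ℝ] (B →₀ ℝ) :=
  Module.reflection (coxDual_self (M := M) a)

theorem coxRefl_apply (a : B) (v : B →₀ ℝ) :
    coxRefl M a v = v - coxDual M a v • coxE a := by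
  simp [coxRefl, Module.reflection_apply]

theorem coxRefl_sq (a : B) : coxRefl M a * coxRefl M a = 1 := by
  ext1 v
  exact Module.involutive_reflection (coxDual_self (M := M) a) v

theorem coxRefl_pow (a b : B) : (coxRefl M a * coxRefl M b) ^ (M a b) = 1 := by
  rcases eq_or_ne a b with rfl | hab
  · simp [coxRefl_sq]
  obtain ⟨m, hm⟩ : ∃ m, m = M a b := ⟨_, rfl⟩
  have hm1 : m ≠ 1 := hm ▸ M.off_diagonal a b hab
  rw [← hm]
  rcases Nat.eq_zero_or_pos m with h0 | h0
  · simp [h0]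
  set θ : ℝ := 2 * Real.pi / m with hθ
  have hmR : (m : ℝ) ≠ 0 := by positivity
  have ht : 2 * Real.cos θ = coxDual M a (coxE b) * coxDual M b (coxE a) - 2 := by
    rw [coxDual_E, coxDual_E, coxCoef_comm b a, coxCoef, ← hm,
      show θ = 2 * (Real.pi / m) by rw [hθ]; ring, Real.cos_two_mul]
    ring
  ext1 z
  have key := Module.reflection_mul_reflection_pow_apply (coxDual_self (M := M) a)
    (coxDual_self (M := M) b) m z (2 * Real.cos θ) ht
  change ((coxRefl M a * coxRefl M b) ^ m) z = _ at key
  rw [key]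
  change _ = z
  rcases eq_or_ne m 2 with rfl | hm2
  · have h0 : coxCoef M a b = 0 := by simp [coxCoef, ← hm]
    have hc : 2 * Real.cos θ = -2 := by
      rw [ht, coxDual_E, h0]; ring
    rw [hc, coxDual_E, coxDual_E, coxCoef_comm b a, h0]
    norm_num
    module
  have h3 : (3 : ℝ) ≤ m := by exact_mod_cast (by omega : 3 ≤ m)
  have hsin : Real.sin θ ≠ 0 := by
    apply ne_of_gt
    apply Real.sin_pos_of_pos_of_lt_pi
    · rw [hθ]; have := Real.pi_pos; positivity
    · rw [hθ, div_lt_iff₀ (by positivity)]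
      nlinarith [Real.pi_pos]
  have hmθ : (m : ℝ) * θ = 2 * Real.pi := by rw [hθ]; field_simp
  rcases Nat.even_or_odd' m with ⟨k, hk | hk⟩
  · have e1 : ((m : ℤ) - 2) / 2 = k - 1 := by omega
    have e2 : ((m : ℤ) - 1) / 2 = k - 1 := by omega
    have hS : (S ℝ ((k : ℤ) - 1)).eval (2 * Real.cos θ) = 0 := by
      have h := S_two_mul_real_cos θ ((k : ℤ) - 1)
      have : (((k : ℤ) - 1 : ℤ) + 1 : ℝ) * θ = Real.pi := by
        push_cast
        rw [hk] at hmθ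
        push_cast at hmθ
        linarith
      rw [this, Real.sin_pi] at h
      exact (mul_eq_zero.mp h).resolve_right hsin
    rw [e1, e2, hS]
    simp
  · have e1 : ((m : ℤ) - 1) / 2 = k := by omega
    have e2 : ((m : ℤ) - 3) / 2 = k - 1 := by omega
    have e3 : (m : ℤ) / 2 = k := by omega
    have e4 : ((m : ℤ) - 2) / 2 = k - 1 := by omega
    have hS : (S ℝ (k : ℤ)).eval (2 * Real.cos θ) + (S ℝ ((k : ℤ) - 1)).eval (2 * Real.cos θ)
        = 0 := by
      have h := S_two_mul_real_cos θ ((k : ℤ) - 1)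
      have h' := S_two_mul_real_cos θ (k : ℤ)
      have : (((k : ℤ) : ℝ) + 1) * θ = 2 * Real.pi - (((k : ℤ) - 1 : ℤ) + 1 : ℝ) * θ := by
        push_cast
        rw [hk] at hmθ
        push_cast at hmθ
        linarith
      rw [this, Real.sin_two_pi_sub] at h'
      have : ((S ℝ (k : ℤ)).eval (2 * Real.cos θ) +
        (S ℝ ((k : ℤ) - 1)).eval (2 * Real.cos θ)) * Real.sin θ = 0 := by
        rw [add_mul, h, h']; ring
      exact (mul_eq_zero.mp this).resolve_right hsin
    rw [e1, e2, e3, e4, hS]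
    simp

theorem coxRefl_contra {a b c : B} (hab : a ≠ b) (hbc : b ≠ c) (hac : a ≠ c)
    {m : ℕ} (hm : Odd m) (h1 : (coxRefl M a * coxRefl M b) ^ m = 1)
    (h2 : (coxRefl M a * coxRefl M b * coxRefl M c) = coxRefl M c * coxRefl M b * coxRefl M a) :
    False := by
  have key := congrArg (fun f : (B →₀ ℝ) ≃ₗ[ℝ] (B →₀ ℝ) => f (coxE a)) h2
  simp only [LinearEquiv.mul_apply, coxRefl_apply, map_sub, map_smul, coxDual_E, coxCoef_self,
    coxCoef_comm b a, coxCoef_comm c b, coxCoef_comm c a, smul_eq_mul] at key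
  have kb := DFunLike.congr_fun key b
  have kc := DFunLike.congr_fun key c
  simp [hab, hbc, hac, hab.symm, hbc.symm, hac.symm] at kb kc
  have P := coxCoef_nonpos (M := M) hab
  have Q := coxCoef_nonpos (M := M) hbc
  have T := coxCoef_nonpos (M := M) hac
  have hT : coxCoef M a c = 0 := by nlinarith
  have hP : coxCoef M a b = 0 := by rw [hT] at kb; linarith
  have step : (coxRefl M a * coxRefl M b) (coxE a) = - coxE a := by
    simp only [LinearEquiv.mul_apply, coxRefl_apply, map_sub, map_smul, coxDual_E, coxCoef_self,
      coxCoef_comm b a, hP]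
    module
  have pw : ∀ n : ℕ, ((coxRefl M a * coxRefl M b) ^ n) (coxE a) = (-1 : ℝ) ^ n • coxE a := by
    intro n
    induction n with
    | zero => simp
    | succ n ih => rw [pow_succ', LinearEquiv.mul_apply, ih, map_smul, step, pow_succ]; module
  have h := pw m
  rw [h1, hm.neg_one_pow] at h
  have := DFunLike.congr_fun h a
  simp at this
  norm_num at this

theorem dihedral_form {G : Type*} [Group G] (cs : CoxeterSystem M W) (F : W →* G) {i t : B}
    (hF : ∀ j, F (cs.simple j) = 1 ∨ j = i ∨ j = t) (w : W) :
    ∃ k : ℤ, F w = (F (cs.simple i) * F (cs.simple t)) ^ k ∨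
      F w = (F (cs.simple i) * F (cs.simple t)) ^ k * F (cs.simple i) := by
  have hg : F (cs.simple i) * F (cs.simple i) = 1 := by rw [← map_mul]; simp
  have hh : F (cs.simple t) * F (cs.simple t) = 1 := by rw [← map_mul]; simp
  set g := F (cs.simple i)
  set h := F (cs.simple t)
  have hrg : (g * h) * g = g * (g * h)⁻¹ := by
    rw [mul_inv_rev, inv_eq_of_mul_eq_one_left hg, inv_eq_of_mul_eq_one_left hh, mul_assoc]
  have hgh : h = (g * h)⁻¹ * g := by
    rw [mul_inv_rev, inv_mul_cancel_right, inv_eq_of_mul_eq_one_left hh]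
  induction w using cs.simple_induction_right with
  | one => exact ⟨0, by simp⟩
  | mul_simple_right w j ih =>
    have hgr : ∀ k : ℤ, g * (g * h) ^ k = (g * h) ^ (-k) * g := by
      intro k
      have : SemiconjBy g (g * h) (g * h)⁻¹ := by
        rw [SemiconjBy, mul_inv_rev, inv_mul_cancel_right, inv_eq_of_mul_eq_one_left hh,
          ← mul_assoc, hg, one_mul]
      have := this.zpow_right k
      rw [inv_zpow'] at this
      exact this
    obtain ⟨k, hk⟩ := ih
    rcases hF j with hj | rfl | rfl
    · exact ⟨k, by simpa [hj] using hk⟩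
    · rcases hk with hk | hk
      · exact ⟨k, Or.inr (by rw [map_mul, hk])⟩
      · exact ⟨k, Or.inl (by rw [map_mul, hk, mul_assoc, hg, mul_one])⟩
    · rcases hk with hk | hk
      · refine ⟨k - 1, Or.inr ?_⟩
        rw [map_mul, hk, zpow_sub_one, mul_assoc, ← hgh]
      · refine ⟨k + 1, Or.inl ?_⟩
        rw [map_mul, hk, zpow_add_one, mul_assoc]

theorem dihedral_conj {G : Type*} [Group G] {g h x : G} (hg : g * g = 1) (hh : h * h = 1)
    (hx : ∃ k : ℤ, x = (g * h) ^ k ∨ x = (g * h) ^ k * g) :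
    ∃ k : ℤ, x * g * x⁻¹ = (g * h) ^ k * g := by
  obtain ⟨k, hk⟩ := hx
  have hgr : g * ((g * h) ^ k)⁻¹ = (g * h) ^ k * g := by
    have : SemiconjBy g (g * h) (g * h)⁻¹ := by
      rw [SemiconjBy, mul_inv_rev, inv_mul_cancel_right, inv_eq_of_mul_eq_one_left hh,
        ← mul_assoc, hg, one_mul]
    have := this.zpow_right (-k)
    rw [inv_zpow', neg_neg, zpow_neg] at this
    exact this
  refine ⟨k + k, ?_⟩
  have : x * g * x⁻¹ = (g * h) ^ k * (g * ((g * h) ^ k)⁻¹) := by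
    rcases hk with rfl | rfl
    · rw [mul_assoc]
    · rw [mul_inv_rev]; group
  rw [this, hgr, zpow_add, mul_assoc]

theorem dihedral_rel {G : Type*} [Group G] {g h : G} (hg : g * g = 1) (hh : h * h = 1)
    {m : ℕ} (hm : (g * h) ^ m = 1) (k l n : ℤ) :
    (((g * h) ^ k * g) * ((g * h) ^ l * g)) ^ m = 1 ∧
    ((g * h) ^ k * g) * ((g * h) ^ l * g) * ((g * h) ^ n * g) =
      ((g * h) ^ n * g) * ((g * h) ^ l * g) * ((g * h) ^ k * g) := by
  have hgr : ∀ k : ℤ, g * (g * h) ^ k * g = (g * h) ^ (-k) := by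
    intro k
    have : SemiconjBy g (g * h) (g * h)⁻¹ := by
      rw [SemiconjBy, mul_inv_rev, inv_mul_cancel_right, inv_eq_of_mul_eq_one_left hh,
        ← mul_assoc, hg, one_mul]
    have := this.zpow_right k
    rw [inv_zpow', SemiconjBy] at this
    rw [this, mul_assoc, hg, mul_one]
  have e : ∀ k l : ℤ, ((g * h) ^ k * g) * ((g * h) ^ l * g) = (g * h) ^ (k - l) := by
    intro k l
    rw [mul_assoc, ← mul_assoc g, hgr, ← zpow_add, sub_eq_add_neg]
  rw [e, e]
  constructor
  · rw [← zpow_natCast, zpow_comm, zpow_natCast, hm, one_zpow]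
  · rw [← mul_assoc, ← mul_assoc, ← zpow_add, ← zpow_add]
    congr 2
    ring

theorem isConj_of_odd (cs : CoxeterSystem M W) {a b : B} (h : Odd (M a b)) :
    IsConj (cs.simple a) (cs.simple b) := by
  obtain ⟨k, hk⟩ := h
  have e := cs.simple_mul_simple_pow a b
  rw [hk] at e
  have ha := cs.simple_mul_simple_self a
  have hb := cs.simple_mul_simple_self b
  set x := cs.simple a
  set y := cs.simple b
  rw [isConj_iff]
  have hgr : x * ((x * y) ^ k)⁻¹ = (x * y) ^ k * x := by
    have : SemiconjBy x (x * y) (x * y)⁻¹ := by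
      rw [SemiconjBy, mul_inv_rev, inv_mul_cancel_right, inv_eq_of_mul_eq_one_left hb,
        ← mul_assoc, ha, one_mul]
    have := this.zpow_right (-(k : ℤ))
    rw [inv_zpow', neg_neg, zpow_neg, zpow_natCast] at this
    exact this
  refine ⟨(x * y) ^ k, ?_⟩
  rw [mul_assoc, hgr, ← mul_assoc, ← pow_add]
  have : (x * y) ^ (k + k) * (x * y) = 1 := by rw [← pow_succ, ← e]; congr 1; ring
  rw [← mul_assoc] at this
  have h5 := inv_eq_of_mul_eq_one_left this
  rw [inv_eq_of_mul_eq_one_left hb] at h5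
  exact h5.symm

open Classical in
theorem exists_partner (cs : CoxeterSystem M W)
    (h2 : ¬ ∃ i j k : B, i ≠ j ∧ j ≠ k ∧ i ≠ k ∧ Odd (M i j) ∧ Odd (M j k)) (i : B) :
    ∃ t, Odd (M i t) ∧ ∀ j, IsConj (cs.simple i) (cs.simple j) → j = i ∨ j = t := by
  have lf : CoxeterMatrix.IsLiftable M
      (fun j => if Odd (M i j) then (-1 : ℤˣ) else 1) := by
    have main : ∀ j k, Odd (M i j) → ¬ Odd (M i k) → Even (M j k) := by
      intro j k hj hk
      by_contra hjk
      rw [Nat.not_even_iff_odd] at hjk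
      have hki : i ≠ k := by rintro rfl; simp at hk
      have hji : i ≠ j := by rintro rfl; exact hk hjk
      have hjk' : j ≠ k := by rintro rfl; exact hk hj
      exact h2 ⟨i, j, k, hji, hjk', hki, hj, hjk⟩
    intro j k
    by_cases hj : Odd (M i j) <;> by_cases hk : Odd (M i k)
    · simp [hj, hk]
    · simp only [hj, hk, if_true, if_false, mul_one]; exact (main j k hj hk).neg_one_pow
    · simp only [hj, hk, if_true, if_false, one_mul]
      rw [M.symmetric]; exact (main k j hk hj).neg_one_pow
    · simp [hj, hk]
  have hodd : ∀ j, IsConj (cs.simple i) (cs.simple j) → Odd (M i j) := by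
    intro j hj
    have := (cs.lift ⟨_, lf⟩).map_isConj hj
    rw [isConj_iff_eq, cs.lift_apply_simple, cs.lift_apply_simple] at this
    by_contra hc
    simp [hc] at this
  by_cases ht : ∃ t, t ≠ i ∧ Odd (M i t)
  · obtain ⟨t, hti, ht⟩ := ht
    refine ⟨t, ht, fun j hj => ?_⟩
    by_contra hc
    push Not at hc
    exact h2 ⟨t, i, j, hti, hc.1.symm, hc.2.symm, by rwa [M.symmetric], hodd j hj⟩
  · push Not at ht
    refine ⟨i, by simp, fun j hj => Or.inl ?_⟩
    by_contra hc
    exact ht j hc (hodd j hj)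

end CoxAux

theorem conj_class_count_image {B W B' W' : Type*} [Group W] [Group W'] [Finite B] [Finite B']
    {M : CoxeterMatrix B} {M' : CoxeterMatrix B'}
    (cs : CoxeterSystem M W) (cs' : CoxeterSystem M' W')
    (φ : W ≃* W')
    (hφ : ∀ w : W, cs.IsReflection w → cs'.IsReflection (φ w))
    (h1 : ∀ i j : B, i ≠ j → Odd (M i j) → cs.IsMaxSpherical {i, j})
    (h2 : ¬ ∃ i j k : B, i ≠ j ∧ j ≠ k ∧ i ≠ k ∧ Odd (M i j) ∧ Odd (M j k))
    (h3 : ∀ i j : B, i ≠ j → Odd (M i j) →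
      {T : Set B | cs.IsMaxSpherical T ∧ (T ∩ {i, j}).Nonempty}.ncard ≤ 2) :
    ∀ i : B, {a' : B' | IsConj (φ (cs.simple i)) (cs'.simple a')}.ncard = 1 ∨
      {a' : B' | IsConj (φ (cs.simple i)) (cs'.simple a')}.ncard = 2 := by
  classical
  intro i
  set X : Set B' := {a' : B' | IsConj (φ (cs.simple i)) (cs'.simple a')} with hX
  have hne : X.Nonempty := by
    obtain ⟨w, a, ha⟩ := hφ _ (cs.isReflection_simple i)
    exact ⟨a, (isConj_iff.mpr ⟨w, ha.symm⟩ : IsConj _ _).symm⟩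
  have hpos : 0 < X.ncard := (Set.ncard_pos X.toFinite).mpr hne
  by_contra hcon
  have h3' : 2 < X.ncard := by omega
  obtain ⟨a, ha, b, hb, c, hc, hab, hac, hbc⟩ := (Set.two_lt_ncard X.toFinite).mp h3'
  have lf : CoxeterMatrix.IsLiftable M' (fun j => if j ∈ X then coxRefl M' j else 1) := by
    have main : ∀ j k, j ∈ X → k ∉ X → Even (M' j k) := by
      intro j k hj hk
      by_contra hjk
      rw [Nat.not_even_iff_odd] at hjk
      exact hk (IsConj.trans hj (isConj_of_odd cs' hjk))
    have sq : ∀ j n, Even n → coxRefl M' j ^ n = 1 := by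
      rintro j n ⟨k, rfl⟩
      rw [pow_add, ← (Commute.refl _).mul_pow, coxRefl_sq, one_pow]
    intro j k
    by_cases hj : j ∈ X <;> by_cases hk : k ∈ X
    · simp only [hj, hk, if_true]; exact coxRefl_pow j k
    · simp only [hj, hk, if_true, if_false, mul_one]; exact sq _ _ (main j k hj hk)
    · simp only [hj, hk, if_true, if_false, one_mul]
      rw [M'.symmetric]; exact sq _ _ (main k j hk hj)
    · simp [hj, hk]
  set f := cs'.lift ⟨_, lf⟩ with hf
  have fs : ∀ j, f (cs'.simple j) = if j ∈ X then coxRefl M' j else 1 :=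
    fun j => cs'.lift_apply_simple lf j
  let F : W →* _ := f.comp φ.toMonoidHom
  have hFa : ∀ w, F w = f (φ w) := fun w => rfl
  obtain ⟨t, htodd, ht⟩ := exists_partner cs h2 i
  have hF : ∀ j, F (cs.simple j) = 1 ∨ j = i ∨ j = t := by
    intro j
    by_cases hj : IsConj (cs.simple i) (cs.simple j)
    · exact Or.inr (ht j hj)
    · left
      obtain ⟨w, d, hd⟩ := hφ _ (cs.isReflection_simple j)
      have hdX : d ∉ X := by
        intro hdX
        apply hj
        have h5 : IsConj (φ (cs.simple i)) (φ (cs.simple j)) :=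
          IsConj.trans hdX (isConj_iff.mpr ⟨w, hd.symm⟩)
        have := φ.symm.toMonoidHom.map_isConj h5
        simpa using this
      rw [hFa, hd, map_mul, map_mul, fs, if_neg hdX, mul_one, ← map_mul, mul_inv_cancel, map_one]
  have hg : F (cs.simple i) * F (cs.simple i) = 1 := by rw [← map_mul]; simp
  have hh : F (cs.simple t) * F (cs.simple t) = 1 := by rw [← map_mul]; simp
  have hm : (F (cs.simple i) * F (cs.simple t)) ^ (M i t) = 1 := by
    rw [← map_mul, ← map_pow]; simp
  have form : ∀ d ∈ X, ∃ k : ℤ, coxRefl M' d =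
      (F (cs.simple i) * F (cs.simple t)) ^ k * F (cs.simple i) := by
    intro d hd
    obtain ⟨w, hw⟩ := isConj_iff.mp hd
    have := dihedral_conj hg hh (dihedral_form cs F hF (φ.symm w))
    have e : F (φ.symm w) * F (cs.simple i) * (F (φ.symm w))⁻¹ = coxRefl M' d := by
      rw [← map_inv, ← map_mul, ← map_mul, hFa, map_mul φ, map_mul φ, map_inv φ,
        φ.apply_symm_apply, hw, fs, if_pos hd]
    rwa [e] at this
  obtain ⟨k, hk⟩ := form a ha
  obtain ⟨l, hl⟩ := form b hb
  obtain ⟨n, hn⟩ := form c hc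
  obtain ⟨r1, r2⟩ := dihedral_rel hg hh hm k l n
  rw [← hk, ← hl] at r1
  rw [← hk, ← hl, ← hn] at r2
  exact coxRefl_contra hab hbc hac htodd r1 r2
end

section
/- Let (W,S) and (W',S') be Coxeter systems and suppose there exists a group isomorphism φ: W → W'. Then for each maximal spherical subset T ⊆ S, there exists a unique maximal spherical subset T' ⊆ S' such that φ(W_T) = w' W'_{T'} (w')^{-1} for some w' ∈ W'. -/
namespace Cox

open Finsupp

/-- simple root -/
noncomputable def al {B : Type*} (s : B) : B →₀ ℝ := Finsupp.single s 1

/-- simple coroot -/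
noncomputable def fn {B : Type*} (M : CoxeterMatrix B) (s : B) : (B →₀ ℝ) →ₗ[ℝ] ℝ :=
  Finsupp.linearCombination ℝ (fun t => -2 * Real.cos (Real.pi / (M s t : ℝ)))

/-- simple reflection -/
noncomputable def rf {B : Type*} (M : CoxeterMatrix B) (s : B) : Module.End ℝ (B →₀ ℝ) :=
  LinearMap.id - (fn M s).smulRight (al s)

section
variable {B : Type*} (M : CoxeterMatrix B)

lemma rf_apply (s : B) (v : B →₀ ℝ) : rf M s v = v - fn M s v • al s := rfl

lemma fn_al (s t : B) : fn M s (al t) = -2 * Real.cos (Real.pi / (M s t : ℝ)) := by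
  simp [fn, al]

lemma fn_al_self (s : B) : fn M s (al s) = 2 := by
  simp [fn_al]

lemma fn_al_comm (s t : B) : fn M s (al t) = fn M t (al s) := by
  rw [fn_al, fn_al, M.symmetric]

lemma rf_al_self (s : B) : rf M s (al s) = - al s := by
  rw [rf_apply, fn_al_self, two_smul]; abel

lemma rf_rf (s : B) (v : B →₀ ℝ) : rf M s (rf M s v) = v := by
  rw [rf_apply, rf_apply, map_sub, map_smul, fn_al_self]
  simp only [smul_eq_mul, sub_smul, mul_smul, two_smul, smul_add]; abel

/-- the bilinear form -/
noncomputable def bf : (B →₀ ℝ) →ₗ[ℝ] (B →₀ ℝ) →ₗ[ℝ] ℝ :=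
  Finsupp.linearCombination ℝ (fn M)

lemma bf_al (s : B) : bf M (al s) = fn M s := by simp [bf, al]

lemma bf_al' (s : B) (v : B →₀ ℝ) : bf M v (al s) = fn M s v := by
  have : (bf M).flip (al s) = fn M s := by
    apply Finsupp.lhom_ext
    intro t b
    have h : Finsupp.single t b = b • (al t : B →₀ ℝ) := by simp [al]
    rw [h, map_smul, map_smul, LinearMap.flip_apply, bf_al, fn_al_comm]
  rw [← this]; rfl

lemma bf_rf (s : B) (v : B →₀ ℝ) : bf M (rf M s v) (rf M s v) = bf M v v := by
  rw [rf_apply]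
  simp only [map_sub, map_smul, LinearMap.sub_apply, LinearMap.smul_apply, bf_al, bf_al', fn_al_self,
    smul_eq_mul]
  ring

/-- Chebyshev-type sequence. -/
noncomputable def U (m k : ℕ) : ℝ :=
  if m = 0 then k else Real.sin (k * (Real.pi / m)) / Real.sin (Real.pi / m)

lemma U_zero (m : ℕ) : U m 0 = 0 := by simp [U]

lemma sin_pos' {m : ℕ} (h0 : m ≠ 0) (h1 : m ≠ 1) : 0 < Real.sin (Real.pi / m) := by
  have h2 : (2 : ℝ) ≤ m := by exact_mod_cast (by omega : 2 ≤ m)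
  apply Real.sin_pos_of_pos_of_lt_pi
  · have := Real.pi_pos; positivity
  · rw [div_lt_iff₀ (by positivity)]; nlinarith [Real.pi_pos]

lemma U_one {m : ℕ} (h1 : m ≠ 1) : U m 1 = 1 := by
  unfold U
  split_ifs with h0
  · simp
  · rw [Nat.cast_one, one_mul, div_self (sin_pos' h0 h1).ne']

lemma U_rec (m k : ℕ) : U m (k+2) = 2 * Real.cos (Real.pi / m) * U m (k+1) - U m k := by
  unfold U
  split_ifs with h0
  · subst h0; push_cast; simp; ring
  · set θ := Real.pi / m
    have e1 : ((k+2 : ℕ) : ℝ) * θ = ((k+1 : ℕ) : ℝ) * θ + θ := by push_cast; ring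
    have e2 : ((k : ℕ) : ℝ) * θ = ((k+1 : ℕ) : ℝ) * θ - θ := by push_cast; ring
    rw [e1, e2, Real.sin_add, Real.sin_sub]; ring

lemma U_nonneg {m k : ℕ} (h1 : m ≠ 1) (hk : m = 0 ∨ k ≤ m) : 0 ≤ U m k := by
  unfold U
  split_ifs with h0
  · positivity
  · have hk : (k : ℝ) ≤ m := by exact_mod_cast hk.resolve_left h0
    have hm : (0 : ℝ) < m := by exact_mod_cast Nat.pos_of_ne_zero h0
    apply div_nonneg _ (sin_pos' h0 h1).le
    apply Real.sin_nonneg_of_nonneg_of_le_pi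
    · have := Real.pi_pos; positivity
    · rw [mul_div_assoc', div_le_iff₀ hm]; nlinarith [Real.pi_pos]

lemma U_two_mul {m : ℕ} (h0 : m ≠ 0) : U m (2*m) = 0 := by
  have hm : (m : ℝ) ≠ 0 := by exact_mod_cast h0
  have : ((2*m : ℕ) : ℝ) * (Real.pi / m) = 2 * Real.pi := by push_cast; field_simp
  rw [U, if_neg h0, this]; simp

lemma U_two_mul_add {m : ℕ} (h0 : m ≠ 0) (h1 : m ≠ 1) : U m (2*m+1) = 1 := by
  have hm : (m : ℝ) ≠ 0 := by exact_mod_cast h0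
  have : ((2*m+1 : ℕ) : ℝ) * (Real.pi / m) = Real.pi / m + 2 * Real.pi := by
    push_cast; field_simp; ring
  rw [U, if_neg h0, this, Real.sin_add_two_pi, div_self (sin_pos' h0 h1).ne']

lemma rf_comb (s t : B) (a b : ℝ) :
    rf M t (a • al s + b • al t) = a • al s + (2 * Real.cos (Real.pi / M s t) * a - b) • al t := by
  rw [rf_apply, map_add, map_smul, map_smul, fn_al_self, fn_al, M.symmetric t s, add_sub_assoc,
    ← sub_smul]
  congr 2; simp only [smul_eq_mul]; ring

lemma rf_pow_al (s t : B) (h : M s t ≠ 1) (j : ℕ) : ((rf M s * rf M t)^j) (al s) =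
    U (M s t) (2*j+1) • al s + U (M s t) (2*j) • al t := by
  induction j with
  | zero => simp [U_zero, U_one h]
  | succ j ih =>
    rw [pow_succ', Module.End.mul_apply, ih, Module.End.mul_apply, rf_comb, ← U_rec, add_comm (_ • al s),
      rf_comb, M.symmetric t s, ← U_rec, add_comm]
    rfl

lemma rf_liftable : M.IsLiftable (rf M) := by
  intro s t
  by_cases h0 : M s t = 0
  · simp [h0]
  by_cases h1 : M s t = 1
  · have hst : s = t := by by_contra h; exact M.off_diagonal s t h h1
    subst hst
    rw [h1, pow_one]; ext1 v; ext1; simp [rf_rf]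
  have hs : ((rf M s * rf M t)^(M s t)) (al s) = al s := by
    rw [rf_pow_al M s t h1, U_two_mul_add h0 h1, U_two_mul h0]; simp
  have ht' : ((rf M t * rf M s)^(M s t)) (al t) = al t := by
    rw [M.symmetric s t] at h0 h1 ⊢
    rw [rf_pow_al M t s h1, U_two_mul_add h0 h1, U_two_mul h0]; simp
  have hinv : ∀ n v, ((rf M s * rf M t)^n) (((rf M t * rf M s)^n) v) = v := by
    intro n
    induction n with
    | zero => intro v; rfl
    | succ n ih =>
      intro v
      rw [pow_succ, pow_succ' _ n, Module.End.mul_apply, Module.End.mul_apply, Module.End.mul_apply,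
        Module.End.mul_apply, rf_rf, rf_rf, ih]
  have ht : ((rf M s * rf M t)^(M s t)) (al t) = al t := by
    conv_lhs => rw [← ht']
    exact hinv _ _
  have hfix : ∀ v, fn M s v = 0 → fn M t v = 0 → ∀ n, ((rf M s * rf M t)^n) v = v := by
    intro v h1 h2 n
    induction n with
    | zero => rfl
    | succ n ih =>
      rw [pow_succ, Module.End.mul_apply, Module.End.mul_apply, rf_apply M t, h2, zero_smul, sub_zero,
        rf_apply, h1, zero_smul, sub_zero, ih]
  apply LinearMap.ext
  intro v
  rw [Module.End.one_apply]
  set c := Real.cos (Real.pi / M s t) with hc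
  have hdet : 1 - c^2 ≠ 0 := by
    have := sin_pos' h0 h1
    have h2 := Real.sin_sq_add_cos_sq (Real.pi / M s t)
    have : 1 - c^2 = Real.sin (Real.pi / M s t)^2 := by rw [hc]; linarith
    rw [this]; positivity
  have e1 : fn M s (al t) = -2*c := fn_al M s t
  have e2 : fn M t (al s) = -2*c := by rw [← fn_al_comm, e1]
  set a := (fn M s v + c * fn M t v) / (2*(1-c^2)) with ha
  set b := (fn M t v + c * fn M s v) / (2*(1-c^2)) with hb
  have h2 : ((rf M s * rf M t)^(M s t)) (v - a • al s - b • al t) = v - a • al s - b • al t := by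
    apply hfix
    · simp only [map_sub, map_smul, fn_al_self, e1, ha, hb, smul_eq_mul]
      field_simp; ring
    · simp only [map_sub, map_smul, fn_al_self, e2, ha, hb, smul_eq_mul]
      field_simp; ring
  simp only [map_sub, map_smul, hs, ht] at h2
  simpa using h2

end

section
variable {B W : Type*} [Group W] {M : CoxeterMatrix B} (cs : CoxeterSystem M W)

/-- geometric representation -/
noncomputable def rep : W →* Module.End ℝ (B →₀ ℝ) := cs.lift ⟨rf M, rf_liftable M⟩

lemma rep_simple (s : B) : rep cs (cs.simple s) = rf M s := cs.lift_apply_simple _ s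

lemma rep_mul (g h : W) (v : B →₀ ℝ) : rep cs (g * h) v = rep cs g (rep cs h v) := by
  rw [map_mul]; rfl

lemma rep_inv (g : W) (v : B →₀ ℝ) : rep cs g⁻¹ (rep cs g v) = v := by
  rw [← rep_mul]; simp

lemma rep_inv' (g : W) (v : B →₀ ℝ) : rep cs g (rep cs g⁻¹ v) = v := by
  rw [← rep_mul]; simp

lemma rep_inj (g : W) : Function.Injective (rep cs g) := fun v w h => by
  rw [← rep_inv cs g v, h, rep_inv]

lemma rep_alt (s t : B) (h : M s t ≠ 1) (k : ℕ) :
    rep cs (cs.wordProd (CoxeterSystem.alternatingWord s t k)) (al s) =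
      if Even k then U (M s t) (k+1) • al s + U (M s t) k • al t
      else U (M s t) k • al s + U (M s t) (k+1) • al t := by
  induction k with
  | zero => simp [CoxeterSystem.alternatingWord, U_zero, U_one h]
  | succ k ih =>
    rw [CoxeterSystem.alternatingWord_succ', cs.wordProd_cons, rep_mul, ih, rep_simple]
    by_cases hk : Even k
    · simp only [hk, if_true, Nat.even_add_one, not_true_eq_false, if_false]
      rw [rf_comb, ← U_rec]
    · simp only [hk, if_false, Nat.even_add_one, not_false_eq_true, if_true]
      rw [add_comm, rf_comb, M.symmetric t s, ← U_rec, add_comm]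

lemma rep_nonneg_aux : ∀ (n : ℕ) (w : W) (s : B), cs.length w = n →
    cs.length w < cs.length (w * cs.simple s) → 0 ≤ rep cs w (al s) := by
  intro n
  induction n using Nat.strong_induction_on with
  | _ n ih =>
  intro w s hn hs
  by_cases hw : w = 1
  · subst hw; simp [al]
  obtain ⟨t, ht⟩ := cs.exists_rightDescent_of_ne_one hw
  have hst : s ≠ t := by rintro rfl; exact absurd ht (not_lt.2 hs.le)
  have h1 : M s t ≠ 1 := M.off_diagonal s t hst
  let P : ℕ → Prop := fun m => ∃ v k, 1 ≤ k ∧ w = v * cs.wordProd (CoxeterSystem.alternatingWord s t k) ∧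
    cs.length w = cs.length v + k ∧ cs.length v = m
  have hP : ∃ m, P m := by
    refine ⟨_, w * cs.simple t, 1, le_rfl, ?_, ?_, rfl⟩
    · simp [CoxeterSystem.alternatingWord]
    · rw [cs.isRightDescent_iff] at ht; omega
  classical
  obtain ⟨v, k, hk, hwv, hl, hv⟩ := Nat.find_spec hP
  have hmin := fun m => @Nat.find_min _ _ hP m
  rw [← hv] at hmin
  have hvr : ∀ r : B, (r = if Even k then t else s) → cs.length v < cs.length (v * cs.simple r) := by
    intro r hr
    by_contra hlt
    have h' : cs.IsRightDescent v r := by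
      rcases cs.length_mul_simple v r with h | h
      · omega
      · rw [cs.isRightDescent_iff]; exact h
    refine hmin _ h' ⟨v * cs.simple r, k+1, by omega, ?_, ?_, rfl⟩
    · rw [CoxeterSystem.alternatingWord_succ', ← hr, cs.wordProd_cons, hwv]; simp [mul_assoc]
    · rw [cs.isRightDescent_iff] at h'; omega
  have hvr' : ∀ r : B, (r = if Even k then s else t) → cs.length v < cs.length (v * cs.simple r) := by
    intro r hr
    obtain ⟨j, rfl⟩ : ∃ j, k = j + 1 := ⟨k-1, by omega⟩
    have e : w = (v * cs.simple r) * cs.wordProd (CoxeterSystem.alternatingWord s t j) := by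
      rw [hwv, CoxeterSystem.alternatingWord_succ', cs.wordProd_cons, ← mul_assoc]
      congr 3
      rw [hr]; by_cases hj : Even j <;> simp [hj, Nat.even_add_one]
    have h2 := cs.length_mul_le (v * cs.simple r) (cs.wordProd (CoxeterSystem.alternatingWord s t j))
    have h3 := cs.length_wordProd_le (CoxeterSystem.alternatingWord s t j)
    rw [CoxeterSystem.length_alternatingWord] at h3
    rw [← e] at h2
    omega
  have hvs : 0 ≤ rep cs v (al s) := by
    apply ih (cs.length v) (by omega) v s rfl
    by_cases hk : Even k
    · exact hvr' s (by simp [hk])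
    · exact hvr s (by simp [hk])
  have hvt : 0 ≤ rep cs v (al t) := by
    apply ih (cs.length v) (by omega) v t rfl
    by_cases hk : Even k
    · exact hvr t (by simp [hk])
    · exact hvr' t (by simp [hk])
  have hred : cs.IsReduced (CoxeterSystem.alternatingWord s t k) := by
    have h2 := cs.length_mul_le v (cs.wordProd (CoxeterSystem.alternatingWord s t k))
    have h3 := cs.length_wordProd_le (CoxeterSystem.alternatingWord s t k)
    rw [CoxeterSystem.IsReduced]
    rw [← hwv] at h2
    rw [CoxeterSystem.length_alternatingWord] at h3 ⊢
    omega
  have hkM : M s t = 0 ∨ k + 1 ≤ M s t := by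
    by_contra hcon
    push Not at hcon
    obtain ⟨h0, hk2⟩ := hcon
    rcases (by omega : k = M s t ∨ k > M s t) with hk3 | hk3
    · have hb := cs.wordProd_braidWord_eq s t
      unfold CoxeterSystem.braidWord at hb
      rw [M.symmetric t s, ← hk3] at hb
      obtain ⟨j, rfl⟩ : ∃ j, k = j + 1 := ⟨k-1, by omega⟩
      have e : w * cs.simple s = v * cs.wordProd (CoxeterSystem.alternatingWord s t j) := by
        rw [hwv, hb, CoxeterSystem.alternatingWord_succ, cs.wordProd_concat]; simp [mul_assoc]
      have h2 := cs.length_mul_le v (cs.wordProd (CoxeterSystem.alternatingWord s t j))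
      have h3 := cs.length_wordProd_le (CoxeterSystem.alternatingWord s t j)
      rw [CoxeterSystem.length_alternatingWord] at h3
      rw [← e] at h2
      omega
    · exact cs.not_isReduced_alternatingWord s t h0 hk3 hred
  have u1 : 0 ≤ U (M s t) k := U_nonneg h1 (by omega)
  have u2 : 0 ≤ U (M s t) (k+1) := U_nonneg h1 hkM
  rw [hwv, rep_mul, rep_alt cs s t h1]
  have key : ∀ a b : ℝ, 0 ≤ a → 0 ≤ b → 0 ≤ rep cs v (a • al s + b • al t) := by
    intro a b ha hb
    rw [map_add, map_smul, map_smul]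
    intro i
    have := hvs i
    have := hvt i
    simp at *
    positivity
  split_ifs
  · exact key _ _ u2 u1
  · exact key _ _ u1 u2

lemma rep_nonneg {w : W} {s : B} (h : ¬ cs.IsRightDescent w s) : 0 ≤ rep cs w (al s) := by
  apply rep_nonneg_aux cs _ w s rfl
  rw [cs.not_isRightDescent_iff] at h; omega

lemma rep_mul_simple_al (w : W) (s : B) : rep cs (w * cs.simple s) (al s) = - rep cs w (al s) := by
  rw [rep_mul, rep_simple, rf_al_self, map_neg]

lemma rep_nonpos {w : W} {s : B} (h : cs.IsRightDescent w s) : rep cs w (al s) ≤ 0 := by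
  have := rep_nonneg cs (cs.isRightDescent_iff_not_isRightDescent_mul.1 h)
  rw [rep_mul_simple_al] at this
  simpa using this

end
end Cox

namespace Cox
section
variable {B W : Type*} [Group W] {M : CoxeterMatrix B} (cs : CoxeterSystem M W)

/-- positive roots -/
def PR : Set (B →₀ ℝ) := {v | 0 ≤ v ∧ ∃ w s, v = rep cs w (al s)}

lemma bf_rep (w : W) : ∀ v, bf M (rep cs w v) (rep cs w v) = bf M v v := by
  induction w using cs.simple_induction_left with
  | one => simp
  | mul_simple_left w i ih => intro v; rw [rep_mul, rep_simple, bf_rf, ih]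

lemma root_or (w : W) (s : B) : rep cs w (al s) ∈ PR cs ∨ -(rep cs w (al s)) ∈ PR cs := by
  by_cases h : cs.IsRightDescent w s
  · exact Or.inr ⟨by simpa using rep_nonpos cs h, w * cs.simple s, s, (rep_mul_simple_al cs w s).symm⟩
  · exact Or.inl ⟨rep_nonneg cs h, w, s, rfl⟩

lemma pr_act {v : B →₀ ℝ} (hv : v ∈ PR cs) (g : W) : rep cs g v ∈ PR cs ∨ -(rep cs g v) ∈ PR cs := by
  obtain ⟨_, w, s, rfl⟩ := hv
  rw [← rep_mul]; exact root_or cs _ _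

lemma pr_bf {v : B →₀ ℝ} (hv : v ∈ PR cs) : bf M v v = 2 := by
  obtain ⟨_, w, s, rfl⟩ := hv
  rw [bf_rep, bf_al, fn_al_self]

lemma pr_ne {v : B →₀ ℝ} (hv : v ∈ PR cs) : v ≠ 0 := by
  rintro rfl
  simpa using pr_bf cs hv

lemma pr_neg {v : B →₀ ℝ} (hv : v ∈ PR cs) : -v ∉ PR cs := by
  intro h
  have h1 := hv.1
  have h2 := h.1
  exact pr_ne cs hv (le_antisymm (by simpa using h2) h1)

lemma al_mem (s : B) : al s ∈ PR cs := ⟨by simp [al], 1, s, by simp⟩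

lemma pr_simple {v : B →₀ ℝ} (hv : v ∈ PR cs) {s : B} (hs : v ≠ al s) : rf M s v ∈ PR cs := by
  have h := pr_act cs hv (cs.simple s)
  rw [rep_simple] at h
  refine h.resolve_right fun h => hs ?_
  have hz : ∀ i, i ≠ s → v i = 0 := by
    intro i hi
    have h1 := hv.1 i
    have h2 := h.1 i
    simp [rf_apply, al, Finsupp.single_apply, hi.symm] at h1 h2
    linarith
  have hvs : v = v s • al s := by
    ext i
    by_cases hi : i = s
    · subst hi; simp [al]
    · simp [al, Finsupp.single_apply, Ne.symm hi, hz i hi]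
  have hb := pr_bf cs hv
  rw [hvs] at hb
  simp only [map_smul, LinearMap.smul_apply, bf_al, fn_al_self, smul_eq_mul] at hb
  have h0 : 0 ≤ v s := hv.1 s
  have h1 : v s = 1 := by nlinarith
  rw [hvs, h1, one_smul]

lemma inv_finite (g : W) : {v | v ∈ PR cs ∧ rep cs g v ∉ PR cs}.Finite := by
  induction g using cs.simple_induction_right with
  | one => convert Set.finite_empty; ext v; simp
  | mul_simple_right w s ih =>
    refine ((Set.finite_singleton (al s)).union
      (ih.preimage (rep_inj cs (cs.simple s)).injOn)).subset ?_
    rintro v ⟨hv, h⟩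
    by_cases hs : v = al s
    · left; exact hs
    · right
      refine ⟨?_, ?_⟩
      · rw [rep_simple]; exact pr_simple cs hv hs
      · rwa [← rep_mul]

/-- contragredient action -/
noncomputable def act (g : W) (x : (B →₀ ℝ) →ₗ[ℝ] ℝ) : (B →₀ ℝ) →ₗ[ℝ] ℝ := x ∘ₗ rep cs g⁻¹

lemma act_apply (g : W) (x : (B →₀ ℝ) →ₗ[ℝ] ℝ) (v) : act cs g x v = x (rep cs g⁻¹ v) := rfl

lemma act_one (x : (B →₀ ℝ) →ₗ[ℝ] ℝ) : act cs 1 x = x := by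
  ext v; simp [act_apply]

lemma act_mul (g h : W) (x : (B →₀ ℝ) →ₗ[ℝ] ℝ) : act cs (g * h) x = act cs g (act cs h x) := by
  apply LinearMap.ext; intro v
  simp only [act_apply, mul_inv_rev, rep_mul]

/-- interior of the Tits cone -/
def InU (x : (B →₀ ℝ) →ₗ[ℝ] ℝ) : Prop := {v | v ∈ PR cs ∧ x v ≤ 0}.Finite

lemma InU.act {x : (B →₀ ℝ) →ₗ[ℝ] ℝ} (hx : InU cs x) (g : W) : InU cs (act cs g x) := by
  refine ((inv_finite cs g⁻¹).union (Set.Finite.preimage (rep_inj cs g⁻¹).injOn hx)).subset ?_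
  rintro v ⟨hv, h⟩
  by_cases hs : rep cs g⁻¹ v ∈ PR cs
  · right; exact ⟨hs, h⟩
  · left; exact ⟨hv, hs⟩

lemma InU.add {x y : (B →₀ ℝ) →ₗ[ℝ] ℝ} (hx : InU cs x) (hy : InU cs y) : InU cs (x + y) := by
  refine (Set.Finite.union hx hy).subset ?_
  rintro v ⟨hv, h⟩
  rw [LinearMap.add_apply] at h
  by_cases hs : x v ≤ 0
  · left; exact ⟨hv, hs⟩
  · right; exact ⟨hv, by linarith⟩

lemma InU.smul {x : (B →₀ ℝ) →ₗ[ℝ] ℝ} (hx : InU cs x) {c : ℝ} (hc : 0 < c) : InU cs (c • x) := by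
  refine Set.Finite.subset hx ?_
  rintro v ⟨hv, h⟩
  refine ⟨hv, ?_⟩
  rw [LinearMap.smul_apply, smul_eq_mul] at h
  by_contra h'
  push Not at h'
  nlinarith [mul_pos hc h']

lemma fun_nonneg {x : (B →₀ ℝ) →ₗ[ℝ] ℝ} (hx : ∀ s, 0 ≤ x (al s)) {v : B →₀ ℝ} (hv : 0 ≤ v) :
    0 ≤ x v := by
  have e : v = v.sum fun s c => c • al s := by
    conv_lhs => rw [← Finsupp.sum_single v]
    simp [al]
  rw [e, map_finsuppSum]
  apply Finset.sum_nonneg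
  intro s _
  simp only [map_smul, smul_eq_mul]
  exact mul_nonneg (hv s) (hx s)

/-- interior point of the fundamental chamber -/
noncomputable def rho : (B →₀ ℝ) →ₗ[ℝ] ℝ := Finsupp.linearCombination ℝ (fun _ => 1)

lemma rho_pos {v : B →₀ ℝ} (hv : v ∈ PR cs) : 0 < rho v := by
  have h : rho v = ∑ s ∈ v.support, v s := by
    simp [rho, Finsupp.linearCombination_apply, Finsupp.sum]
  rw [h]
  apply Finset.sum_pos
  · intro s hs
    exact lt_of_le_of_ne (hv.1 s) (Finsupp.mem_support_iff.1 hs).symm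
  · exact Finsupp.support_nonempty_iff.2 (pr_ne cs hv)

lemma rho_InU : InU cs rho := by
  unfold InU
  convert Set.finite_empty
  ext v
  simp only [Set.mem_setOf_eq, Set.mem_empty_iff_false, iff_false, not_and, not_le]
  exact fun h => rho_pos cs h

lemma exists_dom : ∀ (n : ℕ) (x : (B →₀ ℝ) →ₗ[ℝ] ℝ), InU cs x →
    {v | v ∈ PR cs ∧ x v < 0}.ncard = n → ∃ w, ∀ s, 0 ≤ act cs w x (al s) := by
  intro n
  induction n using Nat.strong_induction_on with
  | _ n ih =>
  intro x hx hn
  by_cases hd : ∀ s, 0 ≤ x (al s)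
  · exact ⟨1, by simpa [act_one] using hd⟩
  push Not at hd
  obtain ⟨s, hs⟩ := hd
  have hfin : {v | v ∈ PR cs ∧ x v < 0}.Finite := Set.Finite.subset hx fun v hv => ⟨hv.1, hv.2.le⟩
  have hlt : {v | v ∈ PR cs ∧ act cs (cs.simple s) x v < 0}.ncard < n := by
    rw [← hn, ← Set.ncard_image_of_injective _ (rep_inj cs (cs.simple s))]
    apply Set.ncard_lt_ncard _ hfin
    rw [Set.ssubset_iff_of_subset]
    · refine ⟨al s, ⟨al_mem cs s, hs⟩, ?_⟩
      rintro ⟨v, ⟨hv, -⟩, h⟩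
      rw [rep_simple] at h
      have : v = - al s := by rw [← rf_rf M s v, h, rf_al_self]
      exact pr_neg cs (al_mem cs s) (this ▸ hv)
    · rintro _ ⟨v, ⟨hv, h⟩, rfl⟩
      rw [act_apply, cs.inv_simple] at h
      refine ⟨?_, h⟩
      rw [rep_simple] at h ⊢
      apply pr_simple cs hv
      rintro rfl
      rw [rf_al_self, map_neg] at h
      linarith
  obtain ⟨w, hw⟩ := ih _ hlt _ (hx.act cs _) rfl
  exact ⟨w * cs.simple s, by simpa only [act_mul] using hw⟩

lemma act_simple_of {x : (B →₀ ℝ) →ₗ[ℝ] ℝ} {s : B} (h : x (al s) = 0) :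
    act cs (cs.simple s) x = x := by
  apply LinearMap.ext; intro v
  rw [act_apply, cs.inv_simple, rep_simple, rf_apply, map_sub, map_smul, h]; simp

lemma zero_of_act_simple {x : (B →₀ ℝ) →ₗ[ℝ] ℝ} {s : B} (h : act cs (cs.simple s) x = x) :
    x (al s) = 0 := by
  have h := LinearMap.congr_fun h (al s)
  rw [act_apply, cs.inv_simple, rep_simple, rf_al_self, map_neg] at h
  linarith

lemma act_of_mem {x : (B →₀ ℝ) →ₗ[ℝ] ℝ} {T : Set B} (hT : ∀ s ∈ T, x (al s) = 0) {w : W}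
    (hw : w ∈ cs.parabolic T) : act cs w x = x := by
  unfold CoxeterSystem.parabolic at hw
  induction hw using Subgroup.closure_induction with
  | mem w hw => obtain ⟨s, hs, rfl⟩ := hw; exact act_simple_of cs (hT s hs)
  | one => exact act_one cs x
  | mul a b _ _ ha hb => rw [act_mul, hb, ha]
  | inv a _ ha =>
    conv_lhs => rw [← ha]
    rw [← act_mul]; simp [act_one]

lemma stab_aux {x : (B →₀ ℝ) →ₗ[ℝ] ℝ} (hx : ∀ s, 0 ≤ x (al s)) : ∀ (n : ℕ) (w : W),
    cs.length w = n → (∀ s, 0 ≤ act cs w x (al s)) →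
    act cs w x = x ∧ w ∈ cs.parabolic {s | x (al s) = 0} := by
  intro n
  induction n using Nat.strong_induction_on with
  | _ n ih =>
  intro w hn hw
  by_cases h1 : w = 1
  · subst h1; exact ⟨act_one cs x, one_mem _⟩
  obtain ⟨s, hs⟩ := cs.exists_rightDescent_of_ne_one h1
  have hneg := rep_nonpos cs hs
  have h2 : 0 ≤ act cs w x (-(rep cs w (al s))) := fun_nonneg hw (by simpa using hneg)
  rw [map_neg, act_apply, rep_inv] at h2
  have h0 : x (al s) = 0 := le_antisymm (by linarith) (hx s)
  have hsx := act_simple_of cs h0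
  have e : act cs (w * cs.simple s) x = act cs w x := by rw [act_mul, hsx]
  obtain ⟨h3, h4⟩ := ih (cs.length (w * cs.simple s)) (hn ▸ hs) (w * cs.simple s) rfl
    (by rw [e]; exact hw)
  refine ⟨e ▸ h3, ?_⟩
  have : w = (w * cs.simple s) * cs.simple s := by simp
  rw [this]
  exact mul_mem h4 (Subgroup.subset_closure ⟨s, h0, rfl⟩)

lemma spherical_of_dom {x : (B →₀ ℝ) →ₗ[ℝ] ℝ} (hU : InU cs x) (hx : ∀ s, 0 ≤ x (al s)) :
    cs.IsSpherical {s | x (al s) = 0} := by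
  unfold CoxeterSystem.IsSpherical
  have hfin : {v | v ∈ PR cs ∧ x v ≤ 0}.powerset.Finite := Set.Finite.powerset hU
  let N : W → Set (B →₀ ℝ) := fun w => {v | v ∈ PR cs ∧ rep cs w v ∉ PR cs}
  have hN : Function.Injective N := by
    intro w v h
    by_contra hne
    have hu : w * v⁻¹ ≠ 1 := fun h => hne (mul_inv_eq_one.1 h)
    obtain ⟨s, hs⟩ := cs.exists_rightDescent_of_ne_one hu
    have hneg : -(rep cs (w * v⁻¹) (al s)) ∈ PR cs := by
      refine (root_or cs _ s).resolve_left fun h => pr_ne cs h ?_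
      exact le_antisymm (rep_nonpos cs hs) h.1
    rw [rep_mul] at hneg
    rcases root_or cs v⁻¹ s with hb | hb
    · have hm : rep cs v⁻¹ (al s) ∈ N w := ⟨hb, fun h => pr_neg cs h hneg⟩
      rw [h] at hm
      exact hm.2 (by rw [rep_inv']; exact al_mem cs s)
    · have hm : -(rep cs v⁻¹ (al s)) ∈ N v := by
        refine ⟨hb, ?_⟩
        rw [map_neg, rep_inv']; exact pr_neg cs (al_mem cs s)
      rw [← h] at hm
      exact hm.2 (by rw [map_neg]; exact hneg)
  refine (hfin.preimage (f := N) hN.injOn).subset ?_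
  intro w hw
  rw [Set.mem_preimage, Set.mem_powerset_iff]
  rintro v ⟨hv, h⟩
  refine ⟨hv, ?_⟩
  have h1 := (pr_act cs hv w).resolve_left h
  have h2 := fun_nonneg hx h1.1
  have h3 := LinearMap.congr_fun (act_of_mem cs (x := x) (T := {s | x (al s) = 0}) (fun s hs => hs) hw)
    (rep cs w v)
  rw [act_apply, rep_inv] at h3
  rw [map_neg] at h2
  linarith

lemma exists_avg (H : Subgroup W) (hH : (H : Set W).Finite) : ∃ S : Finset W,
    (∀ w, w ∈ S ↔ w ∈ H) ∧ InU cs (∑ h ∈ S, act cs h rho) ∧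
    ∀ h ∈ H, act cs h (∑ h ∈ S, act cs h rho) = ∑ h ∈ S, act cs h rho := by
  refine ⟨hH.toFinset, fun w => by simp, ?_, ?_⟩
  · apply Finset.sum_induction_nonempty _ (InU cs) (fun a b ha hb => ha.add cs hb)
    · exact ⟨1, by simp [H.one_mem]⟩
    · intro h _; exact (rho_InU cs).act cs h
  · intro h hh
    have : act cs h (∑ h ∈ hH.toFinset, act cs h rho) = ∑ k ∈ hH.toFinset, act cs (h * k) rho := by
      apply LinearMap.ext; intro v
      simp only [act_apply, LinearMap.sum_apply, mul_inv_rev, rep_mul]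
    rw [this]
    apply Finset.sum_bij' (fun k _ => h * k) (fun k _ => h⁻¹ * k)
    · intro k hk; simp at hk ⊢; exact H.mul_mem hh hk
    · intro k hk; simp at hk ⊢; exact H.mul_mem (H.inv_mem hh) hk
    · simp
    · simp
    · simp

lemma finite_subgroup (H : Subgroup W) (hH : (H : Set W).Finite) : ∃ (w : W) (T : Set B),
    cs.IsSpherical T ∧ ∀ h ∈ H, w * h * w⁻¹ ∈ cs.parabolic T := by
  obtain ⟨S, -, hU, hfix⟩ := exists_avg cs H hH
  set x := ∑ h ∈ S, act cs h rho
  obtain ⟨w, hw⟩ := exists_dom cs _ x hU rfl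
  refine ⟨w, _, spherical_of_dom cs (hU.act cs w) hw, fun h hh => ?_⟩
  have e : act cs (w * h * w⁻¹) (act cs w x) = act cs w x := by
    rw [← act_mul, inv_mul_cancel_right, act_mul, hfix h hh]
  exact (stab_aux cs hw _ _ rfl (by rw [e]; exact hw)).2

lemma coeff_fix {T : Set B} {s : B} (hs : s ∉ T) {w : W} (hw : w ∈ cs.parabolic T) :
    ∀ v : B →₀ ℝ, (rep cs w v) s = v s := by
  unfold CoxeterSystem.parabolic at hw
  induction hw using Subgroup.closure_induction with
  | mem w hw =>
    obtain ⟨t, ht, rfl⟩ := hw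
    intro v
    have : t ≠ s := by rintro rfl; exact hs ht
    rw [rep_simple, rf_apply]; simp [al, Finsupp.single_apply, this]
  | one => simp
  | mul a b _ _ ha hb => intro v; rw [rep_mul, ha, hb]
  | inv a _ ha => intro v; rw [← ha, rep_inv']

lemma exists_pt {T : Set B} (hT : cs.IsSpherical T) : ∃ x : (B →₀ ℝ) →ₗ[ℝ] ℝ, InU cs x ∧
    (∀ s ∈ T, x (al s) = 0) ∧ ∀ s, s ∉ T → 0 < x (al s) := by
  obtain ⟨S, hS, hU, hfix⟩ := exists_avg cs (cs.parabolic T) hT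
  refine ⟨_, hU, fun s hs => ?_, fun s hs => ?_⟩
  · exact zero_of_act_simple cs (hfix _ (Subgroup.subset_closure ⟨s, hs, rfl⟩))
  · rw [LinearMap.sum_apply]
    apply Finset.sum_pos
    · intro h hh
      rw [act_apply]
      apply rho_pos cs
      refine (root_or cs h⁻¹ s).resolve_right fun hn => ?_
      have h1 := hn.1 s
      rw [Finsupp.neg_apply, coeff_fix cs hs (inv_mem ((hS h).1 hh))] at h1
      norm_num [al] at h1
    · exact ⟨1, (hS 1).2 (one_mem _)⟩

lemma max_conj [Finite B] {T T' : Set B} (hT : cs.IsMaxSpherical T) (hT' : cs.IsMaxSpherical T') {g : W}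
    (h : ∀ u ∈ cs.parabolic T, g⁻¹ * u * g ∈ cs.parabolic T') :
    T' = T ∧ g ∈ cs.parabolic T' := by
  obtain ⟨x, hxU, hx0, hx1⟩ := exists_pt cs hT.1
  obtain ⟨x', hxU', hx0', hx1'⟩ := exists_pt cs hT'.1
  have hd' : ∀ s, 0 ≤ x' (al s) := fun s => by
    by_cases hs : s ∈ T'
    · exact (hx0' s hs).ge
    · exact (hx1' s hs).le
  have hz' : {s | x' (al s) = 0} = T' := by
    ext s
    refine ⟨fun hs => ?_, hx0' s⟩
    by_contra hn
    exact (hx1' s hn).ne' hs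
  set y := act cs g x' with hy
  have hyU : InU cs y := hxU'.act cs g
  have hy0 : ∀ s ∈ T, y (al s) = 0 := by
    intro s hs
    apply zero_of_act_simple cs
    have e := act_of_mem cs hx0' (h (cs.simple s) (Subgroup.subset_closure ⟨s, hs, rfl⟩))
    rw [hy]
    conv_rhs => rw [← e]
    rw [← act_mul, ← act_mul]; congr 1; group
  have hyd : ∀ s, 0 ≤ y (al s) := by
    by_contra hcon
    push Not at hcon
    obtain ⟨s, ⟨hs, hmin⟩⟩ := Set.exists_min_image {s | y (al s) < 0}
      (fun s => x (al s) / (- y (al s))) (Set.toFinite _) hcon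
    simp only [Set.mem_setOf_eq] at hs hmin
    have hsT : s ∉ T := fun hsT => by rw [hy0 s hsT] at hs; exact lt_irrefl _ hs
    set c := x (al s) / (- y (al s)) with hc
    have hcpos : 0 < c := div_pos (hx1 s hsT) (by linarith)
    have hzd : ∀ r, 0 ≤ (x + c • y) (al r) := by
      intro r
      have hxr : 0 ≤ x (al r) := by
        by_cases hr : r ∈ T
        · exact (hx0 r hr).ge
        · exact (hx1 r hr).le
      simp only [LinearMap.add_apply, LinearMap.smul_apply, smul_eq_mul]
      by_cases hr : y (al r) < 0
      · have := hmin r hr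
        rw [le_div_iff₀ (by linarith)] at this
        linarith
      · push Not at hr; positivity
    have hsph := spherical_of_dom cs (hxU.add cs (hyU.smul cs hcpos)) hzd
    have heq := hT.2 _ hsph (fun r hr => by simp [hx0 r hr, hy0 r hr])
    apply hsT
    rw [← heq]
    simp only [Set.mem_setOf_eq, LinearMap.add_apply, LinearMap.smul_apply, smul_eq_mul, hc]
    have : y (al s) ≠ 0 := hs.ne
    field_simp; ring
  obtain ⟨e1, e2⟩ := stab_aux cs hd' _ g rfl hyd
  rw [hz'] at e2
  refine ⟨hT.2 T' hT'.1 ?_, e2⟩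
  intro s hs
  rw [← hz']
  have := hy0 s hs
  rw [hy, e1] at this
  exact this

lemma exists_max [Finite B] {T : Set B} (hT : cs.IsSpherical T) : ∃ U, T ⊆ U ∧ cs.IsMaxSpherical U := by
  obtain ⟨U, hU, hm⟩ := Finite.exists_le_maximal (p := fun U : Set B => cs.IsSpherical U) hT
  exact ⟨U, hU, hm.1, fun V hV hUV => le_antisymm (hm.2 hV hUV) hUV⟩

lemma finite_subgroup_max [Finite B] (H : Subgroup W) (hH : (H : Set W).Finite) : ∃ (w : W) (T : Set B),
    cs.IsMaxSpherical T ∧ ∀ h ∈ H, w⁻¹ * h * w ∈ cs.parabolic T := by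
  obtain ⟨w, T, hT, h⟩ := finite_subgroup cs H hH
  obtain ⟨U, hTU, hU⟩ := exists_max cs hT
  refine ⟨w⁻¹, U, hU, fun u hu => ?_⟩
  rw [inv_inv]
  exact Subgroup.closure_mono (Set.image_mono hTU) (h u hu)

end
end Cox

/-- If `φ : W → W'` is an isomorphism between Coxeter groups, then for each maximal spherical
subset `T ⊆ S` there is a unique maximal spherical subset `T' ⊆ S'` such that
`φ (W_T) = w' W'_{T'} (w')⁻¹` for some `w' ∈ W'`. -/
theorem existsUnique_maxSpherical_conj {B W B' W' : Type*} [Group W] [Group W']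
    [Finite B] [Finite B'] {M : CoxeterMatrix B} {M' : CoxeterMatrix B'}
    (cs : CoxeterSystem M W) (cs' : CoxeterSystem M' W') (φ : W ≃* W')
    (T : Set B) (hT : cs.IsMaxSpherical T) :
    ∃! T' : Set B', cs'.IsMaxSpherical T' ∧ ∃ w' : W',
      Subgroup.map φ.toMonoidHom (cs.parabolic T) =
        Subgroup.map (MulAut.conj w').toMonoidHom (cs'.parabolic T') := by
  obtain ⟨w', T', hT', h1⟩ := Cox.finite_subgroup_max cs'
    (Subgroup.map φ.toMonoidHom (cs.parabolic T)) (by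
      rw [Subgroup.coe_map]; exact Set.Finite.image _ hT.1)
  obtain ⟨g, T₂, hT₂, h2⟩ := Cox.finite_subgroup_max cs
    (Subgroup.map φ.symm.toMonoidHom (Subgroup.map (MulAut.conj w').toMonoidHom (cs'.parabolic T'))) (by
      rw [Subgroup.coe_map, Subgroup.coe_map]; exact Set.Finite.image _ (Set.Finite.image _ hT'.1))
  have h1' : ∀ u ∈ cs.parabolic T, w'⁻¹ * φ u * w' ∈ cs'.parabolic T' :=
    fun u hu => h1 _ ⟨u, hu, rfl⟩
  have h2' : ∀ u ∈ cs'.parabolic T', g⁻¹ * φ.symm (w' * u * w'⁻¹) * g ∈ cs.parabolic T₂ :=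
    fun u hu => h2 _ ⟨_, ⟨u, hu, rfl⟩, rfl⟩
  obtain ⟨rfl, hg⟩ := Cox.max_conj cs hT hT₂ (g := g) (fun u hu => by
    have := h2' _ (h1' u hu)
    simpa [mul_assoc] using this)
  refine ⟨T', ⟨hT', w', ?_⟩, ?_⟩
  · apply le_antisymm
    · rintro _ ⟨u, hu, rfl⟩
      refine ⟨_, h1' u hu, ?_⟩
      simp [mul_assoc]
    · rintro _ ⟨u, hu, rfl⟩
      refine ⟨φ.symm (w' * u * w'⁻¹), ?_, by simp⟩
      have h3 := mul_mem (mul_mem hg (h2' u hu)) (inv_mem hg)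
      have e : g * (g⁻¹ * φ.symm (w' * u * w'⁻¹) * g) * g⁻¹ = φ.symm (w' * u * w'⁻¹) := by group
      rw [e] at h3
      exact h3
  · rintro T₃ ⟨hT₃, v, hv⟩
    refine (Cox.max_conj cs' hT₃ hT' (g := v⁻¹ * w') fun u hu => ?_).1.symm
    have hm : v * u * v⁻¹ ∈ Subgroup.map φ.toMonoidHom (cs.parabolic T₂) := by
      rw [hv]; exact ⟨u, hu, rfl⟩
    have := h1 _ hm
    simpa [mul_assoc] using this
end
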